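/- Let q ≥ 1 and let ν be a finite unitary ensemble on U(q) with unitaries U_1, …, U_m and weights p_1, …, p_m ≥ 0 summing to 1, and let ν†∗ν be the ensemble assigning weight p_j·p_k to U_j†·U_k. Define the spectral gap Δ_ν^{(t)} := 1 − ‖M_ν^{(t)} − M_Haar^{(t)}‖. (a) If the support {U_j†U_k : p_j p_k > 0} of ν†∗ν is a universal gate set on U(q), then there exists a constant B > 0 such that Δ_ν^{(t)} > B·(log t)^{−2} for every integer t ≥ 2. (b) If the support of ν†∗ν is not a universal gate set, then there exists t₀ such that Δ_ν^{(t)} = 0 for every t ≥ t₀. -/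

import Mathlib

open MeasureTheory

noncomputable instance (q : ℕ) : MeasurableSpace (Matrix.unitaryGroup (Fin q) ℂ) := borel _
instance (q : ℕ) : BorelSpace (Matrix.unitaryGroup (Fin q) ℂ) := ⟨rfl⟩

/-- The operator norm of a square complex matrix (largest singular value). -/
noncomputable def opNorm {n : Type*} [Fintype n] [DecidableEq n] (A : Matrix n n ℂ) : ℝ :=
  ‖Matrix.toEuclideanCLM (𝕜 := ℂ) A‖

/-- The phase-invariant distance `D(V,W) = min_{φ ∈ [0,2π)} ‖V - e^{iφ} W‖`. -/
noncomputable def Ddist (q : ℕ) (V W : Matrix (Fin q) (Fin q) ℂ) : ℝ :=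
  sInf ((fun φ : ℝ => opNorm (V - Complex.exp (φ * Complex.I) • W)) '' Set.Ico 0 (2 * Real.pi))

/-- A set `S` of unitaries is a universal gate set if every unitary can be approximated,
up to a global phase and to arbitrary precision, by finite products of elements of `S`. -/
def IsUniversalGateSet (q : ℕ) (S : Set (Matrix.unitaryGroup (Fin q) ℂ)) : Prop :=
  ∀ V : Matrix.unitaryGroup (Fin q) ℂ, ∀ ε : ℝ, 0 < ε →
    ∃ ws : List (Matrix.unitaryGroup (Fin q) ℂ), (∀ w ∈ ws, w ∈ S) ∧
      Ddist q (V : Matrix (Fin q) (Fin q) ℂ)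
        ((ws.prod : Matrix.unitaryGroup (Fin q) ℂ) : Matrix (Fin q) (Fin q) ℂ) ≤ ε

/-- The matrix `U^{⊗t,t} = U^{⊗t} ⊗ (conj U)^{⊗t}`. -/
def tensorTT (q t : ℕ) (U : Matrix (Fin q) (Fin q) ℂ) :
    Matrix ((Fin t → Fin q) × (Fin t → Fin q)) ((Fin t → Fin q) × (Fin t → Fin q)) ℂ :=
  Matrix.of fun i j => (∏ s, U (i.1 s) (j.1 s)) * ∏ s, (starRingEnd ℂ) (U (i.2 s) (j.2 s))

/-- The `t`-th moment operator `M_ν^{(t)} = ∑ₖ pₖ Uₖ^{⊗t,t}` of a finite unitary ensemble. -/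
noncomputable def momentOp (q t m : ℕ) (p : Fin m → ℝ)
    (U : Fin m → Matrix.unitaryGroup (Fin q) ℂ) :
    Matrix ((Fin t → Fin q) × (Fin t → Fin q)) ((Fin t → Fin q) × (Fin t → Fin q)) ℂ :=
  ∑ k, (p k : ℂ) • tensorTT q t (U k : Matrix (Fin q) (Fin q) ℂ)

/-- The `t`-th Haar moment operator `M_Haar^{(t)} = ∫ U^{⊗t,t} dμ(U)`, defined entrywise. -/
noncomputable def MHaarOp (q t : ℕ) (μ : Measure (Matrix.unitaryGroup (Fin q) ℂ)) :
    Matrix ((Fin t → Fin q) × (Fin t → Fin q)) ((Fin t → Fin q) × (Fin t → Fin q)) ℂ :=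
  Matrix.of fun i j => ∫ U, tensorTT q t (U : Matrix (Fin q) (Fin q) ℂ) i j ∂μ

open MeasureTheory

namespace SG

abbrev G (q : ℕ) := Matrix.unitaryGroup (Fin q) ℂ
abbrev Idx (q t : ℕ) := (Fin t → Fin q) × (Fin t → Fin q)

lemma tensorTT_mul (q t : ℕ) (A B : Matrix (Fin q) (Fin q) ℂ) :
    tensorTT q t (A * B) = tensorTT q t A * tensorTT q t B := by
  ext i j
  simp only [tensorTT, Matrix.of_apply, Matrix.mul_apply, map_sum, map_mul]
  rw [Finset.prod_univ_sum, Finset.prod_univ_sum, Fintype.sum_prod_type]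
  simp only [Fintype.piFinset_univ]
  rw [Finset.sum_mul_sum]
  refine Finset.sum_congr rfl fun x _ => Finset.sum_congr rfl fun y _ => ?_
  simp only [Finset.prod_mul_distrib]
  ring

lemma tensorTT_one (q t : ℕ) : tensorTT q t 1 = 1 := by
  ext i j
  simp only [tensorTT, Matrix.of_apply, Matrix.one_apply]
  have h : ∀ a b : Fin t → Fin q, (∏ s, (if a s = b s then (1:ℂ) else 0)) = if a = b then 1 else 0 := by
    intro a b
    split_ifs with h
    · subst h; simp
    · obtain ⟨s, hs⟩ := Function.ne_iff.mp h
      exact Finset.prod_eq_zero (Finset.mem_univ s) (by simp [hs])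
  have h2 : ∀ a b : Fin t → Fin q, (∏ s, (starRingEnd ℂ) (if a s = b s then (1:ℂ) else 0)) = if a = b then 1 else 0 := by
    intro a b
    rw [← map_prod, h]; split_ifs <;> simp
  rw [h, h2]
  rcases i with ⟨i1, i2⟩; rcases j with ⟨j1, j2⟩
  simp only [Prod.mk.injEq]
  by_cases h1 : i1 = j1 <;> by_cases h2 : i2 = j2 <;> simp [h1, h2]

lemma tensorTT_conjTranspose (q t : ℕ) (A : Matrix (Fin q) (Fin q) ℂ) :
    tensorTT q t (A.conjTranspose) = (tensorTT q t A).conjTranspose := by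
  ext i j
  simp [tensorTT, Matrix.conjTranspose_apply]

lemma tensorTT_smul (q t : ℕ) (c : ℂ) (hc : c * (starRingEnd ℂ) c = 1) (A : Matrix (Fin q) (Fin q) ℂ) :
    tensorTT q t (c • A) = tensorTT q t A := by
  ext i j
  simp only [tensorTT, Matrix.of_apply, Matrix.smul_apply, smul_eq_mul, map_mul, Finset.prod_mul_distrib,
    Finset.prod_const, Finset.card_univ, Fintype.card_fin]
  calc _ = (c * (starRingEnd ℂ) c)^t * ((∏ x, A (i.1 x) (j.1 x)) * ∏ x, (starRingEnd ℂ) (A (i.2 x) (j.2 x))) := by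
        rw [mul_pow]; ring
    _ = _ := by rw [hc]; simp

lemma continuous_tensorTT (q t : ℕ) : Continuous (tensorTT q t) := by
  refine continuous_matrix fun i j => ?_
  simp only [tensorTT, Matrix.of_apply]
  refine Continuous.mul (continuous_finsetProd _ fun s _ => ?_) (continuous_finsetProd _ fun s _ => ?_)
  · exact continuous_id.matrix_elem _ _
  · exact Complex.continuous_conj.comp (continuous_id.matrix_elem _ _)

/-- the representation `U ↦ U^{⊗t,t}` -/
noncomputable def tau (q t : ℕ) : G q →* Matrix (Idx q t) (Idx q t) ℂ where
  toFun g := tensorTT q t g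
  map_one' := tensorTT_one q t
  map_mul' a b := tensorTT_mul q t a b

lemma tau_star (q t : ℕ) (g : G q) : (tau q t g).conjTranspose = tau q t g⁻¹ := by
  simp only [tau, MonoidHom.coe_mk, OneHom.coe_mk]
  rw [← tensorTT_conjTranspose]; rfl

lemma continuous_tau (q t : ℕ) : Continuous (tau q t) :=
  (continuous_tensorTT q t).comp continuous_subtype_val

instance compactG (q : ℕ) : CompactSpace (G q) := by
  have hcl : IsClosed ((Matrix.unitaryGroup (Fin q) ℂ : Set (Matrix (Fin q) (Fin q) ℂ))) := by
    have : (Matrix.unitaryGroup (Fin q) ℂ : Set (Matrix (Fin q) (Fin q) ℂ)) = {A | star A * A = 1} := by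
      ext A; exact Matrix.mem_unitaryGroup_iff'
    rw [this]
    exact isClosed_eq (continuous_star.matrix_mul continuous_id) continuous_const
  have hsub : (Matrix.unitaryGroup (Fin q) ℂ : Set (Matrix (Fin q) (Fin q) ℂ)) ⊆
      Set.pi Set.univ fun _ => Set.pi Set.univ fun _ => Metric.closedBall (0:ℂ) 1 := by
    intro A hA i _ j _
    simpa using entry_norm_bound_of_unitary hA i j
  have hK : IsCompact (Set.pi Set.univ fun _ : Fin q => Set.pi Set.univ fun _ : Fin q => Metric.closedBall (0:ℂ) 1) :=
    isCompact_univ_pi fun _ => isCompact_univ_pi fun _ => isCompact_closedBall _ _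
  exact isCompact_iff_compactSpace.mp (hK.of_isClosed_subset hcl hsub)

instance topGroupG (q : ℕ) : IsTopologicalGroup (G q) := inferInstance

/-- matrix coefficients of degree `k`. -/
noncomputable def P (q k : ℕ) : Submodule ℂ (G q → ℂ) :=
  Submodule.span ℂ (Set.range fun ij : Idx q k × Idx q k => fun g : G q => tau q k g ij.1 ij.2)

lemma tau_mem_P (q k : ℕ) (i j : Idx q k) : (fun g : G q => tau q k g i j) ∈ P q k :=
  Submodule.subset_span ⟨(i, j), rfl⟩

lemma P_mul (q k l : ℕ) {f h : G q → ℂ} (hf : f ∈ P q k) (hh : h ∈ P q l) : f * h ∈ P q (k + l) := by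
  induction hf using Submodule.span_induction with
  | zero => simp
  | add x y _ _ hx hy => rw [add_mul]; exact add_mem hx hy
  | smul c x _ hx => rw [smul_mul_assoc]; exact Submodule.smul_mem _ _ hx
  | mem x hx =>
    obtain ⟨⟨i, j⟩, rfl⟩ := hx
    induction hh using Submodule.span_induction with
    | zero => simp
    | add x y _ _ hx hy => rw [mul_add]; exact add_mem hx hy
    | smul c x _ hx => rw [mul_smul_comm]; exact Submodule.smul_mem _ _ hx
    | mem x hx =>
      obtain ⟨⟨i', j'⟩, rfl⟩ := hx
      have := tau_mem_P q (k+l) (Fin.append i.1 i'.1, Fin.append i.2 i'.2) (Fin.append j.1 j'.1, Fin.append j.2 j'.2)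
      convert this using 1
      funext g
      simp only [tau, tensorTT, MonoidHom.coe_mk, OneHom.coe_mk, Matrix.of_apply, Pi.mul_apply, Fin.prod_univ_add,
        Fin.append_left, Fin.append_right]
      ring

lemma P_conj (q k : ℕ) {f : G q → ℂ} (hf : f ∈ P q k) : (fun g => (starRingEnd ℂ) (f g)) ∈ P q k := by
  induction hf using Submodule.span_induction with
  | zero => simp; exact zero_mem _
  | add x y _ _ hx hy => simp only [Pi.add_apply, map_add]; exact add_mem hx hy
  | smul c x _ hx => 
    simp only [Pi.smul_apply, smul_eq_mul, map_mul]; exact Submodule.smul_mem _ ((starRingEnd ℂ) c) hx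
  | mem x hx =>
    obtain ⟨⟨i, j⟩, rfl⟩ := hx
    have := tau_mem_P q k (i.2, i.1) (j.2, j.1)
    convert this using 1
    funext g
    simp only [tau, tensorTT, MonoidHom.coe_mk, OneHom.coe_mk, Matrix.of_apply, map_mul, map_prod, Complex.conj_conj]
    ring

lemma entry_mem_P (q : ℕ) (a b c d : Fin q) :
    (fun g : G q => (g : Matrix (Fin q) (Fin q) ℂ) a b * (starRingEnd ℂ) ((g : Matrix (Fin q) (Fin q) ℂ) c d)) ∈ P q 1 := by
  have := tau_mem_P q 1 (fun _ => a, fun _ => c) (fun _ => b, fun _ => d)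
  convert this using 1
  funext g
  simp [tau, tensorTT]

lemma one_mem_P_one (q : ℕ) (hq : 1 ≤ q) : (1 : G q → ℂ) ∈ P q 1 := by
  have : (1 : G q → ℂ) = ∑ b, fun g : G q => (g : Matrix (Fin q) (Fin q) ℂ) ⟨0, hq⟩ b *
      (starRingEnd ℂ) ((g : Matrix (Fin q) (Fin q) ℂ) ⟨0, hq⟩ b) := by
    funext g
    have := Matrix.mem_unitaryGroup_iff.mp g.2
    have := congrFun (congrFun this ⟨0, hq⟩) ⟨0, hq⟩
    rw [Matrix.mul_apply] at this
    simp only [Finset.sum_apply, Pi.one_apply]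
    rw [Matrix.one_apply_eq] at this
    rw [← this]; rfl
  rw [this]
  exact Submodule.sum_mem _ fun b _ => entry_mem_P q _ _ _ _

lemma P_succ (q : ℕ) (hq : 1 ≤ q) (k : ℕ) : P q k ≤ P q (k+1) := by
  intro f hf
  have := P_mul q k 1 hf (one_mem_P_one q hq)
  rwa [mul_one] at this

lemma P_mono (q : ℕ) (hq : 1 ≤ q) : Monotone (P q) := monotone_nat_of_le_succ (P_succ q hq)

lemma one_mem_P (q : ℕ) (hq : 1 ≤ q) (k : ℕ) : (1 : G q → ℂ) ∈ P q k := by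
  refine P_mono q hq (Nat.zero_le k) ?_
  have := tau_mem_P q 0 (fun i => i.elim0, fun i => i.elim0) (fun i => i.elim0, fun i => i.elim0)
  convert this using 1
  funext g
  simp [tau, tensorTT]

lemma P_continuous (q k : ℕ) {f : G q → ℂ} (hf : f ∈ P q k) : Continuous f := by
  induction hf using Submodule.span_induction with
  | zero => exact continuous_const
  | add x y _ _ hx hy => exact hx.add hy
  | smul c x _ hx => exact hx.const_smul c
  | mem x hx =>
    obtain ⟨⟨i, j⟩, rfl⟩ := hx
    exact (continuous_tau q k).matrix_elem i j

lemma mem_P_iff (q k : ℕ) {f : G q → ℂ} (hf : f ∈ P q k) :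
    ∃ L : Matrix (Idx q k) (Idx q k) ℂ →ₗ[ℂ] ℂ, ∀ g, f g = L (tau q k g) := by
  induction hf using Submodule.span_induction with
  | zero => exact ⟨0, by simp⟩
  | add x y _ _ hx hy => 
    obtain ⟨L, hL⟩ := hx; obtain ⟨L', hL'⟩ := hy
    exact ⟨L + L', fun g => by simp [hL, hL']⟩
  | smul c x _ hx => 
    obtain ⟨L, hL⟩ := hx
    exact ⟨c • L, fun g => by simp [hL]⟩
  | mem x hx =>
    obtain ⟨⟨i, j⟩, rfl⟩ := hx
    exact ⟨Matrix.entryLinearMap ℂ ℂ i j, fun g => rfl⟩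

end SG

open MeasureTheory

set_option linter.unusedSectionVars false
namespace SG
open scoped Matrix

/-! ### vectors -/
section Vec
variable {n : Type*} [Fintype n]

/-- squared euclidean norm -/
noncomputable def nsq (x : n → ℂ) : ℝ := ∑ i, ‖x i‖ ^ 2

lemma star_dot_self (x : n → ℂ) : star x ⬝ᵥ x = (nsq x : ℂ) := by
  simp only [dotProduct, nsq, Pi.star_apply, Complex.ofReal_sum]
  refine Finset.sum_congr rfl fun i _ => ?_
  rw [RCLike.star_def, Complex.conj_mul']; push_cast; rfl

lemma nsq_nonneg (x : n → ℂ) : 0 ≤ nsq x := Finset.sum_nonneg fun i _ => by positivity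

lemma nsq_eq_zero {x : n → ℂ} : nsq x = 0 ↔ x = 0 := by
  constructor
  · intro h
    have := (Finset.sum_eq_zero_iff_of_nonneg (fun i _ => by positivity)).mp h
    funext i
    have := this i (Finset.mem_univ i)
    simpa using this
  · rintro rfl; simp [nsq]

lemma nsq_pos {x : n → ℂ} (h : x ≠ 0) : 0 < nsq x :=
  lt_of_le_of_ne (nsq_nonneg x) fun h' => h (nsq_eq_zero.mp h'.symm)

lemma nsq_eq_re (x : n → ℂ) : nsq x = (star x ⬝ᵥ x).re := by rw [star_dot_self]; simp

lemma cs (x y : n → ℂ) : ‖star x ⬝ᵥ y‖ ^ 2 ≤ nsq x * nsq y := by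
  have h := norm_inner_le_norm (𝕜 := ℂ) (WithLp.toLp 2 x) (WithLp.toLp 2 y)
  have h1 : inner ℂ (WithLp.toLp 2 x) (WithLp.toLp 2 y) = star x ⬝ᵥ y := by
    rw [EuclideanSpace.inner_toLp_toLp, dotProduct_comm]
  have h2 : ∀ z : n → ℂ, ‖WithLp.toLp 2 z‖ ^ 2 = nsq z := fun z => by
    rw [EuclideanSpace.norm_sq_eq]; rfl
  rw [h1] at h
  calc _ ≤ (‖WithLp.toLp 2 x‖ * ‖WithLp.toLp 2 y‖) ^ 2 := by gcongr
    _ = _ := by rw [mul_pow, h2, h2]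

lemma star_mulVec_dot {m : Type*} [Fintype m] (A : Matrix m n ℂ) (x : n → ℂ) (y : m → ℂ) :
    star (A *ᵥ x) ⬝ᵥ y = star x ⬝ᵥ (Aᴴ *ᵥ y) := by
  rw [Matrix.star_mulVec, Matrix.dotProduct_mulVec]

lemma nsq_unitary [DecidableEq n] {A : Matrix n n ℂ} (hA : Aᴴ * A = 1) (x : n → ℂ) : nsq (A *ᵥ x) = nsq x := by
  rw [nsq_eq_re, nsq_eq_re, star_mulVec_dot, Matrix.mulVec_mulVec, hA, Matrix.one_mulVec]

lemma nsq_smul (c : ℂ) (x : n → ℂ) : nsq (c • x) = ‖c‖^2 * nsq x := by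
  simp [nsq, mul_pow, Finset.mul_sum]

end Vec

/-! ### averages of unitary representations -/
section Rep
variable {q : ℕ} {n : Type*} [Fintype n] [DecidableEq n]

/-- unitarity -/
def Uni (ρ : G q →* Matrix n n ℂ) : Prop := ∀ g, (ρ g)ᴴ = ρ g⁻¹

lemma Uni.mul {ρ : G q →* Matrix n n ℂ} (h : Uni ρ) (g : G q) : (ρ g)ᴴ * ρ g = 1 := by
  rw [h, ← map_mul]; simp

noncomputable def E (μ : Measure (G q)) (ρ : G q →* Matrix n n ℂ) : Matrix n n ℂ :=
  Matrix.of fun i j => ∫ g, ρ g i j ∂μ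

variable (μ : Measure (G q)) [μ.IsMulLeftInvariant] [IsProbabilityMeasure μ]

lemma integrable_of_cont {f : G q → ℂ} (hf : Continuous f) : Integrable f μ :=
  hf.integrable_of_hasCompactSupport (HasCompactSupport.of_compactSpace f)

lemma lin_integral {f : G q → Matrix n n ℂ} (hf : Continuous f) (L : Matrix n n ℂ →ₗ[ℂ] ℂ) :
    L (Matrix.of fun i j => ∫ g, f g i j ∂μ) = ∫ g, L (f g) ∂μ := by
  have key : ∀ M : Matrix n n ℂ, L M = ∑ i, ∑ j, M i j * L (Matrix.single i j 1) := by
    intro M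
    conv_lhs => rw [Matrix.matrix_eq_sum_single M]
    simp only [map_sum]
    refine Finset.sum_congr rfl fun i _ => Finset.sum_congr rfl fun j _ => ?_
    rw [← smul_eq_mul, ← map_smul, Matrix.smul_single, smul_eq_mul, mul_one]
  have hint : ∀ i j, Integrable (fun g => f g i j * L (Matrix.single i j 1)) μ := fun i j =>
    integrable_of_cont μ ((hf.matrix_elem i j).mul continuous_const)
  rw [key]
  simp_rw [fun g => key (f g)]
  rw [integral_finsetSum _ fun i _ => integrable_finsetSum _ fun j _ => hint i j]
  refine Finset.sum_congr rfl fun i _ => ?_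
  rw [integral_finsetSum _ fun j _ => hint i j]
  refine Finset.sum_congr rfl fun j _ => ?_
  rw [integral_mul_const]; rfl

lemma matlin_integral {m : Type*} {f : G q → Matrix n n ℂ} (hf : Continuous f) (L : Matrix n n ℂ →ₗ[ℂ] Matrix m m ℂ) :
    L (Matrix.of fun i j => ∫ g, f g i j ∂μ) = Matrix.of fun i j => ∫ g, L (f g) i j ∂μ := by
  ext i j
  exact lin_integral μ hf ((Matrix.entryLinearMap ℂ ℂ i j).comp L)

variable {ρ : G q →* Matrix n n ℂ} (hc : Continuous ρ) 

include hc
lemma rho_E (h : G q) : ρ h * E μ ρ = E μ ρ := by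
  have := matlin_integral μ hc (LinearMap.mulLeft ℂ (ρ h))
  simp only [LinearMap.mulLeft_apply] at this
  rw [E, this]
  ext i j
  simp only [Matrix.of_apply, ← map_mul]
  exact integral_mul_left_eq_self (fun g => ρ g i j) h

variable (hu : Uni ρ)
include hu

lemma EstarE : (E μ ρ)ᴴ * E μ ρ = E μ ρ := by
  have h1 : (E μ ρ)ᴴ = Matrix.of fun i j => ∫ g, ρ g⁻¹ i j ∂μ := by
    ext i j
    simp only [E, Matrix.conjTranspose_apply, Matrix.of_apply]
    rw [RCLike.star_def, ← integral_conj]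
    refine integral_congr_ae (Filter.Eventually.of_forall fun g => ?_)
    have := congrFun (congrFun (hu g) i) j
    simpa [Matrix.conjTranspose_apply] using this
  have hc' : Continuous fun g : G q => ρ g⁻¹ := hc.comp continuous_inv
  have := matlin_integral μ hc' (LinearMap.mulRight ℂ (E μ ρ))
  simp only [LinearMap.mulRight_apply] at this
  rw [h1, this]
  simp only [rho_E μ hc]
  ext i j; simp

lemma E_herm : (E μ ρ)ᴴ = E μ ρ := by
  rw [← EstarE μ hc hu]; simp

lemma E_sq : E μ ρ * E μ ρ = E μ ρ := by
  conv_lhs => rw [← E_herm μ hc hu]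
  conv_lhs => arg 2; rw [E_herm μ hc hu]
  exact EstarE μ hc hu

lemma E_rho (h : G q) : E μ ρ * ρ h = E μ ρ := by
  have := congrArg Matrix.conjTranspose (rho_E μ hc h⁻¹)
  rw [Matrix.conjTranspose_mul, E_herm μ hc hu, hu, inv_inv] at this
  exact this

omit hu in
lemma E_fix {x : n → ℂ} (hx : ∀ g, ρ g *ᵥ x = x) : E μ ρ *ᵥ x = x := by
  have : ∀ i, (E μ ρ *ᵥ x) i = ∫ g, (ρ g *ᵥ x) i ∂μ := fun i => by
    let L : Matrix n n ℂ →ₗ[ℂ] ℂ := 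
      { toFun := fun A => (A *ᵥ x) i, map_add' := fun A B => by simp [Matrix.add_mulVec], 
        map_smul' := fun c A => by simp [Matrix.smul_mulVec] }
    exact lin_integral μ hc L
  funext i
  rw [this]; simp [hx]

end Rep

section Avg
variable {q m : ℕ} (p : Fin m → ℝ) (U : Fin m → G q)
variable {n : Type*} [Fintype n] [DecidableEq n] 

noncomputable def Mav (ρ : G q →* Matrix n n ℂ) : Matrix n n ℂ := ∑ k, (p k : ℂ) • ρ (U k)
noncomputable def Aav (ρ : G q →* Matrix n n ℂ) : Matrix n n ℂ :=
  ∑ j, ∑ k, ((p j * p k : ℝ) : ℂ) • ρ ((U j)⁻¹ * U k)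

variable {ρ : G q →* Matrix n n ℂ} 

lemma Aav_eq (hu : Uni ρ) : Aav p U ρ = (Mav p U ρ)ᴴ * Mav p U ρ := by
  simp only [Aav, Mav, Matrix.conjTranspose_sum, Matrix.conjTranspose_smul, Finset.sum_mul_sum]
  refine Finset.sum_congr rfl fun j _ => Finset.sum_congr rfl fun k _ => ?_
  rw [hu, map_mul, Matrix.smul_mul, Matrix.mul_smul, smul_smul]
  simp

lemma Aav_herm (hu : Uni ρ) : (Aav p U ρ)ᴴ = Aav p U ρ := by rw [Aav_eq p U hu]; simp

variable (hpsum : ∑ k, p k = 1)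
include hpsum

lemma wsum : ∑ j, ∑ k, ((p j * p k : ℝ) : ℂ) = 1 := by
  have : (∑ j, ∑ k, (p j * p k)) = 1 := by rw [← Finset.sum_mul_sum, hpsum]; simp
  exact_mod_cast this

lemma Mav_left {X : Matrix n n ℂ} (h : ∀ g, ρ g * X = X) : Mav p U ρ * X = X := by
  simp only [Mav, Finset.sum_mul, Matrix.smul_mul, h, ← Finset.sum_smul]
  rw [← Complex.ofReal_sum, hpsum]; simp

lemma Mav_right {X : Matrix n n ℂ} (h : ∀ g, X * ρ g = X) : X * Mav p U ρ = X := by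
  simp only [Mav, Finset.mul_sum, Matrix.mul_smul, h, ← Finset.sum_smul]
  rw [← Complex.ofReal_sum, hpsum]; simp

lemma Aav_left {X : Matrix n n ℂ} (h : ∀ g, ρ g * X = X) : Aav p U ρ * X = X := by
  simp only [Aav, Finset.sum_mul, Matrix.smul_mul, h, ← Finset.sum_smul]
  rw [wsum p hpsum, one_smul]

lemma Aav_right {X : Matrix n n ℂ} (h : ∀ g, X * ρ g = X) : X * Aav p U ρ = X := by
  simp only [Aav, Finset.mul_sum, Matrix.mul_smul, h, ← Finset.sum_smul]
  rw [wsum p hpsum, one_smul]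

end Avg

section Beta
open scoped Matrix.Norms.L2Operator
variable {q m : ℕ} (p : Fin m → ℝ) (U : Fin m → G q) (μ : Measure (G q)) 

/-- squared norm of the difference of the moment operators. -/
noncomputable def beta (t : ℕ) : ℝ := opNorm (momentOp q t m p U - MHaarOp q t μ) ^ 2

lemma beta_nonneg (t : ℕ) : 0 ≤ beta p U μ t := sq_nonneg _

lemma momentOp_eq (t : ℕ) : momentOp q t m p U = Mav p U (tau q t) := rfl
lemma MHaarOp_eq (t : ℕ) : MHaarOp q t μ = E μ (tau q t) := rfl
lemma opNorm_eq {n : Type*} [Fintype n] [DecidableEq n] (A : Matrix n n ℂ) : opNorm A = ‖A‖ := rfl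
lemma tau_uni (q t : ℕ) : Uni (tau q t) := tau_star q t

variable [μ.IsMulLeftInvariant] [IsProbabilityMeasure μ]
variable {n : Type*} [Fintype n] [DecidableEq n] {ρ : G q →* Matrix n n ℂ} (hc : Continuous ρ) (hu : Uni ρ)
variable (hp : ∀ k, 0 ≤ p k) (hpsum : ∑ k, p k = 1)

include hc hu hpsum in
lemma Adiff : Aav p U ρ - E μ ρ = (Mav p U ρ - E μ ρ)ᴴ * (Mav p U ρ - E μ ρ) := by
  have h1 := Mav_left p U hpsum (rho_E μ hc)
  have h2 : (Mav p U ρ)ᴴ * E μ ρ = E μ ρ := by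
    have := congrArg Matrix.conjTranspose (Mav_right p U hpsum (E_rho μ hc hu))
    rwa [Matrix.conjTranspose_mul, E_herm μ hc hu] at this
  rw [Matrix.conjTranspose_sub, Matrix.sub_mul, Matrix.mul_sub, Matrix.mul_sub, ← Aav_eq p U hu, h2,
    E_herm μ hc hu, E_sq μ hc hu, Mav_right p U hpsum (E_rho μ hc hu)]
  simp

include hpsum in
lemma beta_eq (t : ℕ) : beta p U μ t = ‖Aav p U (tau q t) - E μ (tau q t)‖ := by
  rw [Adiff p U μ (continuous_tau q t) (tau_uni q t) hpsum, Matrix.l2_opNorm_conjTranspose_mul_self, beta,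
    opNorm_eq, momentOp_eq, MHaarOp_eq, sq]

include hp hpsum in
lemma opNorm_le_one (t : ℕ) : opNorm (momentOp q t m p U - MHaarOp q t μ) ≤ 1 := by
  rw [opNorm_eq, momentOp_eq, MHaarOp_eq]
  have hM := Mav_left p U hpsum (rho_E μ (continuous_tau q t))
  have : Mav p U (tau q t) - E μ (tau q t) = Mav p U (tau q t) * (1 - E μ (tau q t)) := by
    rw [mul_sub, hM, mul_one]
  rw [this]
  have h1 : ‖Mav p U (tau q t)‖ ≤ 1 := by
    rw [← hpsum]
    refine (norm_sum_le _ _).trans (Finset.sum_le_sum fun k _ => ?_)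
    rw [norm_smul]
    have : ‖tau q t (U k)‖ ≤ 1 := by
      have h1 := Matrix.l2_opNorm_conjTranspose_mul_self (tau q t (U k))
      rw [(tau_uni q t).mul (U k)] at h1
      have h2 : ‖(1 : Matrix (Idx q t) (Idx q t) ℂ)‖ ≤ 1 := IsStarProjection.norm_le _ (IsStarProjection.one _)
      nlinarith [norm_nonneg (tau q t (U k))]
    calc _ ≤ ‖(p k : ℂ)‖ * 1 := by gcongr
      _ = p k := by simp [abs_of_nonneg (hp k)]
  have h2 : ‖(1 : Matrix (Idx q t) (Idx q t) ℂ) - E μ (tau q t)‖ ≤ 1 := by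
    apply IsStarProjection.norm_le
    have : IsStarProjection (E μ (tau q t)) := ⟨E_sq μ (continuous_tau q t) (tau_uni q t), E_herm μ (continuous_tau q t) (tau_uni q t)⟩
    exact this.one_sub
  calc _ ≤ _ := norm_mul_le _ _
    _ ≤ 1 * 1 := by gcongr
    _ = 1 := by norm_num

include hp hpsum in
lemma beta_le_one (t : ℕ) : beta p U μ t ≤ 1 :=
  pow_le_one₀ (norm_nonneg _) (opNorm_le_one p U μ hp hpsum t)

include hpsum in
lemma exists_eigvec (t : ℕ) (h : 0 < beta p U μ t) : ∃ x : Idx q t → ℂ, x ≠ 0 ∧ E μ (tau q t) *ᵥ x = 0 ∧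
    Aav p U (tau q t) *ᵥ x = (beta p U μ t : ℂ) • x := by
  set N := Mav p U (tau q t) - E μ (tau q t) with hN
  have hA := Adiff p U μ (continuous_tau q t) (tau_uni q t) hpsum
  have hb := beta_eq p U μ hpsum t
  set β := beta p U μ t
  set D := Aav p U (tau q t) - E μ (tau q t) with hD
  have hne : Nontrivial (Matrix (Idx q t) (Idx q t) ℂ) := ⟨D, 0, fun h0 => by rw [h0, norm_zero] at hb; exact h.ne' hb⟩
  open scoped MatrixOrder in
  have hs : ‖D‖ ∈ spectrum ℝ D := by
    refine CStarAlgebra.norm_mem_spectrum_of_nonneg ?_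
    rw [hA]
    exact star_mul_self_nonneg N
  rw [← hb, spectrum.mem_iff, Matrix.isUnit_iff_isUnit_det, isUnit_iff_ne_zero, not_not] at hs
  obtain ⟨x, hx, hx2⟩ := Matrix.exists_mulVec_eq_zero_iff.mpr hs
  have hDx : D *ᵥ x = (β : ℂ) • x := by
    rw [Matrix.sub_mulVec, sub_eq_zero] at hx2
    rw [← hx2, Algebra.algebraMap_eq_smul_one, Matrix.smul_mulVec, Matrix.one_mulVec]
    simp
  have hE := E_sq μ (continuous_tau q t) (tau_uni q t)
  have hEx : E μ (tau q t) *ᵥ x = 0 := by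
    have h0 : E μ (tau q t) * D = 0 := by
      rw [hD, mul_sub, Aav_right p U hpsum (E_rho μ (continuous_tau q t) (tau_uni q t)), hE, sub_self]
    have := congrArg (E μ (tau q t) *ᵥ ·) hDx
    simp only [Matrix.mulVec_mulVec, h0, Matrix.zero_mulVec, Matrix.mulVec_smul] at this
    rcases smul_eq_zero.mp this.symm with h' | h'
    · exact absurd (by exact_mod_cast h') h.ne'
    · exact h'
  refine ⟨x, hx, hEx, ?_⟩
  rw [hD, Matrix.sub_mulVec, hEx, sub_zero] at hDx
  exact hDx

include hpsum in
lemma Apow (t n : ℕ) : (Aav p U (tau q t)) ^ (n+1) = E μ (tau q t) + (Aav p U (tau q t) - E μ (tau q t)) ^ (n+1) := by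
  have h1 := Aav_left p U hpsum (rho_E μ (continuous_tau q t))
  have h2 := Aav_right p U hpsum (E_rho μ (continuous_tau q t) (tau_uni q t))
  have hE := E_sq μ (continuous_tau q t) (tau_uni q t)
  induction n with
  | zero => simp
  | succ n ih =>
    have h3 : (Aav p U (tau q t) - E μ (tau q t)) ^ (n+1) * E μ (tau q t) = 0 := by
      rw [pow_succ, mul_assoc, sub_mul, h1, hE, sub_self, mul_zero]
    rw [pow_succ, ih, add_mul, h2, pow_succ _ (n+1), mul_sub, h3, sub_zero]

omit [μ.IsMulLeftInvariant] [IsProbabilityMeasure μ] in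
lemma exists_lin {k : ℕ} (hk : ∀ i j, (fun g => ρ g i j) ∈ P q k) :
    ∃ L : Matrix (Idx q k) (Idx q k) ℂ →ₗ[ℂ] Matrix n n ℂ, ∀ g, ρ g = L (tau q k g) := by
  choose L hL using fun i j => mem_P_iff q k (hk i j)
  refine ⟨{ toFun := fun A => Matrix.of fun i j => L i j A, map_add' := ?_, map_smul' := ?_ }, ?_⟩
  · intro A B; ext i j; simp
  · intro c A; ext i j; simp
  · intro g; ext i j; simpa using hL i j g

omit [μ.IsMulLeftInvariant] [IsProbabilityMeasure μ] in
lemma lin_pow {k : ℕ} {L : Matrix (Idx q k) (Idx q k) ℂ →ₗ[ℂ] Matrix n n ℂ} (hL : ∀ g, ρ g = L (tau q k g)) (N : ℕ) :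
    (Aav p U ρ) ^ N = L ((Aav p U (tau q k)) ^ N) := by
  have key : ∀ N h, (Aav p U ρ) ^ N * ρ h = L ((Aav p U (tau q k)) ^ N * tau q k h) := by
    intro N
    induction N with
    | zero => intro h; simp [hL]
    | succ N ih =>
      intro h
      rw [pow_succ, pow_succ, mul_assoc, mul_assoc]
      conv_lhs => arg 2; rw [Aav]
      conv_rhs => arg 2; arg 2; rw [Aav]
      simp only [Finset.sum_mul, Finset.mul_sum, Matrix.smul_mul, Matrix.mul_smul, ← map_mul, map_sum, map_smul, ih]
  have := key N 1
  simpa using this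

lemma cont_of_P {k : ℕ} (hk : ∀ i j, (fun g => ρ g i j) ∈ P q k) : Continuous ρ :=
  continuous_matrix fun i j => P_continuous q k (hk i j)

lemma pow_aux {b β C : ℝ} (hb : 0 ≤ b) (hβ : 0 ≤ β) (h : ∀ j : ℕ, b ^ (2^j) ≤ C * β ^ (2^j)) : b ≤ β := by
  by_contra hlt
  push Not at hlt
  rcases hβ.eq_or_lt with h0 | h0
  · have := h 0
    rw [← h0] at this hlt
    simp at this; linarith
  · have h1 : 1 < b / β := (one_lt_div h0).mpr hlt
    obtain ⟨N, hN⟩ := pow_unbounded_of_one_lt C h1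
    have h2 : (b/β)^N ≤ (b/β)^(2^N) := pow_le_pow_right₀ h1.le (Nat.lt_two_pow_self).le
    have h3 := h N
    rw [div_pow b β (2^N)] at h2
    have : b^(2^N)/β^(2^N) ≤ C := by rw [div_le_iff₀ (by positivity)]; exact h3
    linarith

include hu hpsum in
lemma Lgap {k : ℕ} (hk : ∀ i j, (fun g => ρ g i j) ∈ P q k) (y : n → ℂ)
    (hy : ∀ z, (∀ g, ρ g *ᵥ z = z) → star z ⬝ᵥ y = 0) :
    (star y ⬝ᵥ (Aav p U ρ *ᵥ y)).re ≤ beta p U μ k * nsq y := by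
  by_cases hy0 : y = 0
  · subst hy0; simp [nsq]
  have hypos := nsq_pos hy0
  have hc := cont_of_P hk
  obtain ⟨L, hL⟩ := exists_lin hk
  have hpow := lin_pow p U hL
  have hE : L (E μ (tau q k)) = E μ ρ := by
    have := matlin_integral μ (continuous_tau q k) L
    rw [E, this]; simp only [← hL]; rfl
  have hEy : star y ⬝ᵥ (E μ ρ *ᵥ y) = 0 := by
    have := hy (E μ ρ *ᵥ y) fun g => by rw [Matrix.mulVec_mulVec, rho_E μ hc]
    rw [star_mulVec_dot, E_herm μ hc hu] at this
    exact this
  let F : Matrix (Idx q k) (Idx q k) ℂ →ₗ[ℂ] ℂ :=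
      { toFun := fun A => star y ⬝ᵥ (L A *ᵥ y), 
        map_add' := fun A B => by simp [Matrix.add_mulVec], 
        map_smul' := fun c A => by simp [Matrix.smul_mulVec] }
  set A := Aav p U ρ with hA
  have hAh : Aᴴ = A := Aav_herm p U hu
  let r : ℕ → ℝ := fun N => (star y ⬝ᵥ (A^N *ᵥ y)).re / nsq y
  have hr : ∀ N, (r N)^2 ≤ r (2*N) := by
    intro N
    have h1 := cs y (A^N *ᵥ y)
    have h2 : nsq (A^N *ᵥ y) = (star y ⬝ᵥ (A^(2*N) *ᵥ y)).re := by
      rw [nsq_eq_re, star_mulVec_dot, Matrix.conjTranspose_pow, hAh, Matrix.mulVec_mulVec, ← pow_add, two_mul]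
    have h3 : ((star y ⬝ᵥ (A^N *ᵥ y)).re)^2 ≤ ‖star y ⬝ᵥ (A^N *ᵥ y)‖^2 := by
      rw [← sq_abs]; gcongr; exact Complex.abs_re_le_norm _
    simp only [r]
    rw [div_pow, div_le_div_iff₀ (by positivity) hypos, ← h2]
    calc _ ≤ (nsq y * nsq (A^N *ᵥ y)) * nsq y := by gcongr; linarith
      _ = _ := by ring
  have hr1 : 0 ≤ r 1 := by
    simp only [r, pow_one]
    refine div_nonneg ?_ hypos.le
    rw [hA, Aav_eq p U hu, ← Matrix.mulVec_mulVec, ← star_mulVec_dot, ← nsq_eq_re]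
    exact nsq_nonneg _
  have hrj : ∀ j : ℕ, (r 1)^(2^j) ≤ r (2^j) := by
    intro j
    induction j with
    | zero => simp
    | succ j ih =>
      rw [pow_succ, pow_mul]
      calc _ ≤ (r (2^j))^2 := by gcongr
        _ ≤ _ := by rw [mul_comm]; exact hr _
  have hC : ∀ N, r (N+1) ≤ (‖LinearMap.toContinuousLinearMap F‖ / nsq y) * (beta p U μ k)^(N+1) := by
    intro N
    have h1 : star y ⬝ᵥ (A^(N+1) *ᵥ y) = F ((Aav p U (tau q k) - E μ (tau q k))^(N+1)) := by
      have : star y ⬝ᵥ (A^(N+1) *ᵥ y) = F ((Aav p U (tau q k))^(N+1)) := by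
        rw [hpow]; rfl
      rw [this, Apow p U μ hpsum, map_add]
      have : F (E μ (tau q k)) = 0 := by
        show star y ⬝ᵥ (L (E μ (tau q k)) *ᵥ y) = 0
        rw [hE, hEy]
      rw [this, zero_add]
    have h2 := (LinearMap.toContinuousLinearMap F).le_opNorm ((Aav p U (tau q k) - E μ (tau q k))^(N+1))
    have h3 : ‖(Aav p U (tau q k) - E μ (tau q k))^(N+1)‖ ≤ (beta p U μ k)^(N+1) := by
      rw [beta_eq p U μ hpsum]; exact norm_pow_le' _ (Nat.succ_pos N)
    simp only [r]
    rw [div_mul_eq_mul_div]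
    gcongr
    rw [h1]
    calc _ ≤ _ := Complex.re_le_norm _
      _ ≤ _ := h2
      _ ≤ _ := by gcongr
  have hfin : r 1 ≤ beta p U μ k := by
    refine pow_aux hr1 (beta_nonneg p U μ k) (C := ‖LinearMap.toContinuousLinearMap F‖ / nsq y) fun j => ?_
    obtain ⟨N, hN⟩ : ∃ N, 2^j = N+1 := ⟨2^j-1, (Nat.sub_add_cancel Nat.one_le_two_pow).symm⟩
    refine (hrj j).trans ?_
    rw [hN]; exact hC N
  simp only [r, pow_one] at hfin
  rwa [div_le_iff₀ hypos] at hfin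

include hpsum in
lemma beta_mono (hq : 1 ≤ q) : Monotone (beta p U μ) := by
  intro k l hkl
  rcases (beta_nonneg p U μ k).eq_or_lt with h0 | h0
  · rw [← h0]; exact beta_nonneg _ _ _ _
  obtain ⟨x, hx, hEx, hAx⟩ := exists_eigvec p U μ hpsum k h0
  have := Lgap p U μ (tau_uni q k) hpsum (k := l) (fun i j => P_mono q hq hkl (tau_mem_P q k i j)) x ?_
  · rw [hAx, dotProduct_smul, star_dot_self, smul_eq_mul, ← Complex.ofReal_mul, Complex.ofReal_re] at this
    exact le_of_mul_le_mul_right this (nsq_pos hx)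
  · intro z hz
    rw [← E_fix μ (continuous_tau q k) hz, star_mulVec_dot, E_herm μ (continuous_tau q k) (tau_uni q k), hEx]
    simp

end Beta

end SG

open MeasureTheory
set_option linter.unusedSectionVars false
namespace SG
open scoped Matrix

/-- Hilbert-Schmidt norm squared -/
noncomputable def hs {n m : Type*} [Fintype n] [Fintype m] (X : Matrix n m ℂ) : ℝ := ∑ i, ∑ j, ‖X i j‖ ^ 2

lemma hs_nonneg {n m : Type*} [Fintype n] [Fintype m] (X : Matrix n m ℂ) : 0 ≤ hs X :=
  Finset.sum_nonneg fun i _ => Finset.sum_nonneg fun j _ => by positivity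

lemma trace_star_self {n m : Type*} [Fintype n] [Fintype m] (X : Matrix n m ℂ) : (Xᴴ * X).trace = (hs X : ℂ) := by
  simp only [Matrix.trace, Matrix.diag, Matrix.mul_apply, hs, Matrix.conjTranspose_apply, Complex.ofReal_sum]
  rw [Finset.sum_comm]
  refine Finset.sum_congr rfl fun i _ => Finset.sum_congr rfl fun j _ => ?_
  rw [RCLike.star_def, Complex.conj_mul']; push_cast; rfl

lemma nsq_mulVec_le {n m : Type*} [Fintype n] [Fintype m] (X : Matrix n m ℂ) (x : m → ℂ) :
    nsq (X *ᵥ x) ≤ hs X * nsq x := by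
  rw [nsq, hs, Finset.sum_mul]
  refine Finset.sum_le_sum fun i _ => ?_
  have := cs (star (X i)) x
  rw [star_star] at this
  refine this.trans (le_of_eq ?_)
  simp [nsq]

lemma nsq_toLp {n : Type*} [Fintype n] (z : n → ℂ) : ‖WithLp.toLp 2 z‖ ^ 2 = nsq z := by
  rw [EuclideanSpace.norm_sq_eq]; rfl

lemma opNorm_sq_le {n : Type*} [Fintype n] [DecidableEq n] (X : Matrix n n ℂ) : opNorm X ^ 2 ≤ hs X := by
  have h : opNorm X ≤ Real.sqrt (hs X) := by
    refine ContinuousLinearMap.opNorm_le_bound _ (Real.sqrt_nonneg _) fun v => ?_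
    refine (sq_le_sq₀ (norm_nonneg _) (by positivity)).mp ?_
    rw [mul_pow, Real.sq_sqrt (hs_nonneg X)]
    have h1 : Matrix.toEuclideanCLM (𝕜 := ℂ) X v = WithLp.toLp 2 (X *ᵥ v.ofLp) := by
      rw [← Matrix.toEuclideanCLM_toLp]
    have h2 : ‖v‖^2 = nsq v.ofLp := by rw [← nsq_toLp]
    rw [h1, nsq_toLp, h2]
    exact nsq_mulVec_le X _
  calc _ ≤ (Real.sqrt (hs X))^2 := by gcongr; exact norm_nonneg _
    _ = _ := Real.sq_sqrt (hs_nonneg X)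

lemma exists_phase (c : ℂ) : ∃ φ ∈ Set.Ico (0:ℝ) (2 * Real.pi), Complex.exp (φ * Complex.I) * c = (‖c‖ : ℂ) := by
  have key : Complex.exp (((-c.arg : ℝ) : ℂ) * Complex.I) * c = (‖c‖ : ℂ) := by
    conv_lhs => rw [← Complex.norm_mul_exp_arg_mul_I c]
    rw [mul_left_comm, ← Complex.exp_add]; simp
  rcases le_or_gt c.arg 0 with h | h
  · refine ⟨-c.arg, ⟨by linarith, ?_⟩, key⟩
    have := Complex.neg_pi_lt_arg c
    linarith [Real.pi_pos]
  · refine ⟨-c.arg + 2 * Real.pi, ⟨?_, by linarith⟩, ?_⟩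
    · have := Complex.arg_le_pi c
      linarith [Real.pi_pos]
    · rw [← key]
      congr 1
      push_cast
      rw [add_mul, Complex.exp_add, Complex.exp_two_pi_mul_I, mul_one]

section
variable {q m : ℕ} (p : Fin m → ℝ) (U : Fin m → G q) (μ : Measure (G q)) [μ.IsMulLeftInvariant] [IsProbabilityMeasure μ]
variable (hp : ∀ k, 0 ≤ p k) (hpsum : ∑ k, p k = 1)

def Supp : Set (G q) := {W | ∃ j k, 0 < p j * p k ∧ star (U j) * U k = W}

lemma avg_fix_aux {n : Type*} [Fintype n] [DecidableEq n] {A : Matrix n n ℂ} (hA : Aᴴ * A = 1) (x : n → ℂ) :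
    nsq (A *ᵥ x - x) = 2 * (nsq x - (star x ⬝ᵥ (A *ᵥ x)).re) := by
  have h1 := nsq_unitary hA x
  have h2 : (star (A *ᵥ x) ⬝ᵥ x).re = (star x ⬝ᵥ (A *ᵥ x)).re := by
    have : star (A *ᵥ x) ⬝ᵥ x = star (star x ⬝ᵥ (A *ᵥ x)) := by
      rw [Matrix.star_dotProduct]
    rw [this]; simp
  rw [nsq_eq_re, star_sub, sub_dotProduct, dotProduct_sub, dotProduct_sub]
  simp only [Complex.sub_re, h2]
  rw [← nsq_eq_re, ← nsq_eq_re, h1]; ring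

include hp hpsum in
lemma avg_fix {n : Type*} [Fintype n] [DecidableEq n] {ρ : G q →* Matrix n n ℂ} (hu : Uni ρ) {x : n → ℂ}
    (hx : Aav p U ρ *ᵥ x = x) {g : G q} (hg : g ∈ Supp p U) : ρ g *ᵥ x = x := by
  obtain ⟨j0, k0, hw, rfl⟩ := hg
  have hsum : ∑ j, ∑ k, (p j * p k) * nsq (ρ ((U j)⁻¹ * U k) *ᵥ x - x) = 0 := by
    simp only [avg_fix_aux (hu.mul _)]
    have h1 : (star x ⬝ᵥ (Aav p U ρ *ᵥ x)).re = ∑ j, ∑ k, (p j * p k) * (star x ⬝ᵥ (ρ ((U j)⁻¹ * U k) *ᵥ x)).re := by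
      simp only [Aav, Matrix.sum_mulVec, Matrix.smul_mulVec, dotProduct_sum, dotProduct_smul, Complex.re_sum,
        smul_eq_mul, Complex.re_ofReal_mul]
    rw [hx, ← nsq_eq_re] at h1
    have h2 : ∑ j, ∑ k, (p j * p k) * nsq x = nsq x := by
      simp only [← Finset.sum_mul]
      rw [← Finset.sum_mul_sum, hpsum]; simp
    have : ∑ j, ∑ k, (p j * p k) * (2 * (nsq x - (star x ⬝ᵥ (ρ ((U j)⁻¹ * U k) *ᵥ x)).re)) =
      2 * (∑ j, ∑ k, (p j * p k) * nsq x - ∑ j, ∑ k, (p j * p k) * (star x ⬝ᵥ (ρ ((U j)⁻¹ * U k) *ᵥ x)).re) := by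
      simp only [← Finset.sum_sub_distrib, Finset.mul_sum]
      refine Finset.sum_congr rfl fun j _ => Finset.sum_congr rfl fun k _ => by ring
    rw [this, h2, ← h1]; simp
  have hnn : ∀ j k, 0 ≤ (p j * p k) * nsq (ρ ((U j)⁻¹ * U k) *ᵥ x - x) := fun j k =>
    mul_nonneg (mul_nonneg (hp j) (hp k)) (nsq_nonneg _)
  have h3 := (Finset.sum_eq_zero_iff_of_nonneg fun j _ => Finset.sum_nonneg fun k _ => hnn j k).mp hsum j0 (Finset.mem_univ _)
  have h4 := (Finset.sum_eq_zero_iff_of_nonneg fun k _ => hnn j0 k).mp h3 k0 (Finset.mem_univ _)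
  have h5 := (mul_eq_zero.mp h4).resolve_left hw.ne'
  exact sub_eq_zero.mp (nsq_eq_zero.mp h5)

open scoped Matrix.Norms.L2Operator in
include hp hpsum in
lemma beta_lt_one (huniv : IsUniversalGateSet q (Supp p U)) (t : ℕ) : beta p U μ t < 1 := by
  refine lt_of_le_of_ne (beta_le_one p U μ hp hpsum t) fun h1 => ?_
  obtain ⟨x, hx, hEx, hAx⟩ := exists_eigvec p U μ hpsum t (by rw [h1]; norm_num)
  rw [h1] at hAx
  simp only [Complex.ofReal_one, one_smul] at hAx
  have hword : ∀ ws : List (G q), (∀ w ∈ ws, w ∈ Supp p U) → tau q t ws.prod *ᵥ x = x := by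
    intro ws
    induction ws with
    | nil => intro _; simp
    | cons a l ih =>
      intro h
      rw [List.prod_cons, map_mul, ← Matrix.mulVec_mulVec, ih fun w hw => h w (List.mem_cons_of_mem _ hw)]
      exact avg_fix p U hp hpsum (tau_uni q t) hAx (h a List.mem_cons_self)
  have hall : ∀ V : G q, tau q t V *ᵥ x = x := by
    intro V
    by_contra hV
    have hcont : Continuous fun B : Matrix (Fin q) (Fin q) ℂ => tensorTT q t B *ᵥ x :=
      (continuous_tensorTT q t).matrix_mulVec continuous_const
    have hopen : IsOpen {B : Matrix (Fin q) (Fin q) ℂ | tensorTT q t B *ᵥ x ≠ x} :=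
      isOpen_ne_fun hcont continuous_const
    obtain ⟨δ, hδ, hball⟩ := Metric.isOpen_iff.mp hopen (V : Matrix (Fin q) (Fin q) ℂ) hV
    obtain ⟨ws, hws, hD⟩ := huniv V (δ/2) (by positivity)
    have hlt : Ddist q (V : Matrix (Fin q) (Fin q) ℂ) ((ws.prod : G q) : Matrix (Fin q) (Fin q) ℂ) < δ := by linarith
    obtain ⟨_, ⟨φ, _, rfl⟩, hφ⟩ := exists_lt_of_csInf_lt 
      (Set.Nonempty.image _ ⟨0, by simp [Real.pi_pos]⟩) hlt
    refine hball (a := Complex.exp (φ * Complex.I) • ((ws.prod : G q) : Matrix (Fin q) (Fin q) ℂ)) ?_ ?_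
    · rw [Metric.mem_ball, dist_comm, dist_eq_norm]; exact hφ
    · rw [tensorTT_smul]
      · exact hword ws hws
      · rw [Complex.mul_conj, Complex.normSq_eq_norm_sq, Complex.norm_exp_ofReal_mul_I]; simp
  have := E_fix μ (continuous_tau q t) hall
  rw [hEx] at this
  exact hx this.symm

/-! ### part (b) -/

noncomputable def hfun (V : G q) (g : G q) : ℂ := 
  ((V : Matrix (Fin q) (Fin q) ℂ)ᴴ * (g : Matrix (Fin q) (Fin q) ℂ)).trace *
  (starRingEnd ℂ) ((V : Matrix (Fin q) (Fin q) ℂ)ᴴ * (g : Matrix (Fin q) (Fin q) ℂ)).trace 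

lemma hfun_mem (V : G q) : hfun V ∈ P q 1 := by
  have : hfun V = ∑ a, ∑ b, ∑ c, ∑ d, (((starRingEnd ℂ) ((V : Matrix (Fin q) (Fin q) ℂ) b a)) * ((V : Matrix (Fin q) (Fin q) ℂ) d c)) • 
    (fun g : G q => (g : Matrix (Fin q) (Fin q) ℂ) b a * (starRingEnd ℂ) ((g : Matrix (Fin q) (Fin q) ℂ) d c)) := by
    funext g
    simp only [hfun, Matrix.trace, Matrix.diag, Matrix.mul_apply, Matrix.conjTranspose_apply, Finset.sum_apply, map_sum,
      Pi.smul_apply, smul_eq_mul, map_mul]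
    simp only [Finset.sum_mul]
    simp only [Finset.mul_sum]
    refine Finset.sum_congr rfl fun a _ => Finset.sum_congr rfl fun b _ => Finset.sum_congr rfl fun c _ => 
      Finset.sum_congr rfl fun d _ => ?_
    simp; ring
  rw [this]
  exact Submodule.sum_mem _ fun a _ => Submodule.sum_mem _ fun b _ => Submodule.sum_mem _ fun c _ => Submodule.sum_mem _ fun d _ =>
    Submodule.smul_mem _ _ (entry_mem_P q b a d c)

lemma P_pow (hq : 1 ≤ q) {f : G q → ℂ} {k : ℕ} (hf : f ∈ P q k) (N : ℕ) : f ^ N ∈ P q (N * k) := by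
  induction N with
  | zero => simpa using one_mem_P q hq 0
  | succ N ih => rw [pow_succ, Nat.succ_mul]; exact P_mul q _ _ ih hf

lemma unitary_star_mul (g : G q) : (g : Matrix (Fin q) (Fin q) ℂ)ᴴ * (g : Matrix (Fin q) (Fin q) ℂ) = 1 :=
  Matrix.mem_unitaryGroup_iff'.mp g.2

lemma hs_diff (V W : G q) (z : ℂ) (hz : z * (starRingEnd ℂ) z = 1) :
    hs ((V : Matrix (Fin q) (Fin q) ℂ) - z • (W : Matrix (Fin q) (Fin q) ℂ)) = 2 * q - 
      2 * (z * ((V : Matrix (Fin q) (Fin q) ℂ)ᴴ * (W : Matrix (Fin q) (Fin q) ℂ)).trace).re := by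
  have h1 := trace_star_self ((V : Matrix (Fin q) (Fin q) ℂ) - z • (W : Matrix (Fin q) (Fin q) ℂ))
  have h2 : ((W : Matrix (Fin q) (Fin q) ℂ)ᴴ * (V : Matrix (Fin q) (Fin q) ℂ)).trace = 
    (starRingEnd ℂ) ((V : Matrix (Fin q) (Fin q) ℂ)ᴴ * (W : Matrix (Fin q) (Fin q) ℂ)).trace := by
    rw [← RCLike.star_def, ← Matrix.trace_conjTranspose]; simp
  rw [Matrix.conjTranspose_sub, Matrix.sub_mul, Matrix.mul_sub, Matrix.mul_sub, Matrix.conjTranspose_smul,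
    unitary_star_mul, Matrix.smul_mul, Matrix.smul_mul, Matrix.mul_smul, Matrix.mul_smul, unitary_star_mul, smul_smul,
    RCLike.star_def, mul_comm, hz, one_smul, Matrix.trace_sub, Matrix.trace_sub, Matrix.trace_sub, Matrix.trace_smul,
    Matrix.trace_smul, Matrix.trace_one, h2] at h1
  have h3 := congrArg Complex.re h1
  simp only [Complex.ofReal_re] at h3
  rw [← h3]
  simp
  ring

include hpsum in
lemma tendsto_A {N : ℕ} (hb : beta p U μ N < 1) (L : Matrix (Idx q N) (Idx q N) ℂ →ₗ[ℂ] ℂ) :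
    Filter.Tendsto (fun n => L ((Aav p U (tau q N)) ^ (n+1))) Filter.atTop (nhds (L (E μ (tau q N)))) := by
  open scoped Matrix.Norms.L2Operator in
  have h1 : Filter.Tendsto (fun n => (Aav p U (tau q N) - E μ (tau q N)) ^ (n+1)) Filter.atTop (nhds 0) := by
    rw [beta_eq p U μ hpsum] at hb
    exact (tendsto_pow_atTop_nhds_zero_of_norm_lt_one hb).comp (Filter.tendsto_add_atTop_nat 1)
  have hL : Continuous L := LinearMap.continuous_of_finiteDimensional L
  have h2 := (hL.tendsto 0).comp h1
  simp only [Apow p U μ hpsum, map_add]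
  have h3 := (tendsto_const_nhds (x := L (E μ (tau q N)))).add h2
  simpa using h3

include hp hpsum in
lemma bound_words {N : ℕ} (L : Matrix (Idx q N) (Idx q N) ℂ →ₗ[ℂ] ℂ) (c : ℝ)
    (hw : ∀ ws : List (G q), (∀ w ∈ ws, w ∈ Supp p U) → ‖L (tau q N ws.prod)‖ ≤ c) (n : ℕ) :
    ‖L ((Aav p U (tau q N)) ^ n)‖ ≤ c := by
  have key : ∀ n (ws : List (G q)), (∀ w ∈ ws, w ∈ Supp p U) → ‖L ((Aav p U (tau q N)) ^ n * tau q N ws.prod)‖ ≤ c := by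
    intro n
    induction n with
    | zero => intro ws h; simpa using hw ws h
    | succ n ih =>
      intro ws hws
      rw [pow_succ, mul_assoc]
      conv_lhs => arg 1; arg 2; arg 2; rw [Aav]
      simp only [Finset.sum_mul, Finset.mul_sum, Matrix.smul_mul, Matrix.mul_smul, ← map_mul, map_sum, map_smul]
      have hc : c = ∑ j, ∑ k, (p j * p k) * c := by
        simp only [← Finset.sum_mul]
        rw [← Finset.sum_mul_sum, hpsum]; simp
      rw [hc]
      refine (norm_sum_le _ _).trans (Finset.sum_le_sum fun j _ => (norm_sum_le _ _).trans (Finset.sum_le_sum fun k _ => ?_))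
      rw [norm_smul, Complex.norm_real, Real.norm_of_nonneg (mul_nonneg (hp j) (hp k))]
      rcases (mul_nonneg (hp j) (hp k)).eq_or_lt with h | h
      · rw [← h]; simp
      · refine mul_le_mul_of_nonneg_left ?_ h.le
        have := ih (((U j)⁻¹ * U k) :: ws) ?_
        · rwa [List.prod_cons] at this
        · intro w hw
          rcases List.mem_cons.mp hw with h' | h'
          · exact ⟨j, k, h, h'.symm⟩
          · exact hws w h'
  simpa using key n [] (by simp)

include hp hpsum in
lemma part_b_aux (hq : 1 ≤ q) (hnu : ¬ IsUniversalGateSet q (Supp p U)) : ∃ N, beta p U μ N = 1 := by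
  by_contra! hne
  have hlt : ∀ N, beta p U μ N < 1 := fun N => lt_of_le_of_ne (beta_le_one p U μ hp hpsum N) (hne N)
  unfold IsUniversalGateSet at hnu
  push Not at hnu
  obtain ⟨V, ε, hε, hV⟩ := hnu
  have hq0 : (0:ℝ) < q := by exact_mod_cast hq
  set tr : G q → ℝ := fun g => ‖((V : Matrix (Fin q) (Fin q) ℂ)ᴴ * (g : Matrix (Fin q) (Fin q) ℂ)).trace‖ with htr
  have hword : ∀ ws : List (G q), (∀ w ∈ ws, w ∈ Supp p U) → tr ws.prod ≤ q - ε^2/2 := by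
    intro ws hws
    have h1 := hV ws hws
    obtain ⟨φ, hφ, hφ2⟩ := exists_phase ((V : Matrix (Fin q) (Fin q) ℂ)ᴴ * ((ws.prod : G q) : Matrix (Fin q) (Fin q) ℂ)).trace
    have h2 : Ddist q V (ws.prod : G q) ≤ opNorm ((V : Matrix (Fin q) (Fin q) ℂ) - Complex.exp (φ * Complex.I) • ((ws.prod : G q) : Matrix (Fin q) (Fin q) ℂ)) := by
      refine csInf_le ⟨0, ?_⟩ ⟨φ, hφ, rfl⟩
      rintro _ ⟨_, _, rfl⟩
      exact norm_nonneg _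
    have h3 := opNorm_sq_le ((V : Matrix (Fin q) (Fin q) ℂ) - Complex.exp (φ * Complex.I) • ((ws.prod : G q) : Matrix (Fin q) (Fin q) ℂ))
    rw [hs_diff, hφ2, Complex.ofReal_re] at h3
    · have h4 : ε^2 ≤ opNorm ((V : Matrix (Fin q) (Fin q) ℂ) - Complex.exp (φ * Complex.I) • ((ws.prod : G q) : Matrix (Fin q) (Fin q) ℂ))^2 := by
        gcongr; linarith
      simp only [htr]; linarith
    · rw [Complex.mul_conj, Complex.normSq_eq_norm_sq, Complex.norm_exp_ofReal_mul_I]; simp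
  have hf : ∀ g, hfun V g = ((tr g ^ 2 : ℝ) : ℂ) := fun g => by
    rw [hfun, Complex.mul_conj, Complex.normSq_eq_norm_sq]
  set a : ℝ := (q - ε^2/2)^2 with ha
  have ha0 : (0:ℝ) ≤ q - ε^2/2 := le_trans (norm_nonneg _) (hword [] (by simp))
  have haq : a < (q:ℝ)^2 := by
    rw [ha]; gcongr; have : 0 < ε^2 := by positivity
    linarith
  set b : ℝ := (a + (q:ℝ)^2)/2 with hb
  have hann : 0 ≤ a := sq_nonneg _
  have hb0 : 0 < b := by positivity
  have hab : a < b := by rw [hb]; linarith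
  have hbq : b < (q:ℝ)^2 := by rw [hb]; linarith
  have htrc : Continuous fun g => tr g ^ 2 := by
    have := (P_continuous q 1 (hfun_mem V)).norm
    convert this using 1
    funext g
    rw [hf, Complex.norm_real, Real.norm_of_nonneg (sq_nonneg _)]
  set O : Set (G q) := {g | b < tr g ^ 2} with hO
  have hOo : IsOpen O := isOpen_lt continuous_const htrc
  have hVO : V ∈ O := by
    show b < tr V ^ 2
    simp only [htr]
    rw [unitary_star_mul]; simpa using hbq
  have : μ.IsOpenPosMeasure := isOpenPosMeasure_of_mulLeftInvariant_of_compact Set.univ isCompact_univ (by simp)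
  have hmu : 0 < μ.real O := by
    rw [Measure.real, ENNReal.toReal_pos_iff]
    exact ⟨hOo.measure_pos μ ⟨V, hVO⟩, measure_lt_top μ O⟩
  have hN : ∀ N, μ.real O * b^N ≤ a^N := by
    intro N
    obtain ⟨L, hL⟩ := mem_P_iff q (N*1) (P_pow hq (hfun_mem V) N)
    have hI : L (E μ (tau q (N*1))) = ((∫ g, (tr g ^ 2)^N ∂μ : ℝ) : ℂ) := by
      have := lin_integral μ (continuous_tau q (N*1)) L
      rw [E, this]
      simp only [← hL, Pi.pow_apply, hf]
      rw [← integral_complex_ofReal]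
      simp
    have h1 : ‖L (E μ (tau q (N*1)))‖ ≤ a^N := by
      refine le_of_tendsto (tendsto_A p U μ hpsum (hlt (N*1)) L).norm (Filter.Eventually.of_forall fun n => ?_)
      refine bound_words p U hp hpsum L (a^N) (fun ws hws => ?_) (n+1)
      rw [← hL, Pi.pow_apply, hf, norm_pow, Complex.norm_real, Real.norm_of_nonneg (sq_nonneg _), ha]
      have := hword ws hws
      have h0 : 0 ≤ tr ws.prod := norm_nonneg _
      gcongr
    rw [hI, Complex.norm_real] at h1
    refine le_trans ?_ ((Real.le_norm_self _).trans h1)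
    have hint : Integrable (fun g => (tr g ^ 2)^N) μ :=
      (htrc.pow N).integrable_of_hasCompactSupport (HasCompactSupport.of_compactSpace _)
    calc μ.real O * b^N = ∫ g in O, b^N ∂μ := by simp
      _ ≤ ∫ g in O, (tr g ^ 2)^N ∂μ := by
        refine setIntegral_mono_on (integrable_const _) hint.integrableOn hOo.measurableSet fun g hg => ?_
        have : b < tr g ^ 2 := hg
        gcongr
      _ ≤ _ := setIntegral_le_integral hint (Filter.Eventually.of_forall fun g => by positivity)
  have hlim := tendsto_pow_atTop_nhds_zero_of_lt_one (div_nonneg hann hb0.le) ((div_lt_one hb0).mpr hab)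
  have hev := hlim.eventually (gt_mem_nhds hmu)
  obtain ⟨N, hN2⟩ := hev.exists
  have := hN N
  rw [div_pow, div_lt_iff₀ (by positivity)] at hN2
  linarith

include hp hpsum in
lemma part_b (hq : 1 ≤ q) (hnu : ¬ IsUniversalGateSet q (Supp p U)) : 
   ∃ t₀ : ℕ, ∀ t : ℕ, t₀ ≤ t → 1 - opNorm (momentOp q t m p U - MHaarOp q t μ) = 0 := by
  obtain ⟨N, hN⟩ := part_b_aux p U μ hp hpsum hq hnu
  refine ⟨N, fun t ht => ?_⟩
  have h1 : beta p U μ t = 1 := le_antisymm (beta_le_one p U μ hp hpsum t) (hN ▸ beta_mono p U μ hpsum hq ht)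
  have h2 : (0:ℝ) ≤ opNorm (momentOp q t m p U - MHaarOp q t μ) := norm_nonneg _
  rw [beta] at h1
  have h3 := (pow_eq_one_iff_of_nonneg h2 two_ne_zero).mp h1
  linarith

end
end SG

set_option linter.unusedSectionVars false
namespace SG

lemma downset_count {ι : Type*} [Fintype ι] [DecidableEq ι] (S : Finset (ι → ℕ))
    (hS : ∀ a ∈ S, ∀ b, b ≤ a → b ∈ S) (s : ℕ) (hs : 1 ≤ s) (hb : ∀ a ∈ S, ∀ i, a i < s^3) :
    S.card * s ≤ (S.filter fun a => ∀ i, a i < s^2).card * s + 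
      Fintype.card ι * (S.filter fun a => ∀ i, a i < s^2).card ^ 2 := by
  set S0 := S.filter fun a => ∀ i, a i < s^2 with hS0
  let B : ι → Finset (ι → ℕ) := fun i => S.filter fun a => s^2 ≤ a i
  have hcover : S ⊆ S0 ∪ Finset.univ.biUnion B := by
    intro a ha
    by_cases h : ∀ i, a i < s^2
    · exact Finset.mem_union_left _ (Finset.mem_filter.mpr ⟨ha, h⟩)
    · push Not at h
      obtain ⟨i, hi⟩ := h
      exact Finset.mem_union_right _ (Finset.mem_biUnion.mpr ⟨i, Finset.mem_univ i, Finset.mem_filter.mpr ⟨ha, hi⟩⟩)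
  have hss : s ≤ s^2 := Nat.le_self_pow two_ne_zero s
  have hB : ∀ i, (B i).card * s ≤ S0.card ^ 2 := by
    intro i
    let f : (ι → ℕ) → (ι → ℕ) := fun a => Function.update (fun j => a j % s) i 0
    let C := (B i).image f
    have hC : C.card * s^2 ≤ S0.card := by
      have : (C ×ˢ Finset.range (s^2)).card ≤ S0.card := by
        refine Finset.card_le_card_of_injOn (fun x => Function.update x.1 i x.2) ?_ ?_
        · rintro ⟨b, c⟩ hx
          simp only [Finset.coe_product, Set.mem_prod, Finset.mem_coe, Finset.mem_range] at hx
          obtain ⟨hb1, hc⟩ := hx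
          obtain ⟨a, ha, rfl⟩ := Finset.mem_image.mp hb1
          obtain ⟨haS, hai⟩ := Finset.mem_filter.mp ha
          refine Finset.mem_coe.mpr (Finset.mem_filter.mpr ⟨hS a haS _ ?_, ?_⟩)
          · intro j
            by_cases hj : j = i
            · subst hj; simp; omega
            · simp [f, hj]; exact Nat.mod_le _ _
          · intro j
            by_cases hj : j = i
            · subst hj; simpa using hc
            · simp [f, hj]; exact lt_of_lt_of_le (Nat.mod_lt _ hs) hss
        · rintro ⟨b, c⟩ hx ⟨b', c'⟩ hx' h
          simp only [Finset.coe_product, Set.mem_prod, Finset.mem_coe, Finset.mem_range] at hx hx' h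
          obtain ⟨a, ha, rfl⟩ := Finset.mem_image.mp hx.1
          obtain ⟨a', ha', rfl⟩ := Finset.mem_image.mp hx'.1
          have h1 := congrFun h i
          simp at h1
          have h2 : f a = f a' := by
            funext j
            by_cases hj : j = i
            · subst hj; simp [f]
            · have := congrFun h j
              simpa [hj] using this
          rw [h2, h1]
      simpa using this
    have hBi : (B i).card ≤ C.card * s * S0.card := by
      have : (B i).card ≤ (C ×ˢ Finset.range s ×ˢ S0).card := by
        refine Finset.card_le_card_of_injOn (fun a => (f a, a i % s, fun j => a j / s)) ?_ ?_
        · intro a ha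
          have ha' := Finset.mem_coe.mp ha
          obtain ⟨haS, hai⟩ := Finset.mem_filter.mp ha'
          simp only [Finset.coe_product, Set.mem_prod, Finset.mem_coe, Finset.mem_range]
          refine ⟨Finset.mem_image_of_mem f ha', Nat.mod_lt _ hs, Finset.mem_filter.mpr ⟨hS a haS _ fun j => Nat.div_le_self _ _, fun j => ?_⟩⟩
          rw [Nat.div_lt_iff_lt_mul hs, ← pow_succ]
          exact hb a haS j
        · intro a _ a' _ h
          simp only [Prod.mk.injEq] at h
          obtain ⟨h1, h2, h3⟩ := h
          funext j
          have h4 := congrFun h3 j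
          have h5 : a j % s = a' j % s := by
            by_cases hj : j = i
            · subst hj; exact h2
            · have := congrFun h1 j
              simpa [f, hj] using this
          rw [← Nat.div_add_mod (a j) s, ← Nat.div_add_mod (a' j) s, h4, h5]
      simpa [mul_assoc] using this
    calc (B i).card * s ≤ (C.card * s * S0.card) * s := Nat.mul_le_mul_right _ hBi
      _ = (C.card * s^2) * S0.card := by ring
      _ ≤ S0.card * S0.card := Nat.mul_le_mul_right _ hC
      _ = _ := by ring
  calc S.card * s ≤ (S0.card + ∑ i, (B i).card) * s := by
        refine Nat.mul_le_mul_right _ ((Finset.card_le_card hcover).trans ((Finset.card_union_le _ _).trans ?_))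
        exact Nat.add_le_add_left Finset.card_biUnion_le _
    _ = S0.card * s + ∑ i, (B i).card * s := by rw [add_mul, Finset.sum_mul]
    _ ≤ S0.card * s + ∑ i : ι, S0.card^2 := by gcongr with i _; exact hB i
    _ = _ := by simp

end SG

set_option linter.unusedSectionVars false
namespace SG

section PBW
variable {ι : Type*} {R : Type*} [Ring R] [Algebra ℂ R] (X : ι → R)

/-- span of words of length at most `k` -/
def Wsp (k : ℕ) : Submodule ℂ R := Submodule.span ℂ {x | ∃ l : List ι, l.length ≤ k ∧ (l.map X).prod = x}

lemma Wsp_mem {k : ℕ} {l : List ι} (h : l.length ≤ k) : (l.map X).prod ∈ Wsp X k := Submodule.subset_span ⟨l, h, rfl⟩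

lemma Wsp_mono : Monotone (Wsp X) := fun _ _ h => Submodule.span_mono fun _ ⟨l, hl, hx⟩ => ⟨l, hl.trans h, hx⟩

lemma Wsp_mul {a b : ℕ} {x y : R} (hx : x ∈ Wsp X a) (hy : y ∈ Wsp X b) : x * y ∈ Wsp X (a + b) := by
  induction hx using Submodule.span_induction with
  | zero => simp
  | add x y _ _ hx hy => rw [add_mul]; exact add_mem hx hy
  | smul c x _ hx => rw [smul_mul_assoc]; exact Submodule.smul_mem _ _ hx
  | mem x hx =>
    obtain ⟨l, hl, rfl⟩ := hx
    induction hy using Submodule.span_induction with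
    | zero => simp
    | add x y _ _ hx hy => rw [mul_add]; exact add_mem hx hy
    | smul c x _ hx => rw [mul_smul_comm]; exact Submodule.smul_mem _ _ hx
    | mem y hy =>
      obtain ⟨l', hl', rfl⟩ := hy
      rw [← List.prod_append, ← List.map_append]
      exact Wsp_mem X (by rw [List.length_append]; omega)

lemma Wsp_gen (i : ι) : X i ∈ Wsp X 1 := by simpa using Wsp_mem X (l := [i]) (k := 1) (by simp)

lemma Wsp_span : Submodule.span ℂ (Set.range X) ≤ Wsp X 1 := by
  rw [Submodule.span_le]; rintro _ ⟨i, rfl⟩; exact Wsp_gen X i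

lemma one_mem_Wsp (k : ℕ) : (1 : R) ∈ Wsp X k := by simpa using Wsp_mem X (l := []) (k := k) (by simp)

variable (hX : ∀ i j, X i * X j - X j * X i ∈ Submodule.span ℂ (Set.range X))

include hX in
lemma perm_prod {l l' : List ι} (h : l.Perm l') : ∀ k, l.length ≤ k + 1 → (l.map X).prod - (l'.map X).prod ∈ Wsp X k := by
  induction h with
  | nil => intro k _; simp
  | cons x h ih =>
    intro k hk
    simp only [List.map_cons, List.prod_cons, ← mul_sub]
    rcases k with _ | k
    · have : _ = [] := List.length_eq_zero_iff.mp (by simpa using hk)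
      subst this
      rw [List.nil_perm.mp h]; simp
    · rw [add_comm]
      exact Wsp_mul X (Wsp_gen X x) (ih k (by simpa using hk))
  | swap x y l =>
    intro k hk
    simp only [List.map_cons, List.prod_cons, ← mul_assoc, ← sub_mul]
    have := Wsp_mul X (Wsp_span X (hX y x)) (Wsp_mem X (le_refl l.length))
    refine Wsp_mono X ?_ this
    simp at hk; omega
  | trans h1 h2 ih1 ih2 =>
    intro k hk
    have := add_mem (ih1 k hk) (ih2 k (h1.length_eq ▸ hk))
    simpa using this

/-- standard ordered monomial -/
noncomputable def mon (a : ι →₀ ℕ) : R := ((Finsupp.toMultiset a).toList.map X).prod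

lemma card_toM (a : ι →₀ ℕ) : (Finsupp.toMultiset a).toList.length = a.degree := by
  rw [Multiset.length_toList, Finsupp.card_toMultiset]; rfl

lemma mon_mem (a : ι →₀ ℕ) : mon X a ∈ Wsp X a.degree := Wsp_mem X (card_toM a).le

include hX in
lemma mon_mul (a b : ι →₀ ℕ) (k : ℕ) (hk : a.degree + b.degree ≤ k + 1) : mon X (a + b) - mon X a * mon X b ∈ Wsp X k := by
  rw [mon, mon, mon, ← List.prod_append, ← List.map_append]
  refine perm_prod X hX ?_ k ?_
  · rw [← Multiset.coe_eq_coe, Multiset.coe_toList, ← Multiset.coe_add, Multiset.coe_toList, Multiset.coe_toList, map_add]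
  · rw [card_toM, map_add]; exact hk

include hX in
lemma Wsp_le (k : ℕ) : Wsp X k ≤ Submodule.span ℂ (mon X '' {a | a.degree ≤ k}) := by
  classical
  induction k with
  | zero =>
    refine Submodule.span_le.mpr ?_
    rintro _ ⟨l, hl, rfl⟩
    have : l = [] := List.length_eq_zero_iff.mp (by omega)
    subst this
    exact Submodule.subset_span ⟨0, by simp, by simp [mon]⟩
  | succ k ih =>
    refine Submodule.span_le.mpr ?_
    rintro _ ⟨l, hl, rfl⟩
    set a := Multiset.toFinsupp (l : Multiset ι) with ha
    have hp : l.Perm (Finsupp.toMultiset a).toList := by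
      rw [← Multiset.coe_eq_coe, Multiset.coe_toList, ha, Multiset.toFinsupp_toMultiset]
    have h1 := ih (perm_prod X hX hp k hl)
    have h2 : mon X a ∈ Submodule.span ℂ (mon X '' {a | a.degree ≤ k + 1}) :=
      Submodule.subset_span ⟨a, by rw [Set.mem_ofPred_eq, ← card_toM, ← hp.length_eq]; exact hl, rfl⟩
    have h3 : Submodule.span ℂ (mon X '' {a | a.degree ≤ k}) ≤ Submodule.span ℂ (mon X '' {a | a.degree ≤ k + 1}) :=
      Submodule.span_mono (Set.image_mono fun a ha => le_trans ha (Nat.le_succ k))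
    have := add_mem (h3 h1) h2
    rwa [mon, sub_add_cancel] at this

variable [LinearOrder ι] [Finite ι]

/-- span of the lower monomials -/
noncomputable def low (a : ι →₀ ℕ) : Submodule ℂ R := Submodule.span ℂ (mon X '' {b | toDegLex b < toDegLex a})

/-- standard exponents -/
def Std : Set (ι →₀ ℕ) := {a | mon X a ∉ low X a}

include hX in
lemma Wsp_le_low {k : ℕ} {a : ι →₀ ℕ} (h : k < a.degree) : Wsp X k ≤ low X a := by
  refine (Wsp_le X hX k).trans (Submodule.span_mono (Set.image_mono fun b hb => ?_))
  exact Finsupp.DegLex.lt_iff.mpr (Or.inl (lt_of_le_of_lt hb h))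

lemma degree_le_of_lt {a b : ι →₀ ℕ} (h : toDegLex a < toDegLex b) : a.degree ≤ b.degree := by
  rcases Finsupp.DegLex.lt_iff.mp h with h | h
  · exact h.le
  · exact h.1.le

lemma add_lt_add_deg {a b : ι →₀ ℕ} (c : ι →₀ ℕ) (h : toDegLex a < toDegLex b) : toDegLex (a + c) < toDegLex (b + c) := by
  rw [toDegLex_add, toDegLex_add]
  exact add_lt_add_left h _

include hX in
lemma Std_down {a c : ι →₀ ℕ} (h : a + c ∈ Std X) : a ∈ Std X := by
  by_contra hn
  rw [Std, Set.mem_ofPred_eq, not_not] at hn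
  apply h
  rcases Nat.eq_zero_or_pos (a + c).degree with h0 | h0
  · have : a + c = 0 := (Finsupp.degree_eq_zero_iff _).mp h0
    have h1 : a = 0 := by
      ext i; have := DFunLike.congr_fun this i; simp at this; simp [this.1]
    have h2 : c = 0 := by rw [h1, zero_add] at this; exact this
    rw [h2, add_zero]; exact hn
  obtain ⟨k, hk⟩ : ∃ k, (a + c).degree = k + 1 := ⟨_, (Nat.sub_add_cancel h0).symm⟩
  have hkl : Wsp X k ≤ low X (a + c) := Wsp_le_low X hX (by omega)
  have h1 := hkl (mon_mul X hX a c k (by rw [← hk, map_add]))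
  suffices h2 : mon X a * mon X c ∈ low X (a + c) by
    have := add_mem h1 h2
    rwa [sub_add_cancel] at this
  have h3 : low X a ≤ (low X (a + c)).comap (LinearMap.mulRight ℂ (mon X c)) := by
    refine Submodule.span_le.mpr ?_
    rintro _ ⟨b, hb, rfl⟩
    simp only [SetLike.mem_coe, Submodule.mem_comap, LinearMap.mulRight_apply]
    have hdeg := degree_le_of_lt hb
    have h4 := hkl (mon_mul X hX b c k (by rw [map_add] at hk; omega))
    have h5 : mon X (b + c) ∈ low X (a + c) := Submodule.subset_span ⟨b + c, add_lt_add_deg c hb, rfl⟩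
    have := sub_mem h5 h4
    simpa using this
  exact h3 hn

lemma mon_mem_std (a : ι →₀ ℕ) : mon X a ∈ Submodule.span ℂ (mon X '' {b | b ∈ Std X ∧ toDegLex b ≤ toDegLex a}) := by
  have key : ∀ a' : DegLex (ι →₀ ℕ), mon X (ofDegLex a') ∈ Submodule.span ℂ (mon X '' {b | b ∈ Std X ∧ toDegLex b ≤ a'}) := by
    intro a'
    induction a' using WellFoundedLT.induction with
    | ind a' ih =>
      by_cases h : ofDegLex a' ∈ Std X
      · exact Submodule.subset_span ⟨_, ⟨h, by simp⟩, rfl⟩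
      · rw [Std, Set.mem_ofPred_eq, not_not] at h
        refine (Submodule.span_le (p := Submodule.span ℂ (mon X '' {b | b ∈ Std X ∧ toDegLex b ≤ a'}))).mpr ?_ h
        rintro _ ⟨b, hb, rfl⟩
        have hb' : toDegLex b < a' := hb
        have := ih (toDegLex b) hb'
        refine Submodule.span_mono (Set.image_mono ?_) this
        rintro c ⟨hc1, hc2⟩
        exact ⟨hc1, hc2.trans hb'.le⟩
  exact key (toDegLex a)

lemma std_indep : LinearIndependent ℂ (fun a : Std X => mon X a.1) := by
  rw [linearIndependent_iff']
  intro s g hg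
  by_contra! hne
  have hT : (s.filter fun a => g a ≠ 0).Nonempty := by
    obtain ⟨i, hi, hi2⟩ := hne
    exact ⟨i, Finset.mem_filter.mpr ⟨hi, hi2⟩⟩
  obtain ⟨a, ha, hmax⟩ := Finset.exists_max_image _ (fun a : Std X => toDegLex a.1) hT
  obtain ⟨has, ha0⟩ := Finset.mem_filter.mp ha
  apply a.2
  have h1 : g a • mon X a.1 = - ∑ b ∈ s.erase a, g b • mon X b.1 := by
    rw [← Finset.add_sum_erase s _ has] at hg
    exact eq_neg_of_add_eq_zero_left hg
  have h2 : g a • mon X a.1 ∈ low X a.1 := by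
    rw [h1]
    refine neg_mem (sum_mem fun b hb => ?_)
    obtain ⟨hba, hbs⟩ := Finset.mem_erase.mp hb
    by_cases hb0 : g b = 0
    · rw [hb0, zero_smul]; exact zero_mem _
    · refine Submodule.smul_mem _ _ (Submodule.subset_span ⟨b.1, ?_, rfl⟩)
      refine lt_of_le_of_ne (hmax b (Finset.mem_filter.mpr ⟨hbs, hb0⟩)) fun h => hba ?_
      exact Subtype.ext (toDegLex_injective h)
  exact (Submodule.smul_mem_iff _ ha0).mp h2

include hX in
lemma std_degree_le {r : ℕ} (hr : Wsp X r = ⊤) {a : ι →₀ ℕ} (ha : a ∈ Std X) : a.degree ≤ r := by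
  by_contra! h
  exact ha (Wsp_le_low X hX h (hr ▸ Submodule.mem_top))

include hX in
lemma std_span {r : ℕ} (hr : Wsp X r = ⊤) : Submodule.span ℂ (mon X '' Std X) = ⊤ := by
  rw [eq_top_iff, ← hr]
  refine (Wsp_le X hX r).trans (Submodule.span_le.mpr ?_)
  rintro _ ⟨a, _, rfl⟩
  exact Submodule.span_mono (Set.image_mono fun b hb => hb.1) (mon_mem_std X a)

end PBW

lemma chain_aux {ι : Type*} [DecidableEq ι] (S : Finset (ι →₀ ℕ)) (hS : ∀ a ∈ S, ∀ b, b ≤ a → b ∈ S) (a : ι →₀ ℕ) (ha : a ∈ S) :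
    a.degree < S.card := by
  classical
  have hch : ∀ (n : ℕ) (a : ι →₀ ℕ), a.degree = n → a ∈ S → ∀ k ≤ n, ∃ b ∈ S, b.degree = k := by
    intro n
    induction n with
    | zero => intro a h1 h2 k hk; exact ⟨a, h2, by omega⟩
    | succ n ih =>
      intro a h1 h2 k hk
      rcases Nat.lt_or_eq_of_le hk with hk | hk
      · have : a ≠ 0 := by rintro rfl; simp at h1
        obtain ⟨i, hi⟩ := Finsupp.ne_iff.mp this
        have hle : Finsupp.single i 1 ≤ a := by
          rw [Finsupp.single_le_iff]; simp at hi; omega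
        have h3 : (a - Finsupp.single i 1).degree = n := by
          have : a.degree = (a - Finsupp.single i 1).degree + 1 := by
            conv_lhs => rw [← tsub_add_cancel_of_le hle, map_add, Finsupp.degree_single]
          omega
        exact ih _ h3 (hS a h2 _ tsub_le_self) k (by omega)
      · exact ⟨a, h2, by omega⟩
  have : (Finset.range (a.degree + 1)) ⊆ S.image Finsupp.degree := by
    intro k hk
    obtain ⟨b, hb, hb2⟩ := hch _ a rfl ha k (by simpa [Nat.lt_succ_iff] using hk)
    exact Finset.mem_image.mpr ⟨b, hb, hb2⟩
  have h := (Finset.card_le_card this).trans Finset.card_image_le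
  simpa using h

/-- main output of the PBW argument -/
lemma pbw {d : ℕ} {R : Type*} [Ring R] [Algebra ℂ R] [FiniteDimensional ℂ R] (X : Fin d → R)
    (hX : ∀ i j, X i * X j - X j * X i ∈ Submodule.span ℂ (Set.range X)) (r : ℕ) (hr : Wsp X r = ⊤) :
    Wsp X (Module.finrank ℂ R) = ⊤ ∧ ∀ s : ℕ, 1 ≤ s → r < s^3 → 
      Module.finrank ℂ R * s ≤ Module.finrank ℂ (Wsp X (d * s^2)) * s + d * Module.finrank ℂ (Wsp X (d * s^2)) ^ 2 := by
  classical
  have hind := std_indep X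
  have hfin : Finite (Std X) := hind.finite
  have : Fintype (Std X) := Fintype.ofFinite _
  have hspan := std_span X hX hr
  set S := (Std X).toFinset with hS
  have hcard : S.card = Module.finrank ℂ R := by
    have hb : ⊤ ≤ Submodule.span ℂ (Set.range fun a : Std X => mon X a.1) := by
      rw [← hspan, Set.image_eq_range]
    rw [Module.finrank_eq_card_basis (Module.Basis.mk hind hb), hS, Set.toFinset_card]
  have hdown : ∀ a ∈ S, ∀ b, b ≤ a → b ∈ S := by
    intro a ha b hb
    rw [hS, Set.mem_toFinset] at ha ⊢
    obtain ⟨c, rfl⟩ := exists_add_of_le hb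
    exact Std_down X hX ha
  refine ⟨?_, ?_⟩
  · rw [eq_top_iff, ← hspan]
    refine Submodule.span_le.mpr ?_
    rintro _ ⟨a, ha, rfl⟩
    have h1 := chain_aux S hdown a (by rw [hS, Set.mem_toFinset]; exact ha)
    rw [hcard] at h1
    exact Wsp_mono X h1.le (mon_mem X a)
  · intro s hs hrs
    let e : (Fin d →₀ ℕ) ≃ (Fin d → ℕ) := Finsupp.equivFunOnFinite
    set S' := S.map e.toEmbedding with hS'
    have hmem : ∀ a : Fin d → ℕ, a ∈ S' ↔ e.symm a ∈ S := by
      intro a; rw [hS', Finset.mem_map_equiv]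
    have hc := downset_count S' (fun a ha b hb => by
        rw [hmem] at ha ⊢
        exact hdown _ ha _ hb) s hs (fun a ha i => by
        rw [hmem, hS, Set.mem_toFinset] at ha
        have h1 := std_degree_le X hX hr ha
        have h2 : e.symm a i ≤ (e.symm a).degree := Finsupp.le_degree i _
        exact lt_of_le_of_lt (h2.trans h1) hrs)
    set T := S'.filter fun a => ∀ i, a i < s^2 with hT
    have hTc : T.card ≤ Module.finrank ℂ (Wsp X (d * s^2)) := by
      have hTstd : ∀ a : T, e.symm a.1 ∈ Std X := fun a => by
        have := (Finset.mem_filter.mp a.2).1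
        rw [hmem, hS, Set.mem_toFinset] at this
        exact this
      have hTW : ∀ a : T, mon X (e.symm a.1) ∈ Wsp X (d * s^2) := fun a => by
        have := (Finset.mem_filter.mp a.2).2
        refine Wsp_mono X ?_ (mon_mem X _)
        rw [Finsupp.degree_eq_sum]
        calc ∑ i, e.symm a.1 i ≤ ∑ i : Fin d, s^2 := Finset.sum_le_sum fun i _ => (this i).le
          _ = d * s^2 := by simp
      have hli : LinearIndependent ℂ (fun a : T => (⟨mon X (e.symm a.1), hTW a⟩ : Wsp X (d * s^2))) := by
        have h1 : LinearIndependent ℂ (fun a : T => mon X (e.symm a.1)) :=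
          hind.comp (fun a : T => (⟨e.symm a.1, hTstd a⟩ : Std X)) (fun a b h => by
            simp only [Subtype.mk.injEq, EmbeddingLike.apply_eq_iff_eq] at h
            exact Subtype.ext h)
        exact LinearIndependent.of_comp (Wsp X (d * s^2)).subtype h1
      have := hli.fintype_card_le_finrank
      simpa using this
    have hcS' : S'.card = Module.finrank ℂ R := by rw [hS', Finset.card_map, hcard]
    rw [hcS', Fintype.card_fin] at hc
    refine hc.trans ?_
    gcongr <;> (convert hTc <;> rfl)

end SG

set_option linter.unusedSectionVars false
namespace SG
open MeasureTheory
open scoped Matrix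

section Abs
open scoped MatrixOrder Matrix.Norms.L2Operator ComplexOrder
variable {n m : Type*} [Fintype n] [DecidableEq n] [Fintype m] [DecidableEq m]

/-- the positive square root of `Fᴴ F`. -/
noncomputable def absM (F : Matrix m n ℂ) : Matrix n n ℂ := CFC.sqrt (Fᴴ * F)

lemma psd_mm (F : Matrix m n ℂ) : 0 ≤ Fᴴ * F :=
  Matrix.nonneg_iff_posSemidef.mpr (Matrix.posSemidef_conjTranspose_mul_self F)

lemma absM_nonneg (F : Matrix m n ℂ) : 0 ≤ absM F := CFC.sqrt_nonneg _

lemma absM_herm (F : Matrix m n ℂ) : (absM F)ᴴ = absM F :=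
  (Matrix.nonneg_iff_posSemidef.mp (absM_nonneg F)).isHermitian

lemma absM_sq (F : Matrix m n ℂ) : absM F * absM F = Fᴴ * F := CFC.sqrt_mul_sqrt_self _ (psd_mm F)

lemma absM_unique {F : Matrix m n ℂ} {A : Matrix n n ℂ} (h0 : 0 ≤ A) (h : A * A = Fᴴ * F) : absM F = A :=
  CFC.sqrt_unique h h0

lemma nonneg_fac {A : Matrix n n ℂ} (h : 0 ≤ A) : ∃ X : Matrix n n ℂ, A = Xᴴ * X := by
  refine ⟨CFC.sqrt A, ?_⟩
  rw [(Matrix.nonneg_iff_posSemidef.mp (CFC.sqrt_nonneg A)).isHermitian.eq, CFC.sqrt_mul_sqrt_self A h]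

lemma trace_mul_nonneg {A B : Matrix n n ℂ} (hA : 0 ≤ A) (hB : 0 ≤ B) : 0 ≤ (A * B).trace.re := by
  obtain ⟨X, rfl⟩ := nonneg_fac hA
  obtain ⟨Y, rfl⟩ := nonneg_fac hB
  have : (Xᴴ * X * (Yᴴ * Y)).trace = (hs (Y * Xᴴ) : ℂ) := by
    rw [← trace_star_self, Matrix.conjTranspose_mul, Matrix.conjTranspose_conjTranspose, Matrix.mul_assoc,
      Matrix.trace_mul_comm Xᴴ, Matrix.mul_assoc, Matrix.mul_assoc, Matrix.mul_assoc]
  rw [this, Complex.ofReal_re]; exact hs_nonneg _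

lemma absM_add {S : Matrix n n ℂ} (h : Sᴴ = S) : 0 ≤ absM S + S := by
  have h' : IsSelfAdjoint S := h
  have := CFC.abs_add_self S h'
  have h2 : absM S = CFC.abs S := rfl
  rw [h2, this]
  exact nsmul_nonneg (CFC.posPart_nonneg S) 2

lemma absM_sub {S : Matrix n n ℂ} (h : Sᴴ = S) : 0 ≤ absM S - S := by
  have h' : IsSelfAdjoint S := h
  have := CFC.abs_sub_self S h'
  have h2 : absM S = CFC.abs S := rfl
  rw [h2, this]
  exact nsmul_nonneg (CFC.negPart_nonneg S) 2

lemma hs_eq_re {n m : Type*} [Fintype n] [Fintype m] (X : Matrix n m ℂ) : hs X = (Xᴴ * X).trace.re := by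
  rw [trace_star_self, Complex.ofReal_re]

lemma hs_abs_herm {S R : Matrix n n ℂ} (hS : Sᴴ = S) (hR : Rᴴ = R) : hs (absM S - absM R) ≤ hs (S - R) := by
  have h1 := trace_mul_nonneg (absM_add hS) (absM_sub hR)
  have h2 := trace_mul_nonneg (absM_sub hS) (absM_add hR)
  have hA := absM_sq S
  have hB := absM_sq R
  have hAh := absM_herm S
  have hBh := absM_herm R
  generalize absM S = A at *
  generalize absM R = B at *
  rw [hs_eq_re, hs_eq_re]
  simp only [Matrix.conjTranspose_sub, hS, hR, hAh, hBh, mul_sub, sub_mul, mul_add, add_mul, Matrix.trace_sub,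
    Matrix.trace_add, Complex.add_re, Complex.sub_re, hA, hB] at *
  rw [Matrix.trace_mul_comm B A, Matrix.trace_mul_comm R S]
  linarith

lemma hs_fromBlocks {a b c d : Type*} [Fintype a] [Fintype b] [Fintype c] [Fintype d] (A : Matrix a c ℂ) (B : Matrix a d ℂ)
   (C : Matrix b c ℂ) (D : Matrix b d ℂ) : hs (Matrix.fromBlocks A B C D) = hs A + hs B + hs C + hs D := by
  simp [hs, Fintype.sum_sum_type, Finset.sum_add_distrib]; ring

lemma hs_conjTranspose {n m : Type*} [Fintype n] [Fintype m] (X : Matrix n m ℂ) : hs Xᴴ = hs X := by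
  simp only [hs, Matrix.conjTranspose_apply, norm_star]
  exact Finset.sum_comm

lemma absM_block (F : Matrix m n ℂ) : absM (Matrix.fromBlocks 0 F Fᴴ 0) = Matrix.fromBlocks (absM Fᴴ) 0 0 (absM F) := by
  apply absM_unique
  · obtain ⟨X, hX⟩ := nonneg_fac (absM_nonneg Fᴴ)
    obtain ⟨Y, hY⟩ := nonneg_fac (absM_nonneg F)
    have : Matrix.fromBlocks (absM Fᴴ) 0 0 (absM F) = (Matrix.fromBlocks X 0 0 Y)ᴴ * (Matrix.fromBlocks X 0 0 Y) := by
      rw [Matrix.fromBlocks_conjTranspose, Matrix.fromBlocks_multiply]; simp [hX, hY]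
    rw [this]; exact psd_mm _
  · rw [Matrix.fromBlocks_conjTranspose, Matrix.fromBlocks_multiply, Matrix.fromBlocks_multiply]
    simp [absM_sq]

lemma hs_abs (F H : Matrix m n ℂ) : hs (absM F - absM H) ≤ 2 * hs (F - H) := by
  have := hs_abs_herm (S := Matrix.fromBlocks 0 F Fᴴ 0) (R := Matrix.fromBlocks 0 H Hᴴ 0)
    (by simp [Matrix.fromBlocks_conjTranspose]) (by simp [Matrix.fromBlocks_conjTranspose])
  rw [absM_block, absM_block, sub_eq_add_neg, Matrix.fromBlocks_neg, Matrix.fromBlocks_add, sub_eq_add_neg, Matrix.fromBlocks_neg, Matrix.fromBlocks_add,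
    hs_fromBlocks, hs_fromBlocks] at this
  simp only [← sub_eq_add_neg, sub_self, ← Matrix.conjTranspose_sub, hs_conjTranspose] at this
  have h1 := hs_nonneg (absM Fᴴ - absM Hᴴ)
  have h2 : hs (0 : Matrix m n ℂ) = 0 := by simp [hs]
  have h3 : hs (0 : Matrix n m ℂ) = 0 := by simp [hs]
  have h4 : hs (0 : Matrix n n ℂ) = 0 := by simp [hs]
  have h5 : hs (0 : Matrix m m ℂ) = 0 := by simp [hs]
  linarith

lemma absM_conj (F : Matrix m n ℂ) {V : Matrix m m ℂ} {W : Matrix n n ℂ} (hV : Vᴴ * V = 1) (hW : Wᴴ * W = 1) :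
    absM (V * F * Wᴴ) = W * absM F * Wᴴ := by
  apply absM_unique
  · obtain ⟨Y, hY⟩ := nonneg_fac (absM_nonneg F)
    have : W * absM F * Wᴴ = (Y * Wᴴ)ᴴ * (Y * Wᴴ) := by
      rw [hY]; simp [Matrix.mul_assoc]
    rw [this]; exact psd_mm _
  · have h1 : W * absM F * Wᴴ * (W * absM F * Wᴴ) = W * (absM F * ((Wᴴ * W) * absM F)) * Wᴴ := by
      simp only [Matrix.mul_assoc]
    rw [h1, hW, Matrix.one_mul, absM_sq]
    have h2 : (V * F * Wᴴ)ᴴ * (V * F * Wᴴ) = W * (Fᴴ * ((Vᴴ * V) * F)) * Wᴴ := by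
      simp only [Matrix.conjTranspose_mul, Matrix.conjTranspose_conjTranspose, Matrix.mul_assoc]
    rw [h2, hV, Matrix.one_mul]

lemma hs_absM (F : Matrix m n ℂ) : hs (absM F) = hs F := by
  rw [hs_eq_re, hs_eq_re, absM_herm, absM_sq]

lemma hs_absM_mul {l : Type*} [Fintype l] (F : Matrix m n ℂ) (Y : Matrix n l ℂ) : hs (absM F * Y) = hs (F * Y) := by
  rw [hs_eq_re, hs_eq_re, Matrix.conjTranspose_mul, Matrix.conjTranspose_mul, absM_herm]
  congr 2
  rw [Matrix.mul_assoc, ← Matrix.mul_assoc (absM F), absM_sq]; simp only [Matrix.mul_assoc]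

/-- Cauchy-Schwarz -/
lemma cs_hs (X Y : Matrix m n ℂ) : ‖(Xᴴ * Y).trace‖ ^ 2 ≤ hs X * hs Y := by
  have h := cs (fun ij : m × n => X ij.1 ij.2) (fun ij : m × n => Y ij.1 ij.2)
  have e : ∀ Z : Matrix m n ℂ, nsq (fun ij : m × n => Z ij.1 ij.2) = hs Z := fun Z => by
    simp [nsq, hs, Fintype.sum_prod_type]
  rw [e, e] at h
  convert h using 3
  simp only [Matrix.trace, Matrix.diag, Matrix.mul_apply, dotProduct, Fintype.sum_prod_type, Matrix.conjTranspose_apply, Pi.star_apply]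
  exact Finset.sum_comm

/-- the trace of a Hermitian matrix of small rank, against anything -/
lemma trace_rank {T : Matrix n n ℂ} (hT : Tᴴ = T) (Y : Matrix n n ℂ) : ‖(T * Y).trace‖ ^ 2 ≤ T.rank * hs (T * Y) := by
  have hT' : T.IsHermitian := hT
  obtain ⟨Q, hQ, hQT, hQh⟩ : ∃ Q : Matrix n n ℂ, Qᴴ = Q ∧ Q * T = T ∧ hs Q = T.rank := by
    have hsp := hT'.spectral_theorem
    set V : Matrix n n ℂ := (hT'.eigenvectorUnitary : Matrix n n ℂ) with hV
    have hVV : Vᴴ * V = 1 := Unitary.coe_star_mul_self hT'.eigenvectorUnitary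
    have hsp2 : T = V * Matrix.diagonal (fun i => (hT'.eigenvalues i : ℂ)) * Vᴴ := by
      conv_lhs => rw [hsp]
      rw [Unitary.conjStarAlgAut_apply]; rfl
    let d : n → ℂ := fun i => if hT'.eigenvalues i ≠ 0 then 1 else 0
    have hdd : Matrix.diagonal d * Matrix.diagonal d = Matrix.diagonal d := by
      rw [Matrix.diagonal_mul_diagonal]; congr; funext i; simp [d]
    have hds : (Matrix.diagonal d)ᴴ = Matrix.diagonal d := by
      rw [Matrix.diagonal_conjTranspose]; congr; funext i; simp only [d, Pi.star_apply]; split_ifs <;> simp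
    have hQ : (V * Matrix.diagonal d * Vᴴ)ᴴ = V * Matrix.diagonal d * Vᴴ := by
      simp only [Matrix.conjTranspose_mul, Matrix.conjTranspose_conjTranspose, hds, Matrix.mul_assoc]
    refine ⟨V * Matrix.diagonal d * Vᴴ, hQ, ?_, ?_⟩
    · conv_lhs => rw [hsp2]
      conv_rhs => rw [hsp2]
      have : ∀ A B : Matrix n n ℂ, V * A * Vᴴ * (V * B * Vᴴ) = V * (A * ((Vᴴ * V) * B)) * Vᴴ := by
        intro A B; simp only [Matrix.mul_assoc]
      rw [this, hVV, Matrix.one_mul, Matrix.diagonal_mul_diagonal]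
      congr 3
      funext i; simp only [d]; by_cases h : hT'.eigenvalues i = 0 <;> simp [h]
    · rw [hs_eq_re, hQ]
      have : V * Matrix.diagonal d * Vᴴ * (V * Matrix.diagonal d * Vᴴ) = V * (Matrix.diagonal d * ((Vᴴ * V) * Matrix.diagonal d)) * Vᴴ := by
        simp only [Matrix.mul_assoc]
      rw [this, hVV, Matrix.one_mul, hdd, Matrix.trace_mul_comm, ← Matrix.mul_assoc, hVV, Matrix.one_mul, Matrix.trace_diagonal,
        hT'.rank_eq_card_non_zero_eigs, Fintype.card_subtype]
      simp [d, apply_ite Complex.re, Finset.card_filter, ite_not]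
  calc ‖(T * Y).trace‖ ^ 2 = ‖(Qᴴ * (T * Y)).trace‖ ^ 2 := by rw [hQ, ← Matrix.mul_assoc, hQT]
    _ ≤ _ := by rw [← hQh]; exact cs_hs _ _

lemma rank_absM (F : Matrix m n ℂ) : (absM F).rank ≤ Fintype.card m := by
  rw [← Matrix.rank_conjTranspose_mul_self, absM_herm, absM_sq, Matrix.rank_conjTranspose_mul_self]
  exact Matrix.rank_le_card_height F

end Abs
end SG

set_option linter.unusedSectionVars false
namespace SG
open MeasureTheory
open scoped Matrix

section Key
variable {q m : ℕ} (p : Fin m → ℝ) (U : Fin m → G q)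
variable (hp : ∀ k, 0 ≤ p k) (hpsum : ∑ k, p k = 1)

include hpsum in
lemma avg_nsq {n : Type*} [Fintype n] [DecidableEq n] {ρ : G q →* Matrix n n ℂ} (hu : Uni ρ) (x : n → ℂ) :
    ∑ j, ∑ k, (p j * p k) * nsq (ρ ((U j)⁻¹ * U k) *ᵥ x - x) = 2 * (nsq x - (star x ⬝ᵥ (Aav p U ρ *ᵥ x)).re) := by
  have h1 : (star x ⬝ᵥ (Aav p U ρ *ᵥ x)).re = ∑ j, ∑ k, (p j * p k) * (star x ⬝ᵥ (ρ ((U j)⁻¹ * U k) *ᵥ x)).re := by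
    simp only [Aav, Matrix.sum_mulVec, dotProduct_sum, Complex.re_sum, Matrix.smul_mulVec, dotProduct_smul, smul_eq_mul,
      Complex.re_ofReal_mul]
  have h2 : nsq x = ∑ j, ∑ k, (p j * p k) * nsq x := by
    simp_rw [← Finset.sum_mul]; rw [← Finset.sum_mul_sum, hpsum]; simp
  rw [h1]
  conv_rhs => rw [h2]
  rw [← Finset.sum_sub_distrib, Finset.mul_sum]
  refine Finset.sum_congr rfl fun j _ => ?_
  rw [← Finset.sum_sub_distrib, Finset.mul_sum]
  refine Finset.sum_congr rfl fun k _ => ?_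
  rw [avg_fix_aux (hu.mul _)]; ring

variable {n κ : Type*} [Fintype n] [DecidableEq n] [Fintype κ] [DecidableEq κ]

/-- the matrix with columns `w a *ᵥ x`. -/
def Fm (w : κ → Matrix n n ℂ) (x : n → ℂ) : Matrix n κ ℂ := Matrix.of fun i a => (w a *ᵥ x) i

lemma Fm_sub (w : κ → Matrix n n ℂ) (x y : n → ℂ) : Fm w (x - y) = Fm w x - Fm w y := by
  ext i a; simp [Fm, Matrix.mulVec_sub]

/-- `σ ⊗ conj σ`. -/
noncomputable def dbl (σ : G q →* Matrix κ κ ℂ) : G q →* Matrix (κ × κ) (κ × κ) ℂ where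
  toFun g := Matrix.of fun i j => σ g i.1 j.1 * (starRingEnd ℂ) (σ g i.2 j.2)
  map_one' := by
    ext ⟨a, b⟩ ⟨c, d⟩
    simp only [map_one, Matrix.of_apply, Matrix.one_apply, Prod.mk.injEq]
    by_cases h1 : a = c <;> by_cases h2 : b = d <;> simp [h1, h2]
  map_mul' g h := by
    ext ⟨a, b⟩ ⟨c, d⟩
    simp only [map_mul, Matrix.of_apply, Matrix.mul_apply, map_sum, Fintype.sum_prod_type, Finset.sum_mul_sum]
    refine Finset.sum_congr rfl fun x _ => Finset.sum_congr rfl fun y _ => ?_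
    ring

def vecM (T : Matrix κ κ ℂ) : κ × κ → ℂ := fun i => T i.1 i.2

lemma nsq_vecM (T : Matrix κ κ ℂ) : nsq (vecM T) = hs T := by
  simp [nsq, hs, vecM, Fintype.sum_prod_type]

lemma dot_vecM (T Y : Matrix κ κ ℂ) : star (vecM T) ⬝ᵥ vecM Y = (Tᴴ * Y).trace := by
  simp only [Matrix.trace, Matrix.diag, Matrix.mul_apply, dotProduct, Fintype.sum_prod_type, Matrix.conjTranspose_apply, Pi.star_apply, vecM]
  exact Finset.sum_comm

lemma dbl_vecM (σ : G q →* Matrix κ κ ℂ) (g : G q) (T : Matrix κ κ ℂ) : dbl σ g *ᵥ vecM T = vecM (σ g * T * (σ g)ᴴ) := by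
  ext ⟨a, b⟩
  simp only [dbl, vecM, Matrix.mulVec, dotProduct, MonoidHom.coe_mk, OneHom.coe_mk, Matrix.of_apply, Fintype.sum_prod_type,
    Matrix.mul_apply, Matrix.conjTranspose_apply, Finset.sum_mul]
  rw [Finset.sum_comm]
  refine Finset.sum_congr rfl fun x _ => Finset.sum_congr rfl fun y _ => ?_
  rw [RCLike.star_def]; ring

lemma dbl_uni {σ : G q →* Matrix κ κ ℂ} (hu : Uni σ) : Uni (dbl σ) := by
  intro g
  ext ⟨a, b⟩ ⟨c, d⟩
  have h := hu g
  simp only [dbl, MonoidHom.coe_mk, OneHom.coe_mk, Matrix.of_apply, Matrix.conjTranspose_apply, ← h, map_mul, star_mul', RCLike.star_def]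

lemma dbl_P {σ : G q →* Matrix κ κ ℂ} {k : ℕ} (hk : ∀ i j, (fun g => σ g i j) ∈ P q k) (i j : κ × κ) :
    (fun g => dbl σ g i j) ∈ P q (2 * k) := by
  rw [two_mul]
  exact P_mul q k k (hk i.1 j.1) (P_conj q k (hk i.2 j.2))

variable {π : G q →* Matrix n n ℂ} {σ : G q →* Matrix κ κ ℂ} {w : κ → Matrix n n ℂ}
variable (hπ : Uni π) (hσ : Uni σ) (hsch : ∀ A : Matrix n n ℂ, (∀ g, π g * A = A * π g) → ∃ c : ℂ, A = c • 1)
variable (hw : ∀ a b, ((w a)ᴴ * w b).trace = if a = b then 1 else 0)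
variable (hwσ : ∀ g b, π g * w b * π g⁻¹ = ∑ a, σ g a b • w a)

include hwσ hσ in
lemma Fm_equiv (g : G q) (x : n → ℂ) : Fm w (π g *ᵥ x) = π g * Fm w x * (σ g)ᴴ := by
  have h : ∀ a, w a * π g = π g * ∑ b, σ g⁻¹ b a • w b := fun a => by
    rw [← hwσ, inv_inv, ← Matrix.mul_assoc, ← Matrix.mul_assoc, ← map_mul]; simp
  ext i a
  have e : ∀ x b, (w b *ᵥ x) = fun i => Fm w x i b := fun x b => rfl
  calc Fm w (π g *ᵥ x) i a = ((w a * π g) *ᵥ x) i := by simp [Fm]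
    _ = (π g *ᵥ (∑ b, σ g⁻¹ b a • (w b *ᵥ x))) i := by
      rw [h, ← Matrix.mulVec_mulVec, Matrix.sum_mulVec]; simp only [Matrix.smul_mulVec]
    _ = _ := by
      rw [hσ, Matrix.mul_assoc, Matrix.mul_apply, Matrix.mulVec, dotProduct]
      refine Finset.sum_congr rfl fun j _ => ?_
      congr 1
      simp [Matrix.mul_apply, Fm, mul_comm]

lemma ext_form {A B : Matrix n n ℂ} (h : ∀ x y : n → ℂ, star x ⬝ᵥ (A *ᵥ y) = star x ⬝ᵥ (B *ᵥ y)) : A = B := by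
  ext i j
  have := h (Pi.single i 1) (Pi.single j 1)
  simpa [← Pi.single_star] using this

include hπ hwσ hσ hsch hw in
lemma hs_FY [Nonempty n] {Y : Matrix κ κ ℂ} (hY : ∀ g, σ g * Y = Y * σ g) (x : n → ℂ) :
    hs (Fm w x * Y) = hs Y / Fintype.card n * nsq x := by
  set z : κ → Matrix n n ℂ := fun b => ∑ a, Y a b • w a with hz
  set K : Matrix n n ℂ := ∑ b, (z b)ᴴ * z b with hK
  have hFz : ∀ x i b, (Fm w x * Y) i b = (z b *ᵥ x) i := by
    intro x i b
    simp only [hz, Matrix.sum_mulVec, Matrix.smul_mulVec, Matrix.mul_apply, Fm, Matrix.of_apply, Finset.sum_apply, Pi.smul_apply, smul_eq_mul]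
    exact Finset.sum_congr rfl fun _ _ => mul_comm _ _
  have hform : ∀ x y, star x ⬝ᵥ (K *ᵥ y) = ((Fm w x * Y)ᴴ * (Fm w y * Y)).trace := by
    intro x y
    simp only [hK, Matrix.sum_mulVec, dotProduct_sum, ← Matrix.mulVec_mulVec, ← star_mulVec_dot, Matrix.trace, Matrix.diag]
    refine Finset.sum_congr rfl fun b _ => ?_
    rw [Matrix.mul_apply, dotProduct]
    refine Finset.sum_congr rfl fun i _ => ?_
    rw [Matrix.conjTranspose_apply, hFz, hFz, Pi.star_apply]
  have hinv : ∀ g x, Fm w (π g *ᵥ x) * Y = π g * (Fm w x * Y) * (σ g)ᴴ := by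
    intro g x
    rw [Fm_equiv hσ hwσ]
    rw [Matrix.mul_assoc, hσ, hY, ← Matrix.mul_assoc, ← Matrix.mul_assoc]
  have hcomm : ∀ g, π g * K = K * π g := by
    intro g
    have : (π g)ᴴ * K * π g = K := by
      apply ext_form
      intro x y
      rw [hform, ← Matrix.mulVec_mulVec, ← Matrix.mulVec_mulVec, ← star_mulVec_dot, hform, hinv, hinv]
      have e : ∀ A B : Matrix n κ ℂ, (π g * A * (σ g)ᴴ)ᴴ * (π g * B * (σ g)ᴴ) = σ g * (Aᴴ * ((π g)ᴴ * π g) * B * (σ g)ᴴ) := by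
        intro A B; simp only [Matrix.conjTranspose_mul, Matrix.conjTranspose_conjTranspose, Matrix.mul_assoc]
      rw [e, hπ.mul, Matrix.mul_one, Matrix.trace_mul_comm, Matrix.mul_assoc, hσ.mul, Matrix.mul_one]
    have h2 : π g * (π g)ᴴ = 1 := by rw [hπ, ← map_mul]; simp
    calc π g * K = π g * ((π g)ᴴ * K * π g) := by rw [this]
      _ = (π g * (π g)ᴴ) * K * π g := by simp only [Matrix.mul_assoc]
      _ = _ := by rw [h2, Matrix.one_mul]
  obtain ⟨c, hc⟩ := hsch K hcomm
  have htr : K.trace = hs Y := by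
    rw [← trace_star_self]
    simp only [hK, hz, Matrix.trace_sum, Matrix.conjTranspose_sum, Matrix.conjTranspose_smul, Finset.sum_mul, Finset.mul_sum, Matrix.smul_mul, Matrix.mul_smul,
      Matrix.trace_smul, hw]
    simp only [smul_eq_mul, mul_ite, mul_one, mul_zero, Finset.sum_ite_eq, Finset.mem_univ, if_true, Matrix.trace, Matrix.diag, Matrix.mul_apply, Matrix.conjTranspose_apply]
    first | rfl | simp [mul_comm] 
  have hcv : c * Fintype.card n = hs Y := by
    rw [← htr, hc]; simp
  have hD : (Fintype.card n : ℂ) ≠ 0 := by simp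
  have hc2 : c = ((hs Y / Fintype.card n : ℝ) : ℂ) := by
    push_cast; field_simp; exact hcv
  have := hform x x
  rw [trace_star_self, hc, Matrix.smul_mulVec, Matrix.one_mulVec, dotProduct_smul, star_dot_self, hc2, smul_eq_mul] at this
  exact_mod_cast this.symm

include hπ hwσ hσ hsch hw hp hpsum in
theorem key_ineq [Nonempty n] (μ : Measure (G q)) [μ.IsMulLeftInvariant] [IsProbabilityMeasure μ] {k : ℕ} (hk : ∀ i j, (fun g => σ g i j) ∈ P q k) {f : n → ℂ} (hf : nsq f = 1) {l : ℝ}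
    (hl : (star f ⬝ᵥ (Aav p U π *ᵥ f)).re = l) :
    (1 - beta p U μ (2 * k)) * ((Fintype.card κ : ℝ) / Fintype.card n - 1) ≤ 2 * ((Fintype.card κ : ℝ) / Fintype.card n) * (1 - l) := by
  obtain ⟨D, hD⟩ : ∃ D : ℝ, D = Fintype.card n := ⟨_, rfl⟩
  obtain ⟨DW, hDW⟩ : ∃ D : ℝ, D = Fintype.card κ := ⟨_, rfl⟩
  rw [← hD, ← hDW]
  have hDpos : 0 < D := by simp [hD, Fintype.card_pos]
  have hF : ∀ x, hs (Fm w x) = DW / D * nsq x := by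
    intro x
    have := hs_FY hπ hσ hsch hw hwσ (Y := 1) (by simp) x
    rw [Matrix.mul_one] at this
    rw [this, ← hD]
    congr 2
    simp [hs, Matrix.one_apply, apply_ite norm, hDW]
  set T := absM (Fm w f) with hT
  have hρ := dbl_uni hσ
  have hρP := dbl_P hk
  have hcont : Continuous (dbl σ) := cont_of_P hρP
  have hTn : nsq (vecM T) = DW / D := by rw [nsq_vecM, hT, hs_absM, hF, hf, mul_one]
  -- upper bound
  have hup : nsq (vecM T) - (star (vecM T) ⬝ᵥ (Aav p U (dbl σ) *ᵥ vecM T)).re ≤ 2 * (DW / D) * (1 - l) := by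
    have h1 := avg_nsq p U hpsum hρ (vecM T)
    have h2 := avg_nsq p U hpsum hπ f
    rw [hf, hl] at h2
    have h3 : ∀ g, nsq (dbl σ g *ᵥ vecM T - vecM T) ≤ 2 * (DW / D) * nsq (π g *ᵥ f - f) := by
      intro g
      rw [dbl_vecM]
      have : vecM (σ g * T * (σ g)ᴴ) - vecM T = vecM (σ g * T * (σ g)ᴴ - T) := rfl
      rw [this, nsq_vecM, hT, ← absM_conj (Fm w f) (hπ.mul g) (hσ.mul g), ← Fm_equiv hσ hwσ, mul_assoc, ← hF, Fm_sub]
      exact hs_abs _ _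
    have h4 : ∑ j, ∑ k, (p j * p k) * nsq (dbl σ ((U j)⁻¹ * U k) *ᵥ vecM T - vecM T) ≤
        ∑ j, ∑ k, (p j * p k) * (2 * (DW / D) * nsq (π ((U j)⁻¹ * U k) *ᵥ f - f)) := by
      refine Finset.sum_le_sum fun j _ => Finset.sum_le_sum fun k _ => ?_
      exact mul_le_mul_of_nonneg_left (h3 _) (mul_nonneg (hp j) (hp k))
    have h5 : ∑ j, ∑ k, (p j * p k) * (2 * (DW / D) * nsq (π ((U j)⁻¹ * U k) *ᵥ f - f)) =
      2 * (DW / D) * ∑ j, ∑ k, (p j * p k) * nsq (π ((U j)⁻¹ * U k) *ᵥ f - f) := by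
      simp only [Finset.mul_sum]
      refine Finset.sum_congr rfl fun j _ => Finset.sum_congr rfl fun k _ => ?_
      ring
    rw [h5, h2, h1] at h4
    linarith
  -- invariant part
  set t := vecM T with ht
  set t0 := E μ (dbl σ) *ᵥ t with ht0
  have hinv : ∀ g, dbl σ g *ᵥ t0 = t0 := fun g => by rw [ht0, Matrix.mulVec_mulVec, rho_E μ hcont]
  have horth : ∀ z, (∀ g, dbl σ g *ᵥ z = z) → star z ⬝ᵥ t0 = star z ⬝ᵥ t := by
    intro z hz
    have := E_fix μ hcont hz
    conv_rhs => rw [← this]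
    rw [star_mulVec_dot, E_herm μ hcont hρ]
  have horth' : ∀ z, (∀ g, dbl σ g *ᵥ z = z) → star z ⬝ᵥ (t - t0) = 0 := by
    intro z hz; rw [dotProduct_sub, horth z hz, sub_self]
  have hgap := Lgap p U μ hρ hpsum hρP (t - t0) horth'
  have hAt0 : Aav p U (dbl σ) *ᵥ t0 = t0 := by
    have h := Aav_left p U hpsum (rho_E μ hcont)
    rw [ht0, Matrix.mulVec_mulVec, h]
  have h00 := horth' t0 hinv
  have h01 : star (t - t0) ⬝ᵥ t0 = 0 := by
    rw [Matrix.star_dotProduct, h00, star_zero]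
  have hA1 : star t0 ⬝ᵥ (Aav p U (dbl σ) *ᵥ (t - t0)) = 0 := by
    have := star_mulVec_dot (Aav p U (dbl σ)) t0 (t - t0)
    rw [Aav_herm p U hρ, hAt0] at this
    rw [← this, h00]
  have hexp : (star t ⬝ᵥ (Aav p U (dbl σ) *ᵥ t)).re = (star (t - t0) ⬝ᵥ (Aav p U (dbl σ) *ᵥ (t - t0))).re + nsq t0 := by
    have e : t = (t - t0) + t0 := by simp
    conv_lhs => rw [e]
    rw [Matrix.mulVec_add, star_add, add_dotProduct, dotProduct_add, dotProduct_add, hAt0, hA1, h01, star_dot_self]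
    simp
  have hns : nsq t = nsq (t - t0) + nsq t0 := by
    have e : t = (t - t0) + t0 := by simp
    conv_lhs => rw [nsq_eq_re, e]
    rw [star_add, add_dotProduct, dotProduct_add, dotProduct_add, h00, h01, star_dot_self, star_dot_self]
    simp
  -- the bound for the invariant part
  have hle1 : nsq t0 ≤ 1 := by
    set Y : Matrix κ κ ℂ := Matrix.of fun a b => t0 (a, b) with hY
    have hYt : vecM Y = t0 := rfl
    have hYc : ∀ g, σ g * Y = Y * σ g := by
      intro g
      have h := hinv g
      rw [← hYt, dbl_vecM] at h
      have h' : σ g * Y * (σ g)ᴴ = Y := by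
        ext a b; exact congrFun h (a, b)
      calc σ g * Y = σ g * Y * ((σ g)ᴴ * σ g) := by rw [hσ.mul, Matrix.mul_one]
        _ = σ g * Y * (σ g)ᴴ * σ g := by simp only [Matrix.mul_assoc]
        _ = _ := by rw [h']
    have h1 : ((T * Y).trace : ℂ) = nsq t0 := by
      have h := horth t0 hinv
      rw [star_dot_self] at h
      have h3 := dot_vecM T Y
      rw [hYt, ← ht, absM_herm] at h3
      rw [← h3, Matrix.star_dotProduct, ← h]; simp
    have h2 := trace_rank (absM_herm (Fm w f)) Y
    rw [h1, hs_absM_mul, hs_FY hπ hσ hsch hw hwσ hYc, hf, ← nsq_vecM, hYt, ← hD] at h2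
    have h3 : ((absM (Fm w f)).rank : ℝ) ≤ D := by
      rw [hD]; exact_mod_cast rank_absM _
    have h4 : 0 ≤ nsq t0 := nsq_nonneg _
    rw [Complex.norm_real, Real.norm_of_nonneg h4] at h2
    have h5 : ((absM (Fm w f)).rank : ℝ) * (nsq t0 / D * 1) ≤ nsq t0 := by
      calc _ ≤ D * (nsq t0 / D * 1) := by gcongr
        _ = _ := by field_simp
    nlinarith
  have hβ := beta_le_one p U μ hp hpsum (2 * k)
  have hfin := mul_le_mul_of_nonneg_left hle1 (sub_nonneg.mpr hβ)
  rw [hexp, hns] at hup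
  rw [hTn] at hns
  rw [mul_assoc] at hup ⊢
  generalize DW / D * (1 - l) = R at *
  rw [hns]
  linarith

end Key
end SG

set_option linter.unusedSectionVars false
namespace SG
open MeasureTheory
open scoped Matrix

section Sub
variable {n : Type*} [Fintype n] [DecidableEq n]

lemma exists_onb (W : Submodule ℂ (Matrix n n ℂ)) : ∃ w : Fin (Module.finrank ℂ W) → Matrix n n ℂ,
    (∀ a, w a ∈ W) ∧ (∀ a b, ((w a)ᴴ * w b).trace = if a = b then 1 else 0) ∧
    ∀ X ∈ W, X = ∑ a, ((w a)ᴴ * X).trace • w a := by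
  let e : Matrix n n ℂ ≃ₗ[ℂ] EuclideanSpace ℂ (n × n) :=
    (LinearEquiv.curry ℂ ℂ n n).symm ≪≫ₗ (WithLp.linearEquiv 2 ℂ (n × n → ℂ)).symm
  have he : ∀ X i j, e X (i, j) = X i j := fun X i j => rfl
  have hin : ∀ X Y, inner ℂ (e X) (e Y) = (Xᴴ * Y).trace := by
    intro X Y
    rw [EuclideanSpace.inner_eq_star_dotProduct, dotProduct_comm]
    simp only [Matrix.trace, Matrix.diag, Matrix.mul_apply, dotProduct, Fintype.sum_prod_type, Matrix.conjTranspose_apply, Pi.star_apply]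
    rw [Finset.sum_comm]; rfl
  let W' := W.map e.toLinearMap
  have hfr : Module.finrank ℂ W' = Module.finrank ℂ W := LinearEquiv.finrank_map_eq e W
  let b := (stdOrthonormalBasis ℂ W').reindex (finCongr hfr)
  have hbW : ∀ a, e.symm (b a : EuclideanSpace ℂ (n × n)) ∈ W := by
    intro a
    obtain ⟨X, hX, hXe⟩ := (b a).2
    have : e.symm (b a : EuclideanSpace ℂ (n × n)) = X := by rw [← hXe]; exact e.symm_apply_apply X
    rw [this]; exact hX
  refine ⟨fun a => e.symm (b a : EuclideanSpace ℂ (n × n)), hbW, ?_, ?_⟩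
  · intro a c
    rw [← hin, e.apply_symm_apply, e.apply_symm_apply, ← Submodule.coe_inner]
    exact orthonormal_iff_ite.mp b.orthonormal a c
  · intro X hX
    have hXW : e X ∈ W' := ⟨X, hX, rfl⟩
    have h := b.sum_repr' ⟨e X, hXW⟩
    have h2 := congrArg (fun z : W' => e.symm (z : EuclideanSpace ℂ (n × n))) h
    simp only [Submodule.coe_sum, Submodule.coe_smul, map_sum, map_smul, e.symm_apply_apply] at h2
    rw [← h2]
    refine Finset.sum_congr rfl fun a _ => ?_
    rw [h2, ← hin, e.apply_symm_apply, Submodule.coe_inner]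

variable {q m : ℕ} (p : Fin m → ℝ) (U : Fin m → G q)
variable (hp : ∀ k, 0 ≤ p k) (hpsum : ∑ k, p k = 1)
variable {π : G q →* Matrix n n ℂ} 
variable (hπ : Uni π) (hsch : ∀ A : Matrix n n ℂ, (∀ g, π g * A = A * π g) → ∃ c : ℂ, A = c • 1)

include hπ hsch hp hpsum in
theorem key_sub [Nonempty n] (μ : Measure (G q)) [μ.IsMulLeftInvariant] [IsProbabilityMeasure μ] {k : ℕ}
    (W : Submodule ℂ (Matrix n n ℂ)) (hW : ∀ g, ∀ X ∈ W, π g * X * π g⁻¹ ∈ W)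
    (hWP : ∀ X ∈ W, ∀ i j, (fun g => (π g * X * π g⁻¹) i j) ∈ P q k) {f : n → ℂ} (hf : nsq f = 1) {l : ℝ}
    (hl : (star f ⬝ᵥ (Aav p U π *ᵥ f)).re = l) :
    (1 - beta p U μ (2 * k)) * ((Module.finrank ℂ W : ℝ) / Fintype.card n - 1) ≤ 2 * ((Module.finrank ℂ W : ℝ) / Fintype.card n) * (1 - l) := by
  obtain ⟨w, hwW, hw, hexp⟩ := exists_onb W
  have hmul : ∀ g, π g * π g⁻¹ = 1 := fun g => by rw [← map_mul]; simp
  let σ : G q →* Matrix (Fin (Module.finrank ℂ W)) (Fin (Module.finrank ℂ W)) ℂ :=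
    { toFun := fun g => Matrix.of fun a c => ((w a)ᴴ * (π g * w c * π g⁻¹)).trace
      map_one' := by
        ext a c
        simp [Matrix.one_apply, hw]
      map_mul' := fun g h => by
        ext a c
        simp only [Matrix.of_apply, Matrix.mul_apply]
        have h1 := hexp _ (hW h _ (hwW c))
        have h2 : π (g * h) * w c * π (g * h)⁻¹ = π g * (π h * w c * π h⁻¹) * π g⁻¹ := by
          rw [mul_inv_rev, map_mul, map_mul]; simp only [Matrix.mul_assoc]
        rw [h2]
        conv_lhs => rw [h1]
        simp only [Matrix.mul_sum, Matrix.sum_mul, Matrix.trace_sum, Matrix.mul_smul, Matrix.smul_mul, Matrix.trace_smul, smul_eq_mul]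
        exact Finset.sum_congr rfl fun _ _ => mul_comm _ _ }
  have hσa : ∀ g a c, σ g a c = ((w a)ᴴ * (π g * w c * π g⁻¹)).trace := fun g a c => rfl
  have hσ : Uni σ := by
    intro g
    ext a c
    rw [Matrix.conjTranspose_apply, hσa, hσa, ← Matrix.trace_conjTranspose]
    simp only [Matrix.conjTranspose_mul, Matrix.conjTranspose_conjTranspose, inv_inv]
    rw [Matrix.mul_assoc, Matrix.mul_assoc, Matrix.trace_mul_comm]
    simp only [Matrix.mul_assoc]
    rw [hπ g, hπ g⁻¹, inv_inv]
  have hwσ : ∀ g b, π g * w b * π g⁻¹ = ∑ a, σ g a b • w a := fun g b => hexp _ (hW g _ (hwW b))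
  have := key_ineq p U hp hpsum hπ hσ hsch hw hwσ μ (k := k) ?_ hf hl
  · simpa using this
  · intro a c
    have h1 : (fun g => σ g a c) = ∑ i, ∑ j, ((w a)ᴴ i j) • (fun g => (π g * w c * π g⁻¹) j i) := by
      funext g
      simp only [hσa, Finset.sum_apply, Pi.smul_apply, smul_eq_mul, Matrix.trace, Matrix.diag]
      refine Finset.sum_congr rfl fun i _ => ?_
      rw [Matrix.mul_apply]
    rw [h1]
    exact Submodule.sum_mem _ fun i _ => Submodule.sum_mem _ fun j _ => Submodule.smul_mem _ _ (hWP _ (hwW c) j i)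

end Sub
end SG

set_option linter.unusedSectionVars false
namespace SG
open MeasureTheory
open scoped Matrix

section Diag
variable {q : ℕ}

/-- the diagonal torus -/
noncomputable def Dg (q : ℕ) : (Fin q → Circle) →* G q where
  toFun z := ⟨Matrix.diagonal fun i => (z i : ℂ), by
    rw [Matrix.mem_unitaryGroup_iff, Matrix.star_eq_conjTranspose, Matrix.diagonal_conjTranspose, Matrix.diagonal_mul_diagonal,
      ← Matrix.diagonal_one]
    congr 1; funext i
    simp [Complex.mul_conj, Complex.normSq_eq_norm_sq, Circle.norm_coe]⟩
  map_one' := by ext i j; simp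
  map_mul' x y := by
    apply Subtype.ext
    simp [Matrix.diagonal_mul_diagonal]

lemma Dg_coe (z : Fin q → Circle) : (Dg q z : Matrix (Fin q) (Fin q) ℂ) = Matrix.diagonal fun i => (z i : ℂ) := rfl

lemma inv_coe (g : G q) : ((g⁻¹ : G q) : Matrix (Fin q) (Fin q) ℂ) = (g : Matrix (Fin q) (Fin q) ℂ)ᴴ := rfl

lemma herm_diag {H : Matrix (Fin q) (Fin q) ℂ} (hH : Hᴴ = H) : ∃ (V : G q) (d : Fin q → ℝ),
    H = (V : Matrix (Fin q) (Fin q) ℂ) * Matrix.diagonal (fun i => (d i : ℂ)) * ((V⁻¹ : G q) : Matrix (Fin q) (Fin q) ℂ) := by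
  have hH' : H.IsHermitian := hH
  refine ⟨hH'.eigenvectorUnitary, hH'.eigenvalues, ?_⟩
  have hsp := hH'.spectral_theorem
  conv_lhs => rw [hsp]
  rw [Unitary.conjStarAlgAut_apply]; rfl

open scoped Matrix.Norms.L2Operator in
lemma exists_log (g : G q) : ∃ H : Matrix (Fin q) (Fin q) ℂ, Hᴴ = H ∧ (g : Matrix (Fin q) (Fin q) ℂ) = NormedSpace.exp (Complex.I • H) := by
  have hfin : (spectrum ℂ (g : Matrix (Fin q) (Fin q) ℂ)).Finite := Matrix.finite_spectrum _
  have : ContinuousOn Complex.arg (spectrum ℂ (g : Matrix (Fin q) (Fin q) ℂ)) := hfin.continuousOn _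
  have hn : IsStarNormal (g : Matrix (Fin q) (Fin q) ℂ) := by
    constructor
    rw [Commute, SemiconjBy, Unitary.star_mul_self_of_mem g.2, Unitary.mul_star_self_of_mem g.2]
  refine ⟨cfc (Complex.ofReal ∘ Complex.arg : ℂ → ℂ) (g : Matrix (Fin q) (Fin q) ℂ), IsSelfAdjoint.cfc_arg _, ?_⟩
  have h2 : ContinuousOn (Complex.ofReal ∘ Complex.arg : ℂ → ℂ) (spectrum ℂ (g : Matrix (Fin q) (Fin q) ℂ)) := hfin.continuousOn _
  rw [← CFC.exp_eq_normedSpace_exp (𝕜 := ℂ),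
    ← cfc_comp_smul .., ← cfc_comp' ..]
  conv_lhs => rw [← cfc_id' ℂ (g : Matrix (Fin q) (Fin q) ℂ)]
  refine cfc_congr fun y hy ↦ ?_
  have hy₁ : ‖y‖ = 1 := spectrum.norm_eq_one_of_unitary g.2 hy
  have : Complex.I * y.arg = Complex.log y :=
    Complex.ext (by simp [Complex.log_re, hy₁]) (by simp [Complex.log_im])
  have h0 : y ≠ 0 := by rintro rfl; simp at hy₁
  simp [← Complex.exp_eq_exp_ℂ, this, Complex.exp_log h0]

open scoped Matrix.Norms.L2Operator in
lemma unitary_diag (g : G q) : ∃ (V : G q) (z : Fin q → Circle), g = V * Dg q z * V⁻¹ := by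
  obtain ⟨H, hH, hg⟩ := exists_log g
  obtain ⟨V, d, hV⟩ := herm_diag hH
  refine ⟨V, fun i => Circle.exp (d i), ?_⟩
  apply Subtype.ext
  rw [hg]
  let u : (Matrix (Fin q) (Fin q) ℂ)ˣ := ⟨V, ((V⁻¹ : G q) : Matrix (Fin q) (Fin q) ℂ), Unitary.coe_mul_star_self V, Unitary.coe_star_mul_self V⟩
  have e1 : Complex.I • H = (u : Matrix (Fin q) (Fin q) ℂ) * Matrix.diagonal (fun i => Complex.I * (d i : ℂ)) * ((u⁻¹ : (Matrix (Fin q) (Fin q) ℂ)ˣ) : Matrix (Fin q) (Fin q) ℂ) := by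
    rw [hV, ← Matrix.smul_mul, ← Matrix.mul_smul, ← Matrix.diagonal_smul]; rfl
  rw [e1, Matrix.exp_units_conj, Matrix.exp_diagonal]
  have e2 : NormedSpace.exp (fun i => Complex.I * (d i : ℂ)) = fun i => ((Circle.exp (d i) : Circle) : ℂ) := by
    funext i
    rw [Pi.coe_exp, Circle.coe_exp, ← Complex.exp_eq_exp_ℂ, mul_comm]
  rw [e2]; rfl

end Diag
end SG

set_option linter.unusedSectionVars false
namespace SG
open MeasureTheory
open scoped Matrix

section Tens
variable {S d : Type*} [Fintype S] [DecidableEq S] [Fintype d] [DecidableEq d]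

/-- tensor product of a family of matrices -/
noncomputable def TT : (S → Matrix d d ℂ) →* Matrix (S → d) (S → d) ℂ where
  toFun A := Matrix.of fun i j => ∏ s, A s (i s) (j s)
  map_one' := by
    ext i j
    simp only [Matrix.of_apply, Pi.one_apply, Matrix.one_apply, Finset.prod_ite_zero, Finset.prod_const_one]
    simp [funext_iff]
  map_mul' A B := by
    ext i j
    simp only [Matrix.of_apply, Pi.mul_apply, Matrix.mul_apply, Finset.prod_univ_sum, Fintype.piFinset_univ, Finset.prod_mul_distrib]

lemma TT_apply (A : S → Matrix d d ℂ) (i j : S → d) : TT A i j = ∏ s, A s (i s) (j s) := rfl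

lemma TT_single (s : S) (X : Matrix d d ℂ) (i j : S → d) : TT (Pi.mulSingle s X) i j =
    X (i s) (j s) * ∏ r ∈ Finset.univ.erase s, (1 : Matrix d d ℂ) (i r) (j r) := by
  rw [TT_apply, ← Finset.mul_prod_erase _ _ (Finset.mem_univ s), Pi.mulSingle_eq_same]
  congr 1
  refine Finset.prod_congr rfl fun r hr => ?_
  rw [Pi.mulSingle_eq_of_ne (Finset.ne_of_mem_erase hr)]

/-- action in one slot -/
noncomputable def slot (s : S) : Matrix d d ℂ →ₗ[ℂ] Matrix (S → d) (S → d) ℂ where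
  toFun X := TT (Pi.mulSingle s X)
  map_add' X Y := by ext i j; simp only [TT_single, Matrix.add_apply]; ring
  map_smul' c X := by ext i j; simp only [TT_single, Matrix.smul_apply, smul_eq_mul, RingHom.id_apply]; ring

lemma slot_apply (s : S) (X : Matrix d d ℂ) : slot s X = TT (Pi.mulSingle s X) := rfl

lemma slot_mul (s : S) (X Y : Matrix d d ℂ) : slot s X * slot s Y = slot s (X * Y) := by
  rw [slot_apply, slot_apply, slot_apply, ← map_mul, Pi.mulSingle_mul]

lemma slot_comm {s r : S} (h : s ≠ r) (X Y : Matrix d d ℂ) : slot s X * slot r Y = slot r Y * slot s X := by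
  rw [slot_apply, slot_apply, ← map_mul, ← map_mul]
  exact congrArg TT (Pi.mulSingle_commute (f := fun _ : S => Matrix d d ℂ) h X Y).eq

lemma slot_conj (s : S) (A B : S → Matrix d d ℂ) (hAB : A * B = 1) (X : Matrix d d ℂ) :
    TT A * slot s X * TT B = slot s (A s * X * B s) := by
  rw [slot_apply, slot_apply, ← map_mul, ← map_mul]
  congr 1
  funext r
  by_cases h : r = s
  · subst h; simp
  · simp only [Pi.mul_apply, Pi.mulSingle_eq_of_ne h, mul_one]
    exact congrFun hAB r

lemma slot_diag (s : S) (a : d → ℂ) : slot s (Matrix.diagonal a) = Matrix.diagonal fun i : S → d => a (i s) := by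
  ext i j
  rw [slot_apply, TT_single]
  by_cases h : i = j
  · subst h; simp
  · rw [Matrix.diagonal_apply_ne _ h]
    by_contra hne
    apply h
    funext r
    by_contra hr
    apply hne
    by_cases hrs : r = s
    · subst hrs; rw [Matrix.diagonal_apply_ne _ hr, zero_mul]
    · have hz : ∏ r ∈ Finset.univ.erase s, (1 : Matrix d d ℂ) (i r) (j r) = 0 :=
        Finset.prod_eq_zero (i := r) (Finset.mem_erase.mpr ⟨hrs, Finset.mem_univ r⟩) (by exact Matrix.one_apply_ne hr)
      rw [hz, mul_zero]

lemma TT_diag (a : S → d → ℂ) : TT (fun s => Matrix.diagonal (a s)) = Matrix.diagonal fun i : S → d => ∏ s, a s (i s) := by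
  ext i j
  rw [TT_apply]
  by_cases h : i = j
  · subst h; simp
  · rw [Matrix.diagonal_apply_ne _ h]
    obtain ⟨r, hr⟩ := Function.ne_iff.mp h
    exact Finset.prod_eq_zero (Finset.mem_univ r) (Matrix.diagonal_apply_ne _ hr)

end Tens

section Dtau
variable (q t : ℕ)

abbrev SI (t : ℕ) := Fin t ⊕ Fin t
abbrev Ix (q t : ℕ) := SI t → Fin q

noncomputable def fam : G q →* (SI t → Matrix (Fin q) (Fin q) ℂ) where
  toFun g := fun s => s.elim (fun _ => (g : Matrix (Fin q) (Fin q) ℂ)) (fun _ => ((g : Matrix (Fin q) (Fin q) ℂ)ᴴ)ᵀ)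
  map_one' := by funext s; cases s <;> simp
  map_mul' g h := by funext s; cases s <;> simp [Matrix.conjTranspose_mul, Matrix.transpose_mul]

noncomputable def tauS : G q →* Matrix (Ix q t) (Ix q t) ℂ := TT.comp (fam q t)

lemma tauS_apply (g : G q) : tauS q t g = TT (fam q t g) := rfl

lemma tauS_eq (g : G q) : tauS q t g = (tau q t g).submatrix (Equiv.sumArrowEquivProdArrow _ _ _) (Equiv.sumArrowEquivProdArrow _ _ _) := by
  ext i j
  rw [tauS_apply, TT_apply, Fintype.prod_sum_type]
  rfl

lemma tauS_uni : Uni (tauS q t) := by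
  intro g
  rw [tauS_eq, tauS_eq, Matrix.conjTranspose_submatrix, tau_star]

/-- the derivative on slots -/
noncomputable def del (s : SI t) : Matrix (Fin q) (Fin q) ℂ →ₗ[ℂ] Matrix (Fin q) (Fin q) ℂ :=
  s.elim (fun _ => LinearMap.id) (fun _ => - (Matrix.transposeLinearEquiv (Fin q) (Fin q) ℂ ℂ).toLinearMap)

@[simp] lemma del_inl (s : Fin t) (X : Matrix (Fin q) (Fin q) ℂ) : del q t (Sum.inl s) X = X := rfl
@[simp] lemma del_inr (s : Fin t) (X : Matrix (Fin q) (Fin q) ℂ) : del q t (Sum.inr s) X = -Xᵀ := rfl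

/-- derived action -/
noncomputable def dtau : Matrix (Fin q) (Fin q) ℂ →ₗ[ℂ] Matrix (Ix q t) (Ix q t) ℂ := ∑ s, (slot s).comp (del q t s)

lemma dtau_apply (X : Matrix (Fin q) (Fin q) ℂ) : dtau q t X = ∑ s, slot s (del q t s X) := by
  simp [dtau]

lemma dtau_conj (g : G q) (X : Matrix (Fin q) (Fin q) ℂ) :
    tauS q t g * dtau q t X * tauS q t g⁻¹ = dtau q t ((g : Matrix (Fin q) (Fin q) ℂ) * X * ((g⁻¹ : G q) : Matrix (Fin q) (Fin q) ℂ)) := by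
  rw [dtau_apply, dtau_apply, Finset.mul_sum, Finset.sum_mul]
  refine Finset.sum_congr rfl fun s _ => ?_
  rw [tauS_apply, tauS_apply, slot_conj _ _ _ (by rw [← map_mul]; simp)]
  congr 1
  rcases s with s | s
  · rfl
  · simp [fam, Matrix.transpose_mul, Matrix.mul_assoc, inv_coe]
    simp only [Matrix.star_eq_conjTranspose, Matrix.conjTranspose_conjTranspose]

lemma dtau_comm (X Y : Matrix (Fin q) (Fin q) ℂ) :
    dtau q t X * dtau q t Y - dtau q t Y * dtau q t X = dtau q t (X * Y - Y * X) := by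
  simp only [dtau_apply]
  rw [Finset.sum_mul_sum, Finset.sum_mul_sum]
  rw [Finset.sum_comm (f := fun i j => slot i (del q t i Y) * slot j (del q t j X)), ← Finset.sum_sub_distrib]
  refine Finset.sum_congr rfl fun s _ => ?_
  rw [← Finset.sum_sub_distrib, Finset.sum_eq_single s]
  · rw [slot_mul, slot_mul, ← map_sub]
    congr 1
    rcases s with s | s
    · rfl
    · simp [Matrix.transpose_mul]
  · intro r _ hr
    rw [slot_comm hr.symm, sub_self]
  · simp

/-- weight of a basis vector -/
def wt (j : Fin q) (i : Ix q t) : ℤ := (∑ s : Fin t, if i (Sum.inl s) = j then 1 else 0) - ∑ s : Fin t, if i (Sum.inr s) = j then 1 else 0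

lemma wt_mem (j : Fin q) (i : Ix q t) : wt q t j i ∈ Finset.Icc (-(t:ℤ)) t := by
  have h : ∀ f : Fin t → Fin q, (0:ℤ) ≤ (∑ s : Fin t, if f s = j then 1 else 0) ∧ (∑ s : Fin t, if f s = j then (1:ℤ) else 0) ≤ t := by
    intro f
    constructor
    · exact Finset.sum_nonneg fun s _ => by split_ifs <;> simp
    · calc _ ≤ ∑ s : Fin t, (1:ℤ) := Finset.sum_le_sum fun s _ => by split_ifs <;> simp
        _ = t := by simp
  have h1 := h fun s => i (Sum.inl s)
  have h2 := h fun s => i (Sum.inr s)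
  rw [Finset.mem_Icc, wt]
  constructor <;> linarith [h1.1, h1.2, h2.1, h2.2]

lemma dtau_diag (a : Fin q → ℂ) : dtau q t (Matrix.diagonal a) =
    Matrix.diagonal fun i => (∑ s : Fin t, a (i (Sum.inl s))) - ∑ s : Fin t, a (i (Sum.inr s)) := by
  rw [dtau_apply, Fintype.sum_sum_type]
  simp only [del_inl, del_inr, Matrix.diagonal_transpose, map_neg, slot_diag]
  ext i j
  simp only [Matrix.add_apply, Matrix.sum_apply, Matrix.neg_apply, Matrix.diagonal_apply]
  split_ifs <;> simp [sub_eq_add_neg]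

lemma dtau_one : dtau q t 1 = 0 := by
  rw [← Matrix.diagonal_one, dtau_diag]; simp

lemma dtau_E (j : Fin q) : dtau q t (Matrix.single j j 1) = Matrix.diagonal fun i => (wt q t j i : ℂ) := by
  rw [← Matrix.diagonal_single, dtau_diag]
  congr 1; funext i
  simp [wt, Pi.single_apply]

lemma tauS_Dg (j : Fin q) (z : Circle) : tauS q t (Dg q (Pi.mulSingle j z)) = Matrix.diagonal fun i => (z : ℂ) ^ (wt q t j i) := by
  rw [tauS_apply]
  have : fam q t (Dg q (Pi.mulSingle j z)) = fun s => Matrix.diagonal (s.elim (fun _ k => if k = j then (z : ℂ) else 1) (fun _ k => if k = j then (z:ℂ)⁻¹ else 1)) := by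
    funext s
    rcases s with s | s
    · simp only [fam, MonoidHom.coe_mk, OneHom.coe_mk, Sum.elim_inl, Dg_coe]
      congr 1; funext k
      by_cases h : k = j
      · subst h; simp
      · simp [h]
    · simp only [fam, MonoidHom.coe_mk, OneHom.coe_mk, Sum.elim_inr, Dg_coe, Matrix.diagonal_conjTranspose, Matrix.diagonal_transpose]
      congr 1; funext k
      by_cases h : k = j
      · subst h; simp [← Circle.coe_inv_eq_conj]
      · simp [h]
  rw [this, TT_diag]
  congr 1; funext i
  rw [Fintype.prod_sum_type, wt, zpow_sub₀ (Circle.coe_ne_zero z)]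
  simp only [Sum.elim_inl, Sum.elim_inr]
  have e : ∀ (w : ℂ) (hw : w ≠ 0) (f : Fin t → Fin q), (∏ s : Fin t, if f s = j then w else 1) = w ^ (∑ s : Fin t, if f s = j then (1:ℤ) else 0) := by
    intro w hw f
    rw [Finset.prod_ite, Finset.sum_ite]; simp
  rw [e _ (Circle.coe_ne_zero z) (fun s => i (Sum.inl s)), e _ (inv_ne_zero (Circle.coe_ne_zero z)) (fun s => i (Sum.inr s)), inv_zpow, div_eq_mul_inv]

end Dtau
end SG

set_option linter.unusedSectionVars false
namespace SG
open MeasureTheory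
open scoped Matrix

lemma interp (t : ℕ) (v r : ℤ → ℂ) (hv : Set.InjOn v (Finset.Icc (-(t:ℤ)) t)) :
    ∃ Q : Polynomial ℂ, Q.natDegree ≤ 2 * t ∧ ∀ N ∈ Finset.Icc (-(t:ℤ)) t, Q.eval (v N) = r N := by
  refine ⟨Lagrange.interpolate (Finset.Icc (-(t:ℤ)) t) v r, ?_, fun N hN => Lagrange.eval_interpolate_at_node r hv hN⟩
  have h := Lagrange.degree_interpolate_lt r hv
  have hc : (Finset.Icc (-(t:ℤ)) t).card = 2 * t + 1 := by
    rw [Int.card_Icc]; omega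
  rw [hc] at h
  rw [Polynomial.natDegree_le_iff_coeff_eq_zero]
  intro N hN
  exact Polynomial.coeff_eq_zero_of_degree_lt (h.trans_le (by exact_mod_cast hN))

lemma aeval_diag {n : Type*} [Fintype n] [DecidableEq n] (a : n → ℂ) (Q : Polynomial ℂ) :
    Polynomial.aeval (Matrix.diagonal a) Q = Matrix.diagonal fun i => Q.eval (a i) := by
  have := Polynomial.aeval_algHom_apply (Matrix.diagonalAlgHom ℂ (n := n) (α := ℂ)) a Q
  rw [Polynomial.aeval_pi_apply] at this
  simpa using this

lemma aeval_Wsp {ι R : Type*} [Ring R] [Algebra ℂ R] (X : ι → R) {A : R} (hA : A ∈ Wsp X 1) {Q : Polynomial ℂ} {k : ℕ}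
    (hQ : Q.natDegree ≤ k) : Polynomial.aeval A Q ∈ Wsp X k := by
  rw [Polynomial.aeval_eq_sum_range]
  refine Submodule.sum_mem _ fun i hi => Submodule.smul_mem _ _ ?_
  have hp : ∀ i, A ^ i ∈ Wsp X i := by
    intro i
    induction i with
    | zero => simpa using one_mem_Wsp X 0
    | succ i ih => rw [pow_succ]; exact Wsp_mul X ih hA
  refine Wsp_mono X ?_ (hp i)
  have := Finset.mem_range.mp hi
  omega

variable (q t : ℕ)

/-- algebra generated by the representation -/
noncomputable def Alg : Subalgebra ℂ (Matrix (Ix q t) (Ix q t) ℂ) := Algebra.adjoin ℂ (Set.range (tauS q t))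

lemma tauS_mem (g : G q) : tauS q t g ∈ Alg q t := Algebra.subset_adjoin ⟨g, rfl⟩

lemma dtau_E_mem (j : Fin q) : dtau q t (Matrix.single j j 1) ∈ Alg q t := by
  let ω : Circle := Circle.exp (2 * Real.pi / ((2 * t + 1 : ℕ) : ℝ))
  have hω : IsPrimitiveRoot (ω : ℂ) (2 * t + 1) := by
    have h := Complex.isPrimitiveRoot_exp (2 * t + 1) (by omega)
    convert h using 1
    simp only [ω, Circle.coe_exp]
    congr 1
    push_cast; ring
  have hv : Set.InjOn (fun N : ℤ => (ω : ℂ) ^ N) (Finset.Icc (-(t:ℤ)) t) := by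
    intro a ha b hb hab
    simp only [Finset.coe_Icc, Set.mem_Icc] at ha hb hab
    have h1 : (ω : ℂ) ^ (a - b) = 1 := by
      rw [zpow_sub₀ (Circle.coe_ne_zero ω), hab, div_self (zpow_ne_zero _ (Circle.coe_ne_zero ω))]
    have h2 := (hω.zpow_eq_one_iff_dvd _).mp h1
    have h3 := Int.eq_zero_of_abs_lt_dvd h2 (by rw [abs_lt]; push_cast; constructor <;> omega)
    omega
  obtain ⟨Q, -, hQ⟩ := interp t _ (fun N => (N : ℂ)) hv
  have : dtau q t (Matrix.single j j 1) = Polynomial.aeval (tauS q t (Dg q (Pi.mulSingle j ω))) Q := by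
    rw [dtau_E, tauS_Dg, aeval_diag]
    congr 1; funext i
    exact (hQ _ (wt_mem q t j i)).symm
  rw [this]
  exact Polynomial.aeval_mem_adjoin_singleton ℂ _ |> fun h => (Algebra.adjoin_le (S := Alg q t) (by
    rw [Set.singleton_subset_iff]; exact tauS_mem q t _)) h

lemma dtau_mem (X : Matrix (Fin q) (Fin q) ℂ) : dtau q t X ∈ Alg q t := by
  have hherm : ∀ H : Matrix (Fin q) (Fin q) ℂ, Hᴴ = H → dtau q t H ∈ Alg q t := by
    intro H hH
    obtain ⟨V, d, hV⟩ := herm_diag hH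
    rw [hV, ← dtau_conj]
    refine mul_mem (mul_mem (tauS_mem q t _) ?_) (tauS_mem q t _)
    have : Matrix.diagonal (fun i => (d i : ℂ)) = ∑ i, (d i : ℂ) • Matrix.single i i (1:ℂ) := by
      rw [← Matrix.sum_single_eq_diagonal]
      refine Finset.sum_congr rfl fun i _ => ?_
      simp
    rw [this, map_sum]
    refine sum_mem fun i _ => ?_
    rw [map_smul]
    exact Subalgebra.smul_mem _ (dtau_E_mem q t i) _
  have h1 := hherm (X + Xᴴ) (by simp [add_comm])
  have h2 := hherm (Complex.I • (X - Xᴴ)) (by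
    simp [Matrix.conjTranspose_smul, smul_sub]; abel)
  have : X = (1/2 : ℂ) • (X + Xᴴ) + (-(Complex.I)/2) • (Complex.I • (X - Xᴴ)) := by
    rw [smul_smul]
    have : -Complex.I / 2 * Complex.I = 1/2 := by
      rw [div_mul_eq_mul_div, neg_mul, Complex.I_mul_I]; norm_num
    rw [this, ← smul_add]
    ext i j
    simp; ring
  rw [this, map_add, map_smul, map_smul]
  exact add_mem (Subalgebra.smul_mem _ h1 _) (Subalgebra.smul_mem _ h2 _)

/-- generators -/
noncomputable def gen (n : Fin (q * q)) : Matrix (Fin q) (Fin q) ℂ :=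
  Matrix.single (finProdFinEquiv.symm n).1 (finProdFinEquiv.symm n).2 1

lemma gen_span (X : Matrix (Fin q) (Fin q) ℂ) : X = ∑ n, X (finProdFinEquiv.symm n).1 (finProdFinEquiv.symm n).2 • gen q n := by
  rw [← finProdFinEquiv.sum_comp, Fintype.sum_prod_type]
  conv_lhs => rw [Matrix.matrix_eq_sum_single X]
  refine Finset.sum_congr rfl fun i _ => Finset.sum_congr rfl fun j _ => ?_
  simp [gen]

lemma exp_poly (j : Fin q) (z : Circle) : ∃ Q : Polynomial ℂ, Q.natDegree ≤ 2 * t ∧ Q.eval 0 = 1 ∧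
    tauS q t (Dg q (Pi.mulSingle j z)) = Polynomial.aeval (dtau q t (Matrix.single j j 1)) Q := by
  obtain ⟨Q, hd, hQ⟩ := interp t (fun N => (N : ℂ)) (fun N => (z : ℂ) ^ N) (fun a _ b _ h => by simpa using h)
  refine ⟨Q, hd, by simpa using hQ 0 (by simp), ?_⟩
  rw [dtau_E, tauS_Dg, aeval_diag]
  congr 1; funext i
  exact (hQ _ (wt_mem q t j i)).symm

lemma Dg_induct {Pr : ℕ → G q → Prop} (h0 : Pr 0 1) (hs : ∀ k g j z, Pr k g → Pr (k + 1) (Dg q (Pi.mulSingle j z) * g))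
    (z : Fin q → Circle) : Pr q (Dg q z) := by
  classical
  have : ∀ s : Finset (Fin q), Pr s.card (Dg q (s.piecewise z 1)) := by
    intro s
    induction s using Finset.induction_on with
    | empty => simpa using h0
    | insert j s hj ih =>
      rw [Finset.card_insert_of_notMem hj]
      have : (insert j s).piecewise z 1 = Pi.mulSingle j (z j) * s.piecewise z 1 := by
        funext r
        by_cases hr : r = j
        · subst hr; simp [hj]
        · simp [Finset.piecewise, hr]
      rw [this, map_mul]
      exact hs _ _ _ _ ih
  simpa using this Finset.univ

end SG

set_option linter.unusedSectionVars false
namespace SG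
open MeasureTheory
open scoped Matrix

section Burn
variable {n : Type*} [Fintype n] [DecidableEq n] {q : ℕ}

/-- Burnside-type theorem for unitary representations with scalar commutant. -/
theorem burnside {π : G q →* Matrix n n ℂ} (hπ : Uni π)
    (hsch : ∀ A : Matrix n n ℂ, (∀ g, π g * A = A * π g) → ∃ c : ℂ, A = c • 1) :
    Submodule.span ℂ (Set.range π) = ⊤ := by
  set W := Submodule.span ℂ (Set.range π) with hW
  obtain ⟨w, hwW, hw, hexp⟩ := exists_onb W
  have hinv : ∀ g, ∀ X ∈ W, π g * X ∈ W := by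
    intro g X hX
    induction hX using Submodule.span_induction with
    | zero => simp
    | add x y _ _ hx hy => rw [mul_add]; exact add_mem hx hy
    | smul c x _ hx => rw [mul_smul_comm]; exact Submodule.smul_mem _ _ hx
    | mem x hx =>
      obtain ⟨h, rfl⟩ := hx
      rw [← map_mul]; exact Submodule.subset_span ⟨_, rfl⟩
  let T : Matrix n n ℂ →ₗ[ℂ] Matrix n n ℂ :=
    { toFun := fun Z => ∑ a, ((w a)ᴴ * Z).trace • w a
      map_add' := fun X Y => by simp only [mul_add, Matrix.trace_add, add_smul, Finset.sum_add_distrib]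
      map_smul' := fun c X => by
        simp only [mul_smul_comm, Matrix.trace_smul, smul_assoc, RingHom.id_apply, Finset.smul_sum] }
  have hT : ∀ Z, T Z = ∑ a, ((w a)ᴴ * Z).trace • w a := fun Z => rfl
  have hTW : ∀ Z, T Z ∈ W := fun Z => by
    rw [hT]; exact Submodule.sum_mem _ fun a _ => Submodule.smul_mem _ _ (hwW a)
  have hTid : ∀ Z ∈ W, T Z = Z := fun Z hZ => (hexp Z hZ).symm
  have horth : ∀ Z, (∀ a, ((w a)ᴴ * (Z - T Z)).trace = 0) := by
    intro Z a
    rw [mul_sub, Matrix.trace_sub, hT, Finset.mul_sum, Matrix.trace_sum]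
    simp [mul_smul_comm, Matrix.trace_smul, hw]
  have horthW : ∀ Z, ∀ X ∈ W, (Xᴴ * (Z - T Z)).trace = 0 := by
    intro Z X hX
    rw [hexp X hX, Matrix.conjTranspose_sum, Finset.sum_mul, Matrix.trace_sum]
    refine Finset.sum_eq_zero fun a _ => ?_
    rw [Matrix.conjTranspose_smul, smul_mul_assoc, Matrix.trace_smul, horth, smul_zero]
  have hcomm : ∀ g Z, T (π g * Z) = π g * T Z := by
    intro g Z
    have h1 : π g * Z = π g * T Z + π g * (Z - T Z) := by rw [← mul_add]; congr 1; abel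
    have h2 : T (π g * (Z - T Z)) = 0 := by
      rw [hT]
      refine Finset.sum_eq_zero fun a _ => ?_
      have h3 : (w a)ᴴ * (π g * (Z - T Z)) = (π g⁻¹ * w a)ᴴ * (Z - T Z) := by
        rw [Matrix.conjTranspose_mul, hπ, inv_inv, mul_assoc]
      rw [h3, horthW Z _ (hinv _ _ (hwW a)), zero_smul]
    rw [h1, map_add, h2, add_zero]
    exact hTid _ (hinv g _ (hTW Z))
  have hc : ∀ k l, ∃ c : ℂ, ∀ i r, T (Matrix.single i k 1) r l = if r = i then c else 0 := by
    intro k l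
    obtain ⟨c, hc⟩ := hsch (Matrix.of fun r i => T (Matrix.single i k 1) r l) (by
      intro g
      ext r j
      have h := congrFun (congrFun (hcomm g (Matrix.single j k 1)) r) l
      have h4 : π g * Matrix.single j k (1:ℂ) = ∑ i, π g i j • Matrix.single i k (1:ℂ) := by
        ext a b
        simp only [Matrix.mul_single_eq_updateCol_zero, Matrix.sum_apply, Matrix.smul_apply, Matrix.single_apply, smul_eq_mul,
          Matrix.updateCol_apply, Matrix.col_apply]
        by_cases hb : k = b
        · subst hb; simp
        · simp [hb, Ne.symm hb]
      rw [h4, map_sum, Matrix.sum_apply] at h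
      rw [Matrix.mul_apply, Matrix.mul_apply]
      simp only [Matrix.of_apply]
      rw [Matrix.mul_apply] at h
      rw [← h]
      refine Finset.sum_congr rfl fun i _ => ?_
      rw [map_smul, Matrix.smul_apply, smul_eq_mul, mul_comm])
    refine ⟨c, fun i r => ?_⟩
    have := congrFun (congrFun hc r) i
    simpa [Matrix.one_apply] using this
  choose c hc using hc
  have hTC : ∀ Z, T Z = Z * Matrix.of c := by
    intro Z
    conv_lhs => rw [Matrix.matrix_eq_sum_single Z]
    ext r l
    have h5 : ∀ i k, Matrix.single i k (Z i k) = Z i k • Matrix.single i k (1:ℂ) := fun i k => by simp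
    simp only [h5, map_sum, map_smul, Matrix.sum_apply, Matrix.smul_apply, hc, Matrix.mul_apply, Matrix.of_apply]
    rw [Finset.sum_eq_single r]
    · simp
    · intro b _ hb; simp [Ne.symm hb]
    · simp
  have h1 : T 1 = 1 := hTid 1 (Submodule.subset_span ⟨1, map_one π⟩)
  rw [hTC, one_mul] at h1
  rw [eq_top_iff]
  intro Z _
  have := hTW Z
  rwa [hTC, h1, mul_one] at this

lemma exists_onv (Z : Submodule ℂ (n → ℂ)) : ∃ B : Matrix n (Fin (Module.finrank ℂ Z)) ℂ,
    Bᴴ * B = 1 ∧ (∀ x, B *ᵥ x ∈ Z) ∧ ∀ x ∈ Z, B *ᵥ (Bᴴ *ᵥ x) = x := by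
  let e : (n → ℂ) ≃ₗ[ℂ] EuclideanSpace ℂ n := (WithLp.linearEquiv 2 ℂ (n → ℂ)).symm
  have hin : ∀ X Y, inner ℂ (e X) (e Y) = star X ⬝ᵥ Y := by
    intro X Y
    rw [EuclideanSpace.inner_eq_star_dotProduct, dotProduct_comm]; rfl
  let W' := Z.map e.toLinearMap
  have hfr : Module.finrank ℂ W' = Module.finrank ℂ Z := LinearEquiv.finrank_map_eq e Z
  let b := (stdOrthonormalBasis ℂ W').reindex (finCongr hfr)
  have hbW : ∀ a, e.symm (b a : EuclideanSpace ℂ n) ∈ Z := by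
    intro a
    obtain ⟨X, hX, hXe⟩ := (b a).2
    have : e.symm (b a : EuclideanSpace ℂ n) = X := by rw [← hXe]; exact e.symm_apply_apply X
    rw [this]; exact hX
  let B : Matrix n (Fin (Module.finrank ℂ Z)) ℂ := Matrix.of fun i a => e.symm (b a : EuclideanSpace ℂ n) i
  have hB : ∀ x, B *ᵥ x = ∑ a, x a • e.symm (b a : EuclideanSpace ℂ n) := by
    intro x; ext i
    simp [B, Matrix.mulVec, dotProduct, mul_comm]
  refine ⟨B, ?_, ?_, ?_⟩
  · ext a c
    have : (Bᴴ * B) a c = star (e.symm (b a : EuclideanSpace ℂ n)) ⬝ᵥ (e.symm (b c : EuclideanSpace ℂ n)) := rfl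
    rw [this, ← hin, e.apply_symm_apply, e.apply_symm_apply, ← Submodule.coe_inner, Matrix.one_apply]
    exact orthonormal_iff_ite.mp b.orthonormal a c
  · intro x
    rw [hB]
    exact Submodule.sum_mem _ fun a _ => Submodule.smul_mem _ _ (hbW a)
  · intro X hX
    have hXW : e X ∈ W' := ⟨X, hX, rfl⟩
    have h := b.sum_repr' ⟨e X, hXW⟩
    have h2 := congrArg (fun z : W' => e.symm (z : EuclideanSpace ℂ n)) h
    simp only [Submodule.coe_sum, Submodule.coe_smul, map_sum, map_smul, e.symm_apply_apply] at h2
    rw [hB]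
    refine Eq.trans ?_ h2
    refine Finset.sum_congr rfl fun a _ => ?_
    have : (Bᴴ *ᵥ X) a = star (e.symm (b a : EuclideanSpace ℂ n)) ⬝ᵥ X := rfl
    rw [this, ← hin, e.apply_symm_apply, Submodule.coe_inner]

end Burn

section Rep
variable (q t : ℕ)

structure IsRep {n : Type} [Fintype n] [DecidableEq n] (π : G q →* Matrix n n ℂ)
    (dπ : Matrix (Fin q) (Fin q) ℂ →ₗ[ℂ] Matrix n n ℂ) : Prop where
  uni : Uni π
  conj : ∀ g X, π g * dπ X * π g⁻¹ = dπ ((g : Matrix (Fin q) (Fin q) ℂ) * X * ((g⁻¹ : G q) : Matrix (Fin q) (Fin q) ℂ))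
  comm : ∀ X Y, dπ X * dπ Y - dπ Y * dπ X = dπ (X * Y - Y * X)
  one : dπ 1 = 0
  expo : ∀ j z, ∃ Q : Polynomial ℂ, Q.natDegree ≤ 2 * t ∧ Q.eval 0 = 1 ∧
    π (Dg q (Pi.mulSingle j z)) = Polynomial.aeval (dπ (Matrix.single j j 1)) Q
  mem : ∀ X, dπ X ∈ Algebra.adjoin ℂ (Set.range π)

lemma isRep_tauS : IsRep q t (tauS q t) (dtau q t) where
  uni := tauS_uni q t
  conj := dtau_conj q t
  comm := dtau_comm q t
  one := dtau_one q t
  expo := exp_poly q t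
  mem := dtau_mem q t

variable {q t}
variable {n n' : Type} [Fintype n] [DecidableEq n] [Fintype n'] [DecidableEq n'] {π : G q →* Matrix n n ℂ}
    {dπ : Matrix (Fin q) (Fin q) ℂ →ₗ[ℂ] Matrix n n ℂ}

theorem IsRep.compress (h : IsRep q t π dπ) (B : Matrix n n' ℂ) (hB : Bᴴ * B = 1)
    (hinv : ∀ g, B * (Bᴴ * (π g * B)) = π g * B) : ∃ (π' : G q →* Matrix n' n' ℂ) (dπ' : _),
      IsRep q t π' dπ' ∧ ∀ g, π' g = Bᴴ * (π g * B) := by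
  set A := Algebra.adjoin ℂ (Set.range π) with hA
  have hinvA : ∀ a ∈ A, B * (Bᴴ * (a * B)) = a * B := by
    intro a ha
    induction ha using Algebra.adjoin_induction with
    | mem x hx => obtain ⟨g, rfl⟩ := hx; exact hinv g
    | algebraMap r =>
      rw [Algebra.algebraMap_eq_smul_one, Matrix.smul_mul, Matrix.one_mul, Matrix.mul_smul, Matrix.mul_smul, hB, Matrix.mul_one]
    | add x y _ _ hx hy => rw [Matrix.add_mul, Matrix.mul_add, Matrix.mul_add, hx, hy]
    | mul x y _ _ hx hy =>
      have : x * y * B = x * B * (Bᴴ * (y * B)) := by rw [Matrix.mul_assoc, Matrix.mul_assoc, hy]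
      rw [this, ← Matrix.mul_assoc, ← Matrix.mul_assoc, Matrix.mul_assoc B Bᴴ, hx]
  let cm : A →ₐ[ℂ] Matrix n' n' ℂ := AlgHom.ofLinearMap
    { toFun := fun a => Bᴴ * ((a : Matrix n n ℂ) * B)
      map_add' := fun a b => by simp [Matrix.add_mul, Matrix.mul_add]
      map_smul' := fun c a => by simp }
    (by simp [hB])
    (by
      intro a b
      simp only [LinearMap.coe_mk, AddHom.coe_mk, MulMemClass.coe_mul]
      rw [Matrix.mul_assoc, Matrix.mul_assoc, Matrix.mul_assoc, hinvA b b.2])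
  have hcm : ∀ a : A, cm a = Bᴴ * ((a : Matrix n n ℂ) * B) := fun a => rfl
  have hπA : ∀ g, π g ∈ A := fun g => Algebra.subset_adjoin ⟨g, rfl⟩
  let πA : G q →* A :=
    { toFun := fun g => ⟨π g, hπA g⟩
      map_one' := by ext1; simp
      map_mul' := fun a b => by ext1; simp }
  let dA : Matrix (Fin q) (Fin q) ℂ →ₗ[ℂ] A :=
    { toFun := fun X => ⟨dπ X, h.mem X⟩
      map_add' := fun a b => by ext1; simp
      map_smul' := fun a b => by ext1; simp }
  refine ⟨(cm : A →* Matrix n' n' ℂ).comp πA, cm.toLinearMap.comp dA, ?_, fun g => rfl⟩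
  constructor
  · intro g
    change (Bᴴ * (π g * B))ᴴ = Bᴴ * (π g⁻¹ * B)
    rw [Matrix.conjTranspose_mul, Matrix.conjTranspose_mul, h.uni, Matrix.conjTranspose_conjTranspose, Matrix.mul_assoc]
  · intro g X
    change cm (πA g) * cm (dA X) * cm (πA g⁻¹) = cm (dA _)
    rw [← map_mul, ← map_mul]
    congr 1
    ext1
    exact h.conj g X
  · intro X Y
    change cm (dA X) * cm (dA Y) - cm (dA Y) * cm (dA X) = cm (dA _)
    rw [← map_mul cm, ← map_mul cm, ← map_sub]
    congr 1
    ext1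
    exact h.comm X Y
  · change cm (dA 1) = 0
    have : dA 1 = 0 := by ext1; exact h.one
    rw [this, map_zero]
  · intro j z
    obtain ⟨Q, hd, h0, hQ⟩ := h.expo j z
    refine ⟨Q, hd, h0, ?_⟩
    change cm (πA _) = Polynomial.aeval (cm (dA _)) Q
    rw [Polynomial.aeval_algHom_apply]
    congr 1
    ext1
    rw [← Subalgebra.coe_val, ← Polynomial.aeval_algHom_apply]
    exact hQ
  · intro X
    change cm (dA X) ∈ _
    have key : ∀ a (ha : a ∈ A), cm ⟨a, ha⟩ ∈ Algebra.adjoin ℂ (Set.range ((cm : A →* Matrix n' n' ℂ).comp πA)) := by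
      intro a ha
      induction ha using Algebra.adjoin_induction with
      | mem x hx =>
        obtain ⟨g, rfl⟩ := hx
        exact Algebra.subset_adjoin ⟨g, rfl⟩
      | algebraMap r =>
        have : cm (algebraMap ℂ A r) = algebraMap ℂ _ r := cm.commutes r
        exact this ▸ Subalgebra.algebraMap_mem _ r
      | add x y hx hy h1 h2 =>
        have : cm (⟨x, hx⟩ + ⟨y, hy⟩) = cm ⟨x, hx⟩ + cm ⟨y, hy⟩ := map_add _ _ _
        exact this ▸ add_mem h1 h2
      | mul x y hx hy h1 h2 =>
        have : cm (⟨x, hx⟩ * ⟨y, hy⟩) = cm ⟨x, hx⟩ * cm ⟨y, hy⟩ := map_mul _ _ _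
        exact this ▸ mul_mem h1 h2
    exact key _ (h.mem X)

end Rep
end SG

set_option linter.unusedSectionVars false
namespace SG
open MeasureTheory
open scoped Matrix

section Extract
variable {q m : ℕ} (t : ℕ) (p : Fin m → ℝ) (U : Fin m → G q) (l : ℝ)

/-- representation of dimension `D` with an eigenvector -/
def Cand (D : ℕ) : Prop := ∃ (π : G q →* Matrix (Fin D) (Fin D) ℂ) (dπ : Matrix (Fin q) (Fin q) ℂ →ₗ[ℂ] Matrix (Fin D) (Fin D) ℂ),
  IsRep q t π dπ ∧ ∃ f, f ≠ 0 ∧ Aav p U π *ᵥ f = (l : ℂ) • f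

variable {t p U l}
variable {n : Type} [Fintype n] [DecidableEq n] {π : G q →* Matrix n n ℂ}
    {dπ : Matrix (Fin q) (Fin q) ℂ →ₗ[ℂ] Matrix n n ℂ}

lemma mat_ext {a b : Type} [Fintype a] [Fintype b] [DecidableEq b] {M N : Matrix a b ℂ} (h : ∀ x, M *ᵥ x = N *ᵥ x) : M = N := by
  ext i j
  have := congrFun (h (Pi.single j 1)) i
  simpa using this

lemma IsRep.cand (h : IsRep q t π dπ) (Z : Submodule ℂ (n → ℂ)) (hZ : ∀ g, ∀ x ∈ Z, π g *ᵥ x ∈ Z) {x : n → ℂ} (hxZ : x ∈ Z)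
    (hx : x ≠ 0) (hA : Aav p U π *ᵥ x = (l : ℂ) • x) : Cand t p U l (Module.finrank ℂ Z) := by
  obtain ⟨B, hB, hBZ, hBx⟩ := exists_onv Z
  obtain ⟨π', dπ', h', hπ'⟩ := h.compress B hB (by
    intro g
    apply mat_ext
    intro y
    simp only [← Matrix.mulVec_mulVec]
    exact hBx _ (hZ g _ (hBZ y)))
  refine ⟨π', dπ', h', Bᴴ *ᵥ x, ?_, ?_⟩
  · intro h0
    apply hx
    rw [← hBx x hxZ, h0, Matrix.mulVec_zero]
  · have : Aav p U π' = Bᴴ * (Aav p U π * B) := by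
      simp only [Aav, hπ', Matrix.sum_mul, Matrix.mul_sum, Matrix.smul_mul, Matrix.mul_smul]
    rw [this, ← Matrix.mulVec_mulVec, ← Matrix.mulVec_mulVec, hBx x hxZ, hA, Matrix.mulVec_smul]

lemma aav_comm {A : Matrix n n ℂ} (hA : ∀ g, π g * A = A * π g) : Aav p U π * A = A * Aav p U π := by
  simp only [Aav, Finset.sum_mul, Finset.mul_sum, Matrix.smul_mul, Matrix.mul_smul, hA]

theorem extract {x : Idx q t → ℂ} (hx : x ≠ 0) (hA : Aav p U (tau q t) *ᵥ x = (l : ℂ) • x) :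
    ∃ (D : ℕ) (π : G q →* Matrix (Fin D) (Fin D) ℂ) (dπ : Matrix (Fin q) (Fin q) ℂ →ₗ[ℂ] Matrix (Fin D) (Fin D) ℂ),
      IsRep q t π dπ ∧ (∀ A : Matrix (Fin D) (Fin D) ℂ, (∀ g, π g * A = A * π g) → ∃ c : ℂ, A = c • 1) ∧
      ∃ f, nsq f = 1 ∧ Aav p U π *ᵥ f = (l : ℂ) • f := by
  classical
  have hex : ∃ D, Cand t p U l D := by
    let e : Ix q t ≃ Idx q t := Equiv.sumArrowEquivProdArrow _ _ _
    have hAe : Aav p U (tauS q t) = (Aav p U (tau q t)).submatrix e e := by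
      ext i j
      simp only [Aav, tauS_eq, Matrix.sum_apply, Matrix.smul_apply, Matrix.submatrix_apply]
      rfl
    refine ⟨_, (isRep_tauS q t).cand ⊤ (fun _ _ _ => trivial) (x := x ∘ e) trivial ?_ ?_⟩
    · intro h0; apply hx
      funext i
      have := congrFun h0 (e.symm i)
      simpa using this
    · rw [hAe, Matrix.submatrix_mulVec_equiv]
      have : (x ∘ e) ∘ e.symm = x := by funext i; simp
      rw [this, hA]; rfl
  obtain ⟨D, hD, hmin⟩ : ∃ D, Cand t p U l D ∧ ∀ D', Cand t p U l D' → D ≤ D' :=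
    ⟨Nat.find hex, Nat.find_spec hex, fun D' h' => Nat.find_min' hex h'⟩
  obtain ⟨π, dπ, h, f, hf, hAf⟩ := hD
  refine ⟨D, π, dπ, h, ?_, ?_⟩
  · intro A hAc
    let S := Matrix.toLin' (Aav p U π)
    let T := Matrix.toLin' A
    have hc := aav_comm (p := p) (U := U) hAc
    let K : Submodule ℂ (Fin D → ℂ) := LinearMap.ker (S - (l : ℂ) • LinearMap.id)
    have hK : ∀ y, y ∈ K ↔ Aav p U π *ᵥ y = (l : ℂ) • y := by
      intro y
      simp [K, S, LinearMap.mem_ker, sub_eq_zero]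
    have hTK : ∀ y ∈ K, T y ∈ K := by
      intro y hy
      rw [hK] at hy ⊢
      simp only [T, Matrix.toLin'_apply, Matrix.mulVec_mulVec]
      rw [hc, ← Matrix.mulVec_mulVec, hy, Matrix.mulVec_smul]
    have : Nontrivial K := ⟨⟨⟨f, (hK f).mpr hAf⟩, 0, fun h0 => hf (by simpa using congrArg Subtype.val h0)⟩⟩
    obtain ⟨c, hcv⟩ := Module.End.exists_eigenvalue (T.restrict hTK)
    obtain ⟨v, hv⟩ := hcv.exists_hasEigenvector
    have hv1 : A *ᵥ (v : Fin D → ℂ) = c • (v : Fin D → ℂ) := by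
      have := congrArg Subtype.val hv.apply_eq_smul
      simpa [T] using this
    have hv0 : (v : Fin D → ℂ) ≠ 0 := fun h0 => hv.2 (Subtype.ext h0)
    let Z : Submodule ℂ (Fin D → ℂ) := LinearMap.ker (T - c • LinearMap.id)
    have hZ : ∀ y, y ∈ Z ↔ A *ᵥ y = c • y := by
      intro y
      simp [Z, T, LinearMap.mem_ker, sub_eq_zero]
    have hcand := h.cand (p := p) (U := U) (l := l) Z (by
      intro g y hy
      rw [hZ] at hy ⊢
      rw [Matrix.mulVec_mulVec, ← hAc, ← Matrix.mulVec_mulVec, hy, Matrix.mulVec_smul]) ((hZ _).mpr hv1) hv0 ((hK _).mp v.2)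
    have hle := hmin _ hcand
    have htop : Z = ⊤ := by
      apply Submodule.eq_top_of_finrank_eq
      apply le_antisymm (Submodule.finrank_le Z)
      simpa using hle
    refine ⟨c, mat_ext fun y => ?_⟩
    rw [(hZ y).mp (htop ▸ trivial)]
    simp [Matrix.smul_mulVec]
  · have hpos := nsq_pos hf
    refine ⟨((Real.sqrt (nsq f))⁻¹ : ℂ) • f, ?_, ?_⟩
    · rw [nsq_smul]
      simp only [norm_inv, Complex.norm_real, Real.norm_eq_abs]
      rw [abs_of_nonneg (Real.sqrt_nonneg _), inv_pow, Real.sq_sqrt hpos.le, inv_mul_cancel₀ hpos.ne']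
    · rw [Matrix.mulVec_smul, hAf, smul_comm]

end Extract

section Irr
variable {q t : ℕ} {n : Type} [Fintype n] [DecidableEq n] {π : G q →* Matrix n n ℂ}
    {dπ : Matrix (Fin q) (Fin q) ℂ →ₗ[ℂ] Matrix n n ℂ} (h : IsRep q t π dπ)

/-- generators in the representation -/
noncomputable def Xg (dπ : Matrix (Fin q) (Fin q) ℂ →ₗ[ℂ] Matrix n n ℂ) (i : Fin (q * q)) : Matrix n n ℂ := dπ (gen q i)

lemma dpi_span (Y : Matrix (Fin q) (Fin q) ℂ) : dπ Y ∈ Submodule.span ℂ (Set.range (Xg dπ)) := by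
  rw [gen_span q Y, map_sum]
  refine Submodule.sum_mem _ fun i _ => ?_
  rw [map_smul]
  exact Submodule.smul_mem _ _ (Submodule.subset_span ⟨i, rfl⟩)

include h in
lemma Xg_comm (i j : Fin (q * q)) : Xg dπ i * Xg dπ j - Xg dπ j * Xg dπ i ∈ Submodule.span ℂ (Set.range (Xg dπ)) := by
  rw [Xg, Xg, h.comm]; exact dpi_span _

include h in
lemma conj_Wsp (g : G q) (k : ℕ) {Y : Matrix n n ℂ} (hY : Y ∈ Wsp (Xg dπ) k) : π g * Y * π g⁻¹ ∈ Wsp (Xg dπ) k := by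
  have hgg : π g⁻¹ * π g = 1 := by rw [← map_mul]; simp
  induction hY using Submodule.span_induction with
  | zero => simp
  | add x y _ _ hx hy => rw [mul_add, add_mul]; exact add_mem hx hy
  | smul c x _ hx => rw [mul_smul_comm, smul_mul_assoc]; exact Submodule.smul_mem _ _ hx
  | mem x hx =>
    obtain ⟨w, hw, rfl⟩ := hx
    refine Wsp_mono _ hw ?_
    clear hw
    induction w with
    | nil =>
      have : π g * π g⁻¹ = 1 := by rw [← map_mul]; simp
      simpa [this] using one_mem_Wsp (Xg dπ) 0
    | cons a w ih =>
      rw [List.map_cons, List.prod_cons, List.length_cons, add_comm]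
      have : π g * (Xg dπ a * (w.map (Xg dπ)).prod) * π g⁻¹ = (π g * Xg dπ a * π g⁻¹) * (π g * (w.map (Xg dπ)).prod * π g⁻¹) := by
        calc _ = π g * Xg dπ a * 1 * (w.map (Xg dπ)).prod * π g⁻¹ := by noncomm_ring
          _ = _ := by rw [← hgg]; noncomm_ring
      rw [this]
      refine Wsp_mul _ (Wsp_span _ ?_) ih
      rw [Xg, h.conj]; exact dpi_span _

include h in
lemma conj_P (hq : 1 ≤ q) (k : ℕ) {Y : Matrix n n ℂ} (hY : Y ∈ Wsp (Xg dπ) k) (i j : n) :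
    (fun g => (π g * Y * π g⁻¹) i j) ∈ P q k := by
  induction hY using Submodule.span_induction with
  | zero =>
    convert Submodule.zero_mem (P q k) using 1
    funext g; simp
  | add x y _ _ hx hy =>
    convert add_mem hx hy using 1
    funext g; simp [mul_add, add_mul]
  | smul c x _ hx =>
    convert Submodule.smul_mem _ c hx using 1
    funext g; simp
  | mem x hx =>
    obtain ⟨w, hw, rfl⟩ := hx
    refine P_mono q hq hw ?_
    clear hw
    induction w generalizing i j with
    | nil =>
      have : ∀ g, π g * π g⁻¹ = 1 := fun g => by rw [← map_mul]; simp
      simp only [List.map_nil, List.prod_nil, mul_one, this, List.length_nil]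
      have := Submodule.smul_mem _ ((1 : Matrix n n ℂ) i j) (one_mem_P q hq 0)
      convert this using 1
      funext g; simp
    | cons a w ih =>
      rw [List.map_cons, List.prod_cons, List.length_cons, add_comm]
      have : ∀ g, π g * (Xg dπ a * (w.map (Xg dπ)).prod) * π g⁻¹ = (π g * Xg dπ a * π g⁻¹) * (π g * (w.map (Xg dπ)).prod * π g⁻¹) := by
        intro g
        have hgg : π g⁻¹ * π g = 1 := by rw [← map_mul]; simp
        calc _ = π g * Xg dπ a * 1 * (w.map (Xg dπ)).prod * π g⁻¹ := by noncomm_ring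
          _ = _ := by rw [← hgg]; noncomm_ring
      simp only [this, Matrix.mul_apply (M := π _ * Xg dπ a * π _)]
      have hs : (fun g => ∑ r, (π g * Xg dπ a * π g⁻¹) i r * (π g * (w.map (Xg dπ)).prod * π g⁻¹) r j) =
        ∑ r, (fun g => (π g * Xg dπ a * π g⁻¹) i r) * (fun g => (π g * (w.map (Xg dπ)).prod * π g⁻¹) r j) := by
        funext g; simp
      rw [hs]
      refine Submodule.sum_mem _ fun r _ => P_mul q 1 _ ?_ (ih r j)
      have h2 : (fun g => (π g * Xg dπ a * π g⁻¹) i r) = ∑ b : Fin (q * q), (Xg dπ b i r) •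
          (fun g : G q => (g : Matrix (Fin q) (Fin q) ℂ) (finProdFinEquiv.symm b).1 (finProdFinEquiv.symm a).1 *
            (starRingEnd ℂ) ((g : Matrix (Fin q) (Fin q) ℂ) (finProdFinEquiv.symm b).2 (finProdFinEquiv.symm a).2)) := by
        funext g
        rw [Xg, h.conj, gen_span q (_ * _ * _), map_sum, Matrix.sum_apply, Finset.sum_apply]
        refine Finset.sum_congr rfl fun b _ => ?_
        rw [map_smul, Matrix.smul_apply, Pi.smul_apply, smul_eq_mul, smul_eq_mul, mul_comm]
        congr 1
        rw [gen, inv_coe, Matrix.mul_assoc, Matrix.mul_apply]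
        simp [Matrix.single_mul_apply_of_ne, Matrix.mul_apply, Matrix.single_apply, Finset.sum_ite_eq, ite_and]
      rw [h2]
      exact Submodule.sum_mem _ fun b _ => Submodule.smul_mem _ _ (entry_mem_P q _ _ _ _)

include h in
lemma pi_mem_Wsp (g : G q) : π g ∈ Wsp (Xg dπ) (q * (2 * t)) := by
  obtain ⟨V, z, rfl⟩ := unitary_diag g
  rw [map_mul, map_mul]
  apply conj_Wsp h
  refine Dg_induct q (Pr := fun k g => π g ∈ Wsp (Xg dπ) (k * (2 * t))) ?_ ?_ z
  · simpa using one_mem_Wsp (Xg dπ) 0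
  · intro k g j z hg
    rw [map_mul, add_mul, one_mul, add_comm]
    obtain ⟨Q, hd, -, hQ⟩ := h.expo j z
    rw [hQ]
    exact Wsp_mul _ (aeval_Wsp _ (Wsp_span _ (dpi_span _)) hd) hg

include h in
lemma Wsp_top (hsch : ∀ A : Matrix n n ℂ, (∀ g, π g * A = A * π g) → ∃ c : ℂ, A = c • 1) : Wsp (Xg dπ) (q * (2 * t)) = ⊤ := by
  rw [eq_top_iff, ← burnside h.uni hsch, Submodule.span_le]
  rintro _ ⟨g, rfl⟩
  exact pi_mem_Wsp h g

include h in
lemma card_one (hn : Fintype.card n = 1) (hq : 1 ≤ q) (g : G q) : π g = 1 := by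
  have : Subsingleton n := Fintype.card_le_one_iff_subsingleton.mp hn.le
  have hcomm : ∀ A B : Matrix n n ℂ, A * B = B * A := by
    intro A B
    ext i j
    obtain rfl := Subsingleton.elim i j
    rw [Matrix.mul_apply, Matrix.mul_apply]
    refine Finset.sum_congr rfl fun k _ => ?_
    obtain rfl := Subsingleton.elim i k
    ring
  have hE : ∀ i j : Fin q, dπ (Matrix.single i i 1) = dπ (Matrix.single j j 1) := by
    intro i j
    have := h.comm (Matrix.single i j 1) (Matrix.single j i 1)
    rw [hcomm, sub_self, Matrix.single_mul_single_same, Matrix.single_mul_single_same, map_sub, one_mul] at this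
    exact (sub_eq_zero.mp this.symm)
  have hE0 : ∀ j : Fin q, dπ (Matrix.single j j 1) = 0 := by
    intro j
    have h1 := h.one
    rw [← Matrix.diagonal_one, ← Matrix.sum_single_eq_diagonal, map_sum, Finset.sum_congr rfl (fun i _ => hE i j)] at h1
    simp only [Finset.sum_const, Finset.card_univ, Fintype.card_fin] at h1
    rw [← Nat.cast_smul_eq_nsmul ℂ] at h1
    have := smul_eq_zero.mp h1
    rcases this with h2 | h2
    · have : q = 0 := by exact_mod_cast h2
      omega
    · exact h2
  obtain ⟨V, z, rfl⟩ := unitary_diag g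
  have hz : π (Dg q z) = 1 := by
    refine Dg_induct q (Pr := fun _ g => π g = 1) (map_one π) ?_ z
    intro k g j z hg
    obtain ⟨Q, -, h0, hQ⟩ := h.expo j z
    rw [map_mul, hg, mul_one, hQ, hE0, ← Polynomial.coeff_zero_eq_aeval_zero', Polynomial.coeff_zero_eq_eval_zero, h0, map_one]
  rw [map_mul, map_mul, hz, mul_one, ← map_mul]
  simp

end Irr
end SG

set_option linter.unusedSectionVars false
namespace SG
open MeasureTheory
open scoped Matrix

section Final
variable {q m : ℕ} (p : Fin m → ℝ) (U : Fin m → G q) (μ : Measure (G q)) [μ.IsMulLeftInvariant] [IsProbabilityMeasure μ]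
variable (hp : ∀ k, 0 ≤ p k) (hpsum : ∑ k, p k = 1)

include hp hpsum in
theorem step (hq : 1 ≤ q) (huniv : ∀ t, beta p U μ t < 1) (t s : ℕ) (hs : 1 ≤ s) (hr : q * (2 * t) < s ^ 3)
    (hs2 : 2 * (q * q) * 50 ^ 2 ≤ s) :
    49 / 100 * (1 - beta p U μ (2 * (q * q * s ^ 2))) ≤ 1 - beta p U μ t ∨
      1 / 4 * (1 - beta p U μ 20000) ≤ 1 - beta p U μ t := by
  rcases (beta_nonneg p U μ t).eq_or_lt with h0 | hpos
  · left
    rw [← h0]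
    have := beta_nonneg p U μ (2 * (q * q * s ^ 2))
    linarith
  obtain ⟨x, hx, -, hAx⟩ := exists_eigvec p U μ hpsum t hpos
  obtain ⟨D, π, dπ, h, hsch, f, hf, hAf⟩ := extract hx hAx
  have hD0 : D ≠ 0 := by
    rintro rfl
    simp [nsq] at hf
  have : Nonempty (Fin D) := ⟨⟨0, Nat.pos_of_ne_zero hD0⟩⟩
  have hl : (star f ⬝ᵥ (Aav p U π *ᵥ f)).re = beta p U μ t := by
    rw [hAf, dotProduct_smul, star_dot_self, hf]; simp
  have hD1 : D ≠ 1 := by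
    intro h1
    have hone := card_one h (by simp [h1]) hq
    have hA1 : Aav p U π = 1 := by
      simp only [Aav, hone]
      simp only [← Finset.sum_smul]
      rw [wsum p hpsum, one_smul]
    rw [hA1, Matrix.one_mulVec, star_dot_self, hf] at hl
    have := huniv t
    rw [← hl] at this
    simp at this
  have hD2 : 2 ≤ D := by omega
  have hfr : Module.finrank ℂ (Matrix (Fin D) (Fin D) ℂ) = D * D := by
    rw [Module.finrank_matrix]; simp
  obtain ⟨htop, hpb⟩ := pbw (Xg dπ) (Xg_comm h) (q * (2 * t)) (Wsp_top h hsch)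
  have key : ∀ k, (1 - beta p U μ (2 * k)) * ((Module.finrank ℂ (Wsp (Xg dπ) k) : ℝ) / D - 1) ≤
      2 * ((Module.finrank ℂ (Wsp (Xg dπ) k) : ℝ) / D) * (1 - beta p U μ t) := by
    intro k
    have := key_sub p U hp hpsum h.uni hsch μ (k := k) (Wsp (Xg dπ) k) (fun g X hX => conj_Wsp h g k hX)
      (fun X hX i j => conj_P h hq k hX i j) hf hl
    simpa using this
  have hDr : (2:ℝ) ≤ D := by exact_mod_cast hD2
  by_cases hDC : 100 ≤ D
  · left
    have hb := hpb s hs hr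
    have hk := key (q * q * s ^ 2)
    rw [hfr] at hb
    set w := Module.finrank ℂ (Wsp (Xg dπ) (q * q * s ^ 2)) with hw
    have hwD : 50 * D ≤ w := by
      by_contra hlt
      push Not at hlt
      have hlt' : (w:ℝ) < 50 * D := by exact_mod_cast hlt
      have hb' : (D:ℝ) * D * s ≤ w * s + (q * q) * w ^ 2 := by exact_mod_cast hb
      have hs2' : 2 * ((q:ℝ) * q) * 50 ^ 2 ≤ s := by exact_mod_cast hs2
      have hDC' : (100:ℝ) ≤ D := by exact_mod_cast hDC
      have hs' : (1:ℝ) ≤ s := by exact_mod_cast hs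
      have hw0 : (0:ℝ) ≤ w := by positivity
      have hq0 : (0:ℝ) ≤ (q:ℝ) * q := by positivity
      have h1 : (w:ℝ) * s < 50 * D * s := by nlinarith
      have h2 : (w:ℝ) ^ 2 ≤ (50 * D) ^ 2 := by gcongr
      have h3 : (q * q : ℝ) * w ^ 2 ≤ (q * q) * (50 * D) ^ 2 := by gcongr
      have h4 : ((q:ℝ) * q) * (50 * D) ^ 2 ≤ s / 2 * D ^ 2 := by
        have : ((q:ℝ) * q) * (50 * D) ^ 2 = (2 * ((q:ℝ) * q) * 50 ^ 2) / 2 * D ^ 2 := by ring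
        rw [this]; gcongr
      have h5 : 50 * (D:ℝ) * s ≤ D * D * s / 2 := by
        have : 0 ≤ (D:ℝ) * s := by positivity
        nlinarith
      nlinarith
    have hwD' : (50:ℝ) * D ≤ w := by exact_mod_cast hwD
    have hy : (50:ℝ) ≤ w / D := by rw [le_div_iff₀ (by linarith)]; exact hwD'
    generalize (w:ℝ) / D = y at hk hy
    have hg := huniv (2 * (q * q * s ^ 2))
    set a := 1 - beta p U μ (2 * (q * q * s ^ 2))
    have ha : 0 < a := by simp only [a]; linarith
    set b := 1 - beta p U μ t
    have h6 : 49 / 50 * y ≤ y - 1 := by linarith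
    have h7 : a * (49/50 * y) ≤ 2 * y * b := le_trans (mul_le_mul_of_nonneg_left h6 ha.le) hk
    have h8 : y * (49/100 * a) ≤ y * b := by linarith
    exact le_of_mul_le_mul_left h8 (by linarith)
  · right
    have hk := key (D * D)
    rw [hfr] at htop
    have hft : Module.finrank ℂ (Wsp (Xg dπ) (D * D)) = D * D := by rw [htop, finrank_top, hfr]
    rw [hft] at hk
    have hy : (((D * D : ℕ) : ℝ)) / D = D := by push_cast; field_simp
    rw [hy] at hk
    have hmono : beta p U μ (2 * (D * D)) ≤ beta p U μ 20000 := beta_mono p U μ hpsum hq (by nlinarith)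
    have hg := huniv 20000
    set a := 1 - beta p U μ (2 * (D * D)) with ha'
    set b := 1 - beta p U μ t
    set c := 1 - beta p U μ 20000 with hc
    have ha : c ≤ a := by linarith
    have hc0 : 0 < c := by linarith
    have h7 : a * (1 / 2 * D) ≤ 2 * D * b := le_trans (mul_le_mul_of_nonneg_left (by linarith) (by linarith)) hk
    have h8 : (D:ℝ) * (1/4 * a) ≤ D * b := by linarith
    have h9 := le_of_mul_le_mul_left h8 (by linarith)
    linarith

lemma choose_s (q : ℕ) (hq : 1 ≤ q) : ∃ t1 : ℕ, ∀ t : ℕ, t1 ≤ t → ∃ s : ℕ, 1 ≤ s ∧ q * (2 * t) < s ^ 3 ∧ 2 * (q * q) * 50 ^ 2 ≤ s ∧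
    ((2 * (q * q * s ^ 2) : ℕ) : ℝ) ≤ (t:ℝ) ^ (0.7 : ℝ) := by
  have T : ∀ a : ℝ, 0 < a → ∀ c : ℝ, ∀ᶠ t : ℕ in Filter.atTop, c < (t:ℝ) ^ a := fun a ha c =>
    ((tendsto_rpow_atTop ha).comp tendsto_natCast_atTop_atTop).eventually_gt_atTop c
  have hev := (((T 0.035 (by norm_num) (2 * q)).and (T 0.01 (by norm_num) (8 * (q * q)))).and
    ((T 0.345 (by norm_num) (2 * (q * q) * 50 ^ 2)).and (T 0.345 (by norm_num) 1))).and (Filter.eventually_ge_atTop 1)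
  obtain ⟨t1, ht1⟩ := Filter.eventually_atTop.mp hev
  refine ⟨t1, fun t ht => ?_⟩
  obtain ⟨⟨⟨h1, h2⟩, h3, h4⟩, h5⟩ := ht1 t ht
  have ht0 : (0:ℝ) < t := by exact_mod_cast h5
  set x := (t:ℝ) ^ (0.345:ℝ) with hx
  have hxs : x ≤ ⌈x⌉₊ := Nat.le_ceil x
  have hxs2 : (⌈x⌉₊ : ℝ) < x + 1 := Nat.ceil_lt_add_one (by linarith)
  refine ⟨⌈x⌉₊, ?_, ?_, ?_, ?_⟩
  · exact_mod_cast (by linarith : (1:ℝ) ≤ ⌈x⌉₊)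
  · have hx3 : x ^ 3 = t * (t:ℝ) ^ (0.035:ℝ) := by
      rw [hx, ← Real.rpow_natCast, ← Real.rpow_mul ht0.le]
      conv_rhs => rw [← Real.rpow_one (t:ℝ), Real.rpow_one, ← Real.rpow_one_add' ht0.le (by norm_num)]
      norm_num
    have : (q:ℝ) * (2 * t) < (⌈x⌉₊:ℝ) ^ 3 := by
      calc (q:ℝ) * (2 * t) = t * (2 * q) := by ring
        _ < t * (t:ℝ) ^ (0.035:ℝ) := by gcongr
        _ = x ^ 3 := hx3.symm
        _ ≤ _ := by gcongr
    exact_mod_cast this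
  · have : (2:ℝ) * (q * q) * 50 ^ 2 ≤ ⌈x⌉₊ := by linarith
    exact_mod_cast this
  · have hx2 : (t:ℝ) ^ (0.7:ℝ) = x ^ 2 * (t:ℝ) ^ (0.01:ℝ) := by
      rw [hx, ← Real.rpow_natCast, ← Real.rpow_mul ht0.le, ← Real.rpow_add ht0]
      norm_num
    rw [hx2]
    push_cast
    have : (⌈x⌉₊:ℝ) ≤ 2 * x := by linarith
    calc 2 * ((q:ℝ) * q * (⌈x⌉₊:ℝ) ^ 2) ≤ 2 * ((q:ℝ) * q * (2 * x) ^ 2) := by gcongr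
      _ = x ^ 2 * (8 * (q * q)) := by ring
      _ ≤ _ := by gcongr

include hp hpsum in
theorem gap_beta (hq : 1 ≤ q) (huniv : ∀ t, beta p U μ t < 1) : ∃ B : ℝ, 0 < B ∧ ∀ t : ℕ, 2 ≤ t →
    B / Real.log t ^ 2 ≤ 1 - beta p U μ t := by
  obtain ⟨t1, ht1⟩ := choose_s q hq
  set T := max t1 20000 with hT
  have hmono := beta_mono p U μ hpsum hq
  have hgT : 0 < 1 - beta p U μ T := by linarith [huniv T]
  have hl2 : 0 < Real.log 2 := Real.log_pos (by norm_num)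
  set g := 1 - beta p U μ T with hg
  refine ⟨g / 4 * Real.log 2 ^ 2, by positivity, ?_⟩
  intro t
  induction t using Nat.strong_induction_on with
  | _ t ih =>
    intro ht
    have hlt : Real.log 2 ≤ Real.log t := Real.log_le_log (by norm_num) (by exact_mod_cast ht)
    have hlt0 : 0 < Real.log t := by linarith
    have hbase : g / 4 * Real.log 2 ^ 2 / Real.log t ^ 2 ≤ g / 4 := by
      rw [div_le_iff₀ (by positivity)]
      gcongr
    by_cases htT : t ≤ T
    · have := hmono htT
      linarith
    · push Not at htT
      have h1 : t1 < t := lt_of_le_of_lt (le_max_left _ _) htT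
      obtain ⟨s, hs, hr, hs2, hle⟩ := ht1 t h1.le
      rcases step p U μ hp hpsum hq huniv t s hs hr hs2 with h | h
      · set t' := 2 * (q * q * s ^ 2) with ht'
        have ht'2 : 2 ≤ t' := by
          have : 1 ≤ q * q * s ^ 2 := Nat.mul_pos (Nat.mul_pos hq hq) (pow_pos hs 2)
          omega
        have ht1' : (1:ℝ) < t := by exact_mod_cast ht
        have ht'lt : t' < t := by
          have : (t':ℝ) < t := lt_of_le_of_lt hle (by
            conv_rhs => rw [← Real.rpow_one (t:ℝ)]
            exact Real.rpow_lt_rpow_of_exponent_lt ht1' (by norm_num))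
          exact_mod_cast this
        have hi := ih t' ht'lt ht'2
        have hlog : Real.log t' ≤ 0.7 * Real.log t := by
          rw [← Real.log_rpow (by linarith)]
          exact Real.log_le_log (by positivity) hle
        have hlog0 : 0 < Real.log t' := Real.log_pos (by exact_mod_cast ht'2)
        have hsq : Real.log t' ^ 2 ≤ 49 / 100 * Real.log t ^ 2 := by
          calc _ ≤ (0.7 * Real.log t) ^ 2 := by gcongr
            _ = _ := by ring
        refine le_trans ?_ h
        refine le_trans ?_ (mul_le_mul_of_nonneg_left hi (by norm_num))
        rw [mul_div_assoc', div_le_div_iff₀ (by positivity) (by positivity)]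
        have : 0 < g / 4 * Real.log 2 ^ 2 := by positivity
        nlinarith
      · have : beta p U μ 20000 ≤ beta p U μ T := hmono (le_max_right _ _)
        linarith

include hp hpsum in
theorem part_a (hq : 1 ≤ q) (huniv : IsUniversalGateSet q (Supp p U)) : ∃ B : ℝ, 0 < B ∧ ∀ t : ℕ, 2 ≤ t →
    1 - opNorm (momentOp q t m p U - MHaarOp q t μ) > B / Real.log t ^ 2 := by
  obtain ⟨B, hB, h⟩ := gap_beta p U μ hp hpsum hq (beta_lt_one p U μ hp hpsum huniv)
  refine ⟨B / 4, by positivity, fun t ht => ?_⟩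
  have h1 := h t ht
  have h2 := opNorm_le_one p U μ hp hpsum t
  have hlt0 : 0 < Real.log t := Real.log_pos (by exact_mod_cast ht)
  have h3 : 0 < B / Real.log t ^ 2 := by positivity
  have h4 : B / 4 / Real.log t ^ 2 = (B / Real.log t ^ 2) / 4 := by ring
  rw [h4]
  simp only [beta] at h1
  nlinarith

end Final
end SG

/-- Lemma S12.  Write `Δ_ν^{(t)} := 1 - ‖M_ν^{(t)} - M_Haar^{(t)}‖`.
(a) If the support of `ν†∗ν` is a universal gate set, then there is `B > 0` with
`Δ_ν^{(t)} > B (log t)⁻²` for all `t ≥ 2`.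
(b) If it is not, then `Δ_ν^{(t)} = 0` for all sufficiently large `t`. -/
theorem spectral_gap_dichotomy
    (q m : ℕ) (hq : 1 ≤ q) (hm : 1 ≤ m)
    (p : Fin m → ℝ) (hp : ∀ k, 0 ≤ p k) (hpsum : ∑ k, p k = 1)
    (U : Fin m → Matrix.unitaryGroup (Fin q) ℂ)
    (μ : Measure (Matrix.unitaryGroup (Fin q) ℂ))
    [μ.IsMulLeftInvariant] [IsProbabilityMeasure μ] :
    (IsUniversalGateSet q {W | ∃ j k, 0 < p j * p k ∧ star (U j) * U k = W} →
      ∃ B : ℝ, 0 < B ∧ ∀ t : ℕ, 2 ≤ t →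
        1 - opNorm (momentOp q t m p U - MHaarOp q t μ) > B / Real.log t ^ 2) ∧
    (¬ IsUniversalGateSet q {W | ∃ j k, 0 < p j * p k ∧ star (U j) * U k = W} →
      ∃ t₀ : ℕ, ∀ t : ℕ, t₀ ≤ t →
        1 - opNorm (momentOp q t m p U - MHaarOp q t μ) = 0) := by
  exact ⟨fun h => SG.part_a p U μ hp hpsum hq h, fun h => SG.part_b p U μ hp hpsum hq h⟩
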